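/- arXiv:2105.03922 — 2 statements merged into one kernel-verified Lean document; each statement's English description precedes it below -/
import Mathlib

section
/- Let β, σ ∈ (0,∞), let ξ(x) = |x|^{−σ}, and let V: (0,∞) → [0,∞) be twice differentiable and increasing. Assume there exist R, B, D ∈ (0,∞) such that for all s ≥ R: V'(s) ≥ D s⁷ and sV'(s) ≥ B V(s), and assume V''(s) > 0 for all large s with (V'(s))²/V''(s) → ∞ as s → ∞. Set U(x,z) = V(βN(x,z) + ξ(x)) (defined for x ≠ 0) and assume 0 < Z := ∫ e^{−U} dλ < ∞. Then the probability measure dμ_U = Z⁻¹ e^{−U} dλ satisfies the logarithmic Sobolev inequality: there exists c ∈ (0,∞) such that μ_U(f² log(f²/μ_U(f²))) ≤ c μ_U(|∇f|²) for every smooth compactly supported f. -/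
open Real MeasureTheory Filter

/-- Horizontal vector field `X₁ = ∂/∂x₁ + (x₂/2)∂/∂z` on the Heisenberg group `ℝ³`. -/
noncomputable def X1 (f : ℝ × ℝ × ℝ → ℝ) (p : ℝ × ℝ × ℝ) : ℝ :=
  fderiv ℝ f p (1, 0, 0) + (p.2.1 / 2) * fderiv ℝ f p (0, 0, 1)

/-- Horizontal vector field `X₂ = ∂/∂x₂ − (x₁/2)∂/∂z` on the Heisenberg group `ℝ³`. -/
noncomputable def X2 (f : ℝ × ℝ × ℝ → ℝ) (p : ℝ × ℝ × ℝ) : ℝ :=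
  fderiv ℝ f p (0, 1, 0) - (p.1 / 2) * fderiv ℝ f p (0, 0, 1)

/-- The Kaplan norm `N(x₁,x₂,z) = (|x|⁴ + 16 z²)^(1/4)` on the Heisenberg group. -/
noncomputable def NH (p : ℝ × ℝ × ℝ) : ℝ :=
  ((p.1 ^ 2 + p.2.1 ^ 2) ^ 2 + 16 * p.2.2 ^ 2) ^ ((1 : ℝ) / 4)

/-- The energy `U(x,z) = V(β N(x,z) + |x|^(−σ))`. -/
noncomputable def UH (β σ : ℝ) (V : ℝ → ℝ) (p : ℝ × ℝ × ℝ) : ℝ :=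
  V (β * NH p + Real.sqrt (p.1 ^ 2 + p.2.1 ^ 2) ^ (-σ))

/-- The normalized Gibbs measure `Z⁻¹ e^{−U} dλ`. -/
noncomputable def gibbsP {E : Type*} [MeasureSpace E] (U : E → ℝ) : Measure E :=
  (ENNReal.ofReal (∫ p, Real.exp (-(U p))))⁻¹ •
    (volume.withDensity fun p => ENNReal.ofReal (Real.exp (-(U p))))

open Real MeasureTheory Filter

namespace HeisLSI

/-- flow of `X1` -/
noncomputable def fl1 (s : ℝ) (p : ℝ × ℝ × ℝ) : ℝ × ℝ × ℝ := (p.1 + s, p.2.1, p.2.2 + s * (p.2.1 / 2))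
/-- flow of `X2` -/
noncomputable def fl2 (s : ℝ) (p : ℝ × ℝ × ℝ) : ℝ × ℝ × ℝ := (p.1, p.2.1 + s, p.2.2 - s * (p.1 / 2))

lemma continuous_fl1 : Continuous (fun q : ℝ × (ℝ × ℝ × ℝ) => fl1 q.1 q.2) := by
  unfold fl1; fun_prop
lemma continuous_fl2 : Continuous (fun q : ℝ × (ℝ × ℝ × ℝ) => fl2 q.1 q.2) := by
  unfold fl2; fun_prop

lemma mp_fl1 (s : ℝ) : MeasurePreserving (fl1 s) volume volume := by
  have h2 : ∀ b : ℝ, Measure.map (fun c : ℝ => c + s * (b / 2)) volume = volume :=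
    fun b => (measurePreserving_add_right volume (s * (b / 2))).map_eq
  have h1 : MeasurePreserving (fun q : ℝ × ℝ => (id q.1, q.2 + s * (q.1 / 2)))
      (volume.prod volume) (volume.prod volume) :=
    MeasurePreserving.skew_product (g := fun b c => c + s * (b / 2)) (MeasurePreserving.id volume)
      (by unfold Function.uncurry; fun_prop) (ae_of_all _ h2)
  have h3 := MeasurePreserving.skew_product
    (g := fun (_ : ℝ) (q : ℝ × ℝ) => (id q.1, q.2 + s * (q.1 / 2)))
    (measurePreserving_add_right (volume : Measure ℝ) s)
    (by unfold Function.uncurry; simp only [id]; fun_prop) (ae_of_all _ fun _ => h1.map_eq)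
  exact h3

lemma mp_fl2 (s : ℝ) : MeasurePreserving (fl2 s) volume volume := by
  have h2 : ∀ a : ℝ, ∀ b : ℝ, Measure.map (fun c : ℝ => c - s * (a / 2)) volume = volume :=
    fun a _ => (measurePreserving_sub_right volume (s * (a / 2))).map_eq
  have h1 : ∀ a : ℝ, MeasurePreserving (fun q : ℝ × ℝ => (q.1 + s, q.2 - s * (a / 2)))
      (volume.prod volume) (volume.prod volume) := fun a =>
    MeasurePreserving.skew_product (g := fun b c => c - s * (a / 2))
      (measurePreserving_add_right (volume : Measure ℝ) s)
      (by unfold Function.uncurry; fun_prop) (ae_of_all _ (h2 a))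
  have h3 := MeasurePreserving.skew_product
    (g := fun (a : ℝ) (q : ℝ × ℝ) => (q.1 + s, q.2 - s * (a / 2)))
    (MeasurePreserving.id (volume : Measure ℝ))
    (by unfold Function.uncurry; fun_prop) (ae_of_all _ fun a => (h1 a).map_eq)
  exact h3

lemma cs1d {a : ℝ} (ha : 0 ≤ a) {F d : ℝ → ℝ}
    (hF : ∀ s ∈ Set.Icc 0 a, HasDerivAt F (d s) s) (hd : ContinuousOn d (Set.Icc 0 a)) :
    ENNReal.ofReal ((F a - F 0) ^ 2) ≤
      ENNReal.ofReal a * ∫⁻ s in Set.Ioc 0 a, ENNReal.ofReal (d s ^ 2) := by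
  rcases ha.eq_or_lt with rfl | hpos
  · simp
  have hd' : ContinuousOn d (Set.uIcc 0 a) := by rwa [Set.uIcc_of_le ha]
  have hI : IntervalIntegrable d volume 0 a := hd'.intervalIntegrable
  have hI2 : IntervalIntegrable (fun s => d s ^ 2) volume 0 a := (hd'.pow 2).intervalIntegrable
  have h1 : ∫ s in (0:ℝ)..a, d s = F a - F 0 :=
    intervalIntegral.integral_eq_sub_of_hasDerivAt (by rwa [Set.uIcc_of_le ha]) hI
  set m := (F a - F 0) / a with hm
  have h0 : 0 ≤ ∫ s in (0:ℝ)..a, (d s - m) ^ 2 :=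
    intervalIntegral.integral_nonneg ha fun s _ => sq_nonneg _
  have h2 : ∫ s in (0:ℝ)..a, (d s - m) ^ 2
      = (∫ s in (0:ℝ)..a, d s ^ 2) - 2 * m * (F a - F 0) + m ^ 2 * a := by
    have e : (fun s => (d s - m) ^ 2) = fun s => d s ^ 2 - (2 * m) * d s + m ^ 2 := by
      ext s; ring
    rw [e, intervalIntegral.integral_add (hI2.sub (hI.const_mul _)) intervalIntegrable_const,
      intervalIntegral.integral_sub hI2 (hI.const_mul _), intervalIntegral.integral_const_mul, h1]
    simp; ring
  have h3 : (F a - F 0) ^ 2 ≤ a * ∫ s in (0:ℝ)..a, d s ^ 2 := by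
    have e : F a - F 0 = m * a := by rw [hm]; field_simp
    rw [h2, e] at h0
    rw [e]; nlinarith
  have h4 : ENNReal.ofReal (∫ s in (0:ℝ)..a, d s ^ 2)
      = ∫⁻ s in Set.Ioc 0 a, ENNReal.ofReal (d s ^ 2) := by
    rw [intervalIntegral.integral_of_le ha]
    apply ofReal_integral_eq_lintegral_ofReal
    · exact (intervalIntegrable_iff_integrableOn_Ioc_of_le ha).1 hI2
    · exact ae_of_all _ fun s => sq_nonneg _
  rw [← h4, ← ENNReal.ofReal_mul ha]
  exact ENNReal.ofReal_le_ofReal h3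

lemma lint_flow {Φ : ℝ → (ℝ × ℝ × ℝ) → (ℝ × ℝ × ℝ)}
    (hc : Continuous (fun q : ℝ × (ℝ × ℝ × ℝ) => Φ q.1 q.2))
    (hmp : ∀ s, MeasurePreserving (Φ s) volume volume)
    {D : ℝ × ℝ × ℝ → ENNReal} (hD : Measurable D) (a : ℝ) :
    ∫⁻ p, (ENNReal.ofReal a * ∫⁻ s in Set.Ioc 0 a, D (Φ s p)) =
      ENNReal.ofReal a * (ENNReal.ofReal a * ∫⁻ p, D p) := by
  have hm : Measurable (fun q : (ℝ × ℝ × ℝ) × ℝ => D (Φ q.2 q.1)) :=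
    hD.comp (hc.comp continuous_swap).measurable
  rw [lintegral_const_mul _ hm.lintegral_prod_right', lintegral_lintegral_swap hm.aemeasurable]
  simp_rw [fun s => (hmp s).lintegral_comp hD]
  simp [mul_comm]

lemma meas_flow {Φ : ℝ → (ℝ × ℝ × ℝ) → (ℝ × ℝ × ℝ)}
    (hc : Continuous (fun q : ℝ × (ℝ × ℝ × ℝ) => Φ q.1 q.2))
    {D : ℝ × ℝ × ℝ → ENNReal} (hD : Measurable D) (a : ℝ) :
    Measurable (fun p => ENNReal.ofReal a * ∫⁻ s in Set.Ioc 0 a, D (Φ s p)) := by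
  have hm : Measurable (fun q : (ℝ × ℝ × ℝ) × ℝ => D (Φ q.2 q.1)) :=
    hD.comp (hc.comp continuous_swap).measurable
  exact hm.lintegral_prod_right'.const_mul _

/-- one step estimate -/
def Step (Φ : ℝ → (ℝ × ℝ × ℝ) → (ℝ × ℝ × ℝ)) (f : ℝ × ℝ × ℝ → ℝ) (D : ℝ × ℝ × ℝ → ENNReal)
    (a : ℝ) (p : ℝ × ℝ × ℝ) : Prop :=
  ENNReal.ofReal ((f (Φ a p) - f p) ^ 2) ≤ ENNReal.ofReal a * ∫⁻ s in Set.Ioc 0 a, D (Φ s p)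

/-- three-step path -/
noncomputable def pth (a b c : ℝ) (p : ℝ × ℝ × ℝ) : ℝ × ℝ × ℝ := fl1 c (fl2 b (fl1 a p))

lemma path_bound {f : ℝ × ℝ × ℝ → ℝ} {D : ℝ × ℝ × ℝ → ENNReal} (hD : Measurable D)
    {A : Set (ℝ × ℝ × ℝ)} {a b c : ℝ} (ha : 0 ≤ a) (hb : 0 ≤ b) (hc : 0 ≤ c)
    (hA : MeasurableSet A)
    (h : ∀ᵐ p, p ∈ A → Step fl1 f D a p ∧ Step fl2 f D b (fl1 a p) ∧
      Step fl1 f D c (fl2 b (fl1 a p))) :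
    ∫⁻ p in A, ENNReal.ofReal ((f (pth a b c p) - f p) ^ 2) ≤
      ENNReal.ofReal (3 * (a ^ 2 + b ^ 2 + c ^ 2)) * ∫⁻ p, D p := by
  set h1 : ℝ × ℝ × ℝ → ENNReal := fun p => ENNReal.ofReal a * ∫⁻ s in Set.Ioc 0 a, D (fl1 s p)
  set h2 : ℝ × ℝ × ℝ → ENNReal := fun p => ENNReal.ofReal b * ∫⁻ s in Set.Ioc 0 b, D (fl2 s p)
  set h3 : ℝ × ℝ × ℝ → ENNReal := fun p => ENNReal.ofReal c * ∫⁻ s in Set.Ioc 0 c, D (fl1 s p)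
  have m1 : Measurable h1 := meas_flow continuous_fl1 hD a
  have m2 : Measurable h2 := meas_flow continuous_fl2 hD b
  have m3 : Measurable h3 := meas_flow continuous_fl1 hD c
  have key : ∀ᵐ p, p ∈ A → ENNReal.ofReal ((f (pth a b c p) - f p) ^ 2) ≤
      3 * (h1 p + h2 (fl1 a p) + h3 (fl2 b (fl1 a p))) := by
    filter_upwards [h] with p hp hpA
    obtain ⟨s1, s2, s3⟩ := hp hpA
    refine le_trans ?_ (mul_le_mul_right (add_le_add (add_le_add s1 s2) s3) 3)
    rw [← ENNReal.ofReal_add (sq_nonneg _) (sq_nonneg _),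
      ← ENNReal.ofReal_add (by positivity) (sq_nonneg _)]
    rw [show (3 : ENNReal) = ENNReal.ofReal 3 by simp, ← ENNReal.ofReal_mul (by norm_num)]
    apply ENNReal.ofReal_le_ofReal
    unfold pth
    set u := f (fl1 c (fl2 b (fl1 a p)))
    set v := f (fl2 b (fl1 a p))
    set w := f (fl1 a p)
    nlinarith [sq_nonneg ((u - v) - (v - w)), sq_nonneg ((v - w) - (w - f p)),
      sq_nonneg ((u - v) - (w - f p))]
  calc _ ≤ ∫⁻ p in A, 3 * (h1 p + h2 (fl1 a p) + h3 (fl2 b (fl1 a p))) :=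
        lintegral_mono_ae ((ae_restrict_iff' hA).2 key)
    _ ≤ ∫⁻ p, 3 * (h1 p + h2 (fl1 a p) + h3 (fl2 b (fl1 a p))) :=
        lintegral_mono' Measure.restrict_le_self le_rfl
    _ = 3 * ((∫⁻ p, h1 p) + (∫⁻ p, h2 (fl1 a p)) + ∫⁻ p, h3 (fl2 b (fl1 a p))) := by
        have k1 : Measurable (fun p => h2 (fl1 a p)) := m2.comp (mp_fl1 a).measurable
        have k2 : Measurable (fun p => h1 p + h2 (fl1 a p)) := m1.add k1
        rw [lintegral_const_mul' _ _ (by simp), lintegral_add_left k2,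
          lintegral_add_left m1]
    _ = _ := by
        have k3 : Measurable (fun p => h3 (fl2 b p)) := m3.comp (mp_fl2 b).measurable
        rw [(mp_fl1 a).lintegral_comp m2, (mp_fl1 a).lintegral_comp k3, (mp_fl2 b).lintegral_comp m3,
          lint_flow continuous_fl1 mp_fl1 hD, lint_flow continuous_fl2 mp_fl2 hD,
          lint_flow continuous_fl1 mp_fl1 hD]
        rw [ENNReal.ofReal_mul (by norm_num), ENNReal.ofReal_add (by positivity) (sq_nonneg _),
          ENNReal.ofReal_add (sq_nonneg _) (sq_nonneg _), ENNReal.ofReal_pow ha,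
          ENNReal.ofReal_pow hb, ENNReal.ofReal_pow hc]
        simp; ring

/-- change of variables in `(a,c)` -/
lemma cv {F : ℝ × ℝ × ℝ → ENNReal} (hF : Measurable F) {b : ℝ} (hb : 0 < b) (p : ℝ × ℝ × ℝ) :
    ∫⁻ a, ∫⁻ c, F (pth a b c p) = ENNReal.ofReal b⁻¹ * ∫⁻ u, ∫⁻ w, F (u, p.2.1 + b, w) := by
  have e1 : ∀ a : ℝ, ∫⁻ c, F (pth a b c p) = ∫⁻ u, F (u, p.2.1 + b,
      (p.2.2 - b * p.1 / 2 + (u - p.1) * (p.2.1 + b) / 2) + (-b) * a) := by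
    intro a
    rw [← lintegral_add_right_eq_self (fun u => F (u, p.2.1 + b,
      (p.2.2 - b * p.1 / 2 + (u - p.1) * (p.2.1 + b) / 2) + (-b) * a)) (p.1 + a)]
    congr 1; ext c
    simp only [pth, fl1, fl2]
    congr 2
    · ring
    · congr 1; ring
  simp_rw [e1]
  rw [lintegral_lintegral_swap]
  swap
  · apply Measurable.aemeasurable
    apply hF.comp
    fun_prop
  have e2 : ∀ u : ℝ, ∫⁻ a, F (u, p.2.1 + b,
      (p.2.2 - b * p.1 / 2 + (u - p.1) * (p.2.1 + b) / 2) + (-b) * a)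
      = ENNReal.ofReal b⁻¹ * ∫⁻ w, F (u, p.2.1 + b, w) := by
    intro u
    set K := (p.2.2 - b * p.1 / 2 + (u - p.1) * (p.2.1 + b) / 2)
    have hG : Measurable (fun w => F (u, p.2.1 + b, K + w)) := hF.comp (by fun_prop)
    have : ∫⁻ a, F (u, p.2.1 + b, K + (-b) * a)
        = ∫⁻ w, F (u, p.2.1 + b, K + w) ∂(Measure.map (fun x => (-b) * x) volume) := by
      rw [lintegral_map hG (by fun_prop)]
    rw [this, Real.map_volume_mul_left (by linarith), lintegral_smul_measure,
      lintegral_add_left_eq_self (fun w => F (u, p.2.1 + b, w)) K]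
    rw [inv_neg, abs_neg, abs_of_pos (by positivity)]
    rfl
  simp_rw [e2]
  rw [lintegral_const_mul']
  simp

end HeisLSI

open Real MeasureTheory Filter

namespace HeisLSI

lemma continuous_pth : Continuous (fun q : (ℝ × ℝ × ℝ) × (ℝ × ℝ × ℝ) =>
    pth q.2.2.1 q.2.1 q.2.2.2 q.1) := by
  unfold pth fl1 fl2; fun_prop

lemma tri {F : ℝ × ℝ × ℝ → ENNReal} (hF : Measurable F) :
    ∫⁻ p, F p = ∫⁻ v, ∫⁻ u, ∫⁻ w, F (u, v, w) := by
  rw [Measure.volume_eq_prod, lintegral_prod _ hF.aemeasurable]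
  have : ∀ u : ℝ, ∫⁻ q : ℝ × ℝ, F (u, q) = ∫⁻ v, ∫⁻ w, F (u, v, w) := by
    intro u
    have h : Measurable (fun q : ℝ × ℝ => F (u, q)) := hF.comp (by fun_prop)
    rw [Measure.volume_eq_prod, lintegral_prod _ h.aemeasurable]
  simp_rw [this]
  rw [lintegral_lintegral_swap]
  apply Measurable.aemeasurable
  have : Measurable (fun q : (ℝ × ℝ) × ℝ => F (q.1.1, q.1.2, q.2)) := hF.comp (by fun_prop)
  exact this.lintegral_prod_right'

/-- `(b,a,c)` box measure -/
noncomputable def bx (A B C : Set ℝ) : Measure (ℝ × ℝ × ℝ) :=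
  (volume.restrict A).prod ((volume.restrict B).prod (volume.restrict C))

lemma box_cv {F : ℝ × ℝ × ℝ → ENNReal} (hF : Measurable F) {A B C : Set ℝ} 
    {t : ℝ} (ht : 0 < t) (hA : A ⊆ Set.Ici t) (hAm : MeasurableSet A) (p : ℝ × ℝ × ℝ) :
    ∫⁻ θ, F (pth θ.2.1 θ.1 θ.2.2 p) ∂(bx A B C) ≤ ENNReal.ofReal t⁻¹ * ∫⁻ q, F q := by
  have hm : Measurable (fun θ : ℝ × ℝ × ℝ => F (pth θ.2.1 θ.1 θ.2.2 p)) :=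
    hF.comp (by unfold pth fl1 fl2; fun_prop)
  unfold bx
  rw [lintegral_prod _ hm.aemeasurable]
  calc _ ≤ ∫⁻ b in A, ∫⁻ a, ∫⁻ c, F (pth a b c p) := by
        apply lintegral_mono
        intro b
        have hm2 : Measurable (fun θ : ℝ × ℝ => F (pth θ.1 b θ.2 p)) :=
          hF.comp (by unfold pth fl1 fl2; fun_prop)
        simp only
        rw [lintegral_prod _ hm2.aemeasurable]
        refine lintegral_mono' Measure.restrict_le_self ?_
        intro a
        exact lintegral_mono' Measure.restrict_le_self le_rfl
    _ ≤ ∫⁻ b in A, ENNReal.ofReal t⁻¹ * ∫⁻ u, ∫⁻ w, F (u, p.2.1 + b, w) := by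
        refine setLIntegral_mono' hAm ?_
        intro b hb
        have hb' : t ≤ b := hA hb
        rw [cv hF (lt_of_lt_of_le ht hb')]
        gcongr
    _ ≤ ∫⁻ b, ENNReal.ofReal t⁻¹ * ∫⁻ u, ∫⁻ w, F (u, p.2.1 + b, w) :=
        lintegral_mono' Measure.restrict_le_self le_rfl
    _ = _ := by
        rw [lintegral_const_mul' _ _ (by simp),
          lintegral_add_left_eq_self (fun b => ∫⁻ u, ∫⁻ w, F (u, b, w)) p.2.1, tri hF]

lemma nash_pt {m : Measure (ℝ × ℝ × ℝ)} {H : ℝ × ℝ × ℝ → ℝ} (hH : Measurable H) {g t : ℝ}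
    (ht : 0 < t) (hmu : m Set.univ = ENNReal.ofReal (t ^ 3))
    (hB : ∫⁻ θ, ENNReal.ofReal (H θ ^ 2) ∂m ≤ ENNReal.ofReal t⁻¹) (hp' : 4 / t ^ 4 < g ^ 2) :
    ENNReal.ofReal (t ^ 3) * ENNReal.ofReal (g ^ 2) ≤
      4 * ∫⁻ θ, ENNReal.ofReal ((H θ - g) ^ 2) ∂m := by
  set Y := ∫⁻ θ, ENNReal.ofReal ((H θ - g) ^ 2) ∂m
  have a1 : ENNReal.ofReal (t ^ 3) * ENNReal.ofReal (g ^ 2) ≤ 2 * Y + 2 * ENNReal.ofReal t⁻¹ := by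
    have hmm : Measurable (fun θ : ℝ × ℝ × ℝ => ENNReal.ofReal ((H θ - g) ^ 2)) :=
      ((hH.sub_const g).pow_const 2).ennreal_ofReal
    calc ENNReal.ofReal (t ^ 3) * ENNReal.ofReal (g ^ 2)
        = ∫⁻ θ, ENNReal.ofReal (g ^ 2) ∂m := by rw [lintegral_const, hmu, mul_comm]
      _ ≤ ∫⁻ θ, (2 * ENNReal.ofReal ((H θ - g) ^ 2)
            + 2 * ENNReal.ofReal (H θ ^ 2)) ∂m := by
          apply lintegral_mono
          intro θ
          simp only
          rw [show (2 : ENNReal) = ENNReal.ofReal 2 by simp, ← ENNReal.ofReal_mul (by norm_num),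
            ← ENNReal.ofReal_mul (by norm_num), ← ENNReal.ofReal_add (by positivity) (by positivity)]
          apply ENNReal.ofReal_le_ofReal
          nlinarith [sq_nonneg (H θ - g + H θ)]
      _ ≤ _ := by
          rw [lintegral_add_left (hmm.const_mul 2), lintegral_const_mul _ hmm,
            lintegral_const_mul' _ _ (by simp)]
          gcongr
  by_cases hY : Y = ⊤
  · rw [hY]; simp
  clear_value Y
  lift Y to NNReal using hY
  rw [← ENNReal.ofReal_mul (by positivity)] at a1 ⊢
  rw [← ENNReal.ofReal_coe_nnreal, show (2 : ENNReal) = ENNReal.ofReal 2 by simp,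
    ← ENNReal.ofReal_mul (by norm_num), ← ENNReal.ofReal_mul (by norm_num),
    ← ENNReal.ofReal_add (by positivity) (by positivity),
    ENNReal.ofReal_le_ofReal_iff (by positivity)] at a1
  rw [← ENNReal.ofReal_coe_nnreal, show (4 : ENNReal) = ENNReal.ofReal 4 by simp,
    ← ENNReal.ofReal_mul (by norm_num)]
  apply ENNReal.ofReal_le_ofReal
  have : 4 * t⁻¹ ≤ t ^ 3 * g ^ 2 := by
    have : t ^ 3 * (4 / t ^ 4) = 4 * t⁻¹ := by field_simp
    rw [← this]; gcongr
  linarith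

lemma nash_int {m : Measure (ℝ × ℝ × ℝ)} [SFinite m] {Hf : (ℝ × ℝ × ℝ) → (ℝ × ℝ × ℝ) → ENNReal}
    (hHf : Measurable (Function.uncurry Hf)) {S : Set (ℝ × ℝ × ℝ)} (hS : MeasurableSet S)
    {F : (ℝ × ℝ × ℝ) → ENNReal} {M J : ENNReal} (hM0 : M ≠ 0) (hMt : M ≠ ⊤)
    (hmu : m Set.univ = M)
    (key : ∀ p ∈ S, M * F p ≤ 4 * ∫⁻ θ, Hf p θ ∂m)
    (hJ : ∀ᵐ θ ∂m, ∫⁻ p, Hf p θ ≤ J) : ∫⁻ p in S, F p ≤ 4 * J := by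
  have main : M * ∫⁻ p in S, F p ≤ M * (4 * J) := by
    calc _ = ∫⁻ p in S, M * F p := by
          rw [lintegral_const_mul' _ _ hMt]
      _ ≤ ∫⁻ p in S, 4 * ∫⁻ θ, Hf p θ ∂m := setLIntegral_mono' hS key
      _ ≤ ∫⁻ p, 4 * ∫⁻ θ, Hf p θ ∂m := lintegral_mono' Measure.restrict_le_self le_rfl
      _ = 4 * ∫⁻ θ, (∫⁻ p, Hf p θ) ∂m := by
          rw [lintegral_const_mul' _ _ (by simp), lintegral_lintegral_swap hHf.aemeasurable]
      _ ≤ 4 * ∫⁻ θ, J ∂m := by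
          gcongr 4 * ?_
          exact lintegral_mono_ae hJ
      _ = _ := by
          rw [lintegral_const, hmu]; ring
  exact (ENNReal.mul_le_mul_iff_right hM0 hMt).1 main

lemma bx_univ {t : ℝ} (ht : 0 < t) :
    bx (Set.Icc t (2 * t)) (Set.Icc 0 t) (Set.Icc 0 t) Set.univ = ENNReal.ofReal (t ^ 3) := by
  rw [bx, ← Set.univ_prod_univ, Measure.prod_prod, ← Set.univ_prod_univ, Measure.prod_prod]
  simp only [Measure.restrict_apply MeasurableSet.univ, Set.univ_inter, Real.volume_Icc]
  rw [← ENNReal.ofReal_mul (by linarith), ← ENNReal.ofReal_mul (by linarith)]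
  congr 1; ring

lemma bx_ae {A B C : Set ℝ} (hA : MeasurableSet A) (hB : MeasurableSet B) (hC : MeasurableSet C) :
    ∀ᵐ θ ∂(bx A B C), θ.1 ∈ A ∧ θ.2.1 ∈ B ∧ θ.2.2 ∈ C := by
  have hr : bx A B C = volume.restrict (A ×ˢ B ×ˢ C) := by
    rw [bx, Measure.prod_restrict, Measure.prod_restrict]; rfl
  rw [hr]
  filter_upwards [self_mem_ae_restrict (hA.prod (hB.prod hC))] with θ hθ
  exact hθ

instance (A B C : Set ℝ) : SFinite (bx A B C) := by unfold bx; infer_instance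

lemma meas_dif {G : ℝ × ℝ × ℝ → ℝ} (hG : Measurable G) :
    Measurable (Function.uncurry fun (p θ : ℝ × ℝ × ℝ) =>
      ENNReal.ofReal ((G (pth θ.2.1 θ.1 θ.2.2 p) - G p) ^ 2)) := by
  have h1 : Measurable (fun q : (ℝ × ℝ × ℝ) × (ℝ × ℝ × ℝ) =>
    G (pth q.2.2.1 q.2.1 q.2.2.2 q.1)) := hG.comp continuous_pth.measurable
  have h2 : Measurable (fun q : (ℝ × ℝ × ℝ) × (ℝ × ℝ × ℝ) => G q.1) := hG.comp measurable_fst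
  exact ((h1.sub h2).pow_const 2).ennreal_ofReal

lemma nash_level {G : ℝ × ℝ × ℝ → ℝ} (hG : Measurable G) (h1 : ∫⁻ p, ENNReal.ofReal (G p ^ 2) ≤ 1)
    {I : ENNReal}
    (hI : ∀ a b c : ℝ, 0 ≤ a → 0 ≤ b → 0 ≤ c → ∫⁻ p, ENNReal.ofReal ((G (pth a b c p) - G p) ^ 2) ≤
      ENNReal.ofReal (3 * (a ^ 2 + b ^ 2 + c ^ 2)) * I) {t : ℝ} (ht : 0 < t) :
    ∫⁻ p in {p | 4 / t ^ 4 < G p ^ 2}, ENNReal.ofReal (G p ^ 2) ≤ ENNReal.ofReal (72 * t ^ 2) * I := by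
  have hS : MeasurableSet {p | 4 / t ^ 4 < G p ^ 2} :=
    measurableSet_lt measurable_const (hG.pow_const 2)
  have hFm : Measurable (fun p => ENNReal.ofReal (G p ^ 2)) := (hG.pow_const 2).ennreal_ofReal
  have h0 : ENNReal.ofReal (t ^ 3) ≠ 0 := by
    simp; positivity
  have := nash_int (m := bx (Set.Icc t (2 * t)) (Set.Icc 0 t) (Set.Icc 0 t)) (meas_dif hG) hS
    (F := fun p => ENNReal.ofReal (G p ^ 2)) h0 (by simp) (bx_univ ht)
    (J := ENNReal.ofReal (18 * t ^ 2) * I) ?_ ?_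
  · refine this.trans (le_of_eq ?_)
    rw [show (4 : ENNReal) = ENNReal.ofReal 4 by simp, ← mul_assoc,
      ← ENNReal.ofReal_mul (by norm_num)]
    congr 2; ring
  · intro p hp
    refine nash_pt (H := fun θ => G (pth θ.2.1 θ.1 θ.2.2 p))
      (hG.comp (by unfold pth fl1 fl2; fun_prop)) ht (bx_univ ht) ?_ hp
    refine (box_cv hFm ht (fun x hx => hx.1) measurableSet_Icc p).trans ?_
    exact mul_le_of_le_one_right' h1
  · filter_upwards [bx_ae (A := Set.Icc t (2 * t)) (B := Set.Icc 0 t) (C := Set.Icc 0 t)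
      measurableSet_Icc measurableSet_Icc measurableSet_Icc] with θ hθ
    obtain ⟨⟨h3, h4⟩, ⟨h5, h6⟩, ⟨h7, h8⟩⟩ := hθ
    refine (hI _ _ _ h5 (by linarith) h7).trans ?_
    gcongr ENNReal.ofReal ?_ * _
    nlinarith

lemma posLog_le_sum (y : ℝ) (hy0 : 0 ≤ y) : ENNReal.ofReal (log⁺ y) ≤
    ∑' k : ℕ, (if (4 : ℝ) ^ k < y then ENNReal.ofReal (Real.log 4) else 0) := by
  by_cases hy : y ≤ 1
  · have : log⁺ y = 0 := by
      rw [Real.posLog_eq_zero_iff, abs_of_nonneg hy0]; exact hy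
    simp [this]
  push Not at hy
  have h4 : 0 < Real.log 4 := Real.log_pos (by norm_num)
  set n := ⌈Real.log y / Real.log 4⌉₊ with hn
  have hk : ∀ k ∈ Finset.range n, (if (4 : ℝ) ^ k < y then ENNReal.ofReal (Real.log 4) else 0)
      = ENNReal.ofReal (Real.log 4) := by
    intro k hk
    have h1 : (k : ℝ) < Real.log y / Real.log 4 := Nat.lt_ceil.1 (Finset.mem_range.1 hk)
    rw [lt_div_iff₀ h4, ← Real.log_pow] at h1
    rw [if_pos ((Real.log_lt_log_iff (by positivity) (by linarith)).1 h1)]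
  calc ENNReal.ofReal (log⁺ y) ≤ ENNReal.ofReal (n * Real.log 4) := by
        apply ENNReal.ofReal_le_ofReal
        rw [Real.posLog_eq_log (by rw [abs_of_pos (by linarith)]; exact hy.le)]
        rw [← div_le_iff₀ h4]
        exact Nat.le_ceil _
    _ = ∑ k ∈ Finset.range n, (if (4 : ℝ) ^ k < y then ENNReal.ofReal (Real.log 4) else 0) := by
        rw [Finset.sum_congr rfl hk]
        simp [ENNReal.ofReal_mul]
    _ ≤ _ := ENNReal.sum_le_tsum _

lemma nash_log {G : ℝ × ℝ × ℝ → ℝ} (hG : Measurable G) (h1 : ∫⁻ p, ENNReal.ofReal (G p ^ 2) ≤ 1)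
    {I : ENNReal}
    (hI : ∀ a b c : ℝ, 0 ≤ a → 0 ≤ b → 0 ≤ c → ∫⁻ p, ENNReal.ofReal ((G (pth a b c p) - G p) ^ 2) ≤
      ENNReal.ofReal (3 * (a ^ 2 + b ^ 2 + c ^ 2)) * I) :
    ∫⁻ p, ENNReal.ofReal (G p ^ 2 * log⁺ (G p ^ 2)) ≤ ENNReal.ofReal (Real.log 4 * 288) * I := by
  have hS : ∀ y : ℝ, MeasurableSet {p | y < G p ^ 2} := fun y =>
    measurableSet_lt measurable_const (hG.pow_const 2)
  have hFm : Measurable (fun p => ENNReal.ofReal (G p ^ 2)) := (hG.pow_const 2).ennreal_ofReal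
  have hlev : ∀ k : ℕ, ∫⁻ p in {p | (4:ℝ) ^ k < G p ^ 2}, ENNReal.ofReal (G p ^ 2) ≤
      ENNReal.ofReal (144 * (1 / 2) ^ k) * I := by
    intro k
    have ht : 0 < √(2 * (1 / 2) ^ k : ℝ) := Real.sqrt_pos.2 (by positivity)
    have := nash_level hG h1 hI ht
    have e2 : √(2 * (1 / 2) ^ k : ℝ) ^ 2 = 2 * (1 / 2) ^ k := Real.sq_sqrt (by positivity)
    have e4 : √(2 * (1 / 2) ^ k : ℝ) ^ 4 = 4 * (1 / 4) ^ k := by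
      rw [show (4 : ℕ) = 2 * 2 from rfl, pow_mul, e2, mul_pow, ← pow_mul, mul_comm k 2, pow_mul]
      norm_num
    rw [e4, e2] at this
    have e5 : (4 : ℝ) / (4 * (1 / 4) ^ k) = 4 ^ k := by
      rw [one_div, inv_pow]; field_simp
    rw [e5] at this
    refine this.trans (le_of_eq ?_)
    congr 2; ring
  calc _ ≤ ∫⁻ p, ∑' k : ℕ, ENNReal.ofReal (Real.log 4) *
        Set.indicator {p | (4:ℝ) ^ k < G p ^ 2} (fun p => ENNReal.ofReal (G p ^ 2)) p := by
        apply lintegral_mono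
        intro p
        simp only
        rw [ENNReal.ofReal_mul (sq_nonneg _)]
        refine (mul_le_mul_right (posLog_le_sum _ (sq_nonneg _)) _).trans (le_of_eq ?_)
        rw [← ENNReal.tsum_mul_left]
        congr 1; ext k
        by_cases h : (4:ℝ) ^ k < G p ^ 2
        · simp [h, mul_comm]
        · simp [h]
    _ = ∑' k : ℕ, ENNReal.ofReal (Real.log 4) *
        ∫⁻ p in {p | (4:ℝ) ^ k < G p ^ 2}, ENNReal.ofReal (G p ^ 2) := by
        rw [lintegral_tsum]
        · congr 1; ext k
          rw [lintegral_const_mul' _ _ (by simp), lintegral_indicator (hS _)]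
        · intro k
          exact ((hFm.indicator (hS _)).const_mul _).aemeasurable
    _ ≤ ∑' k : ℕ, ENNReal.ofReal (Real.log 4) * (ENNReal.ofReal (144 * (1 / 2) ^ k) * I) :=
        ENNReal.tsum_le_tsum fun k => mul_le_mul_right (hlev k) _
    _ = _ := by
        rw [ENNReal.tsum_mul_left, ENNReal.tsum_mul_right, ← mul_assoc]
        congr 1
        rw [← ENNReal.ofReal_tsum_of_nonneg (fun k => by positivity)
          (summable_geometric_two.mul_left 144), tsum_mul_left, tsum_geometric_two,
          ← ENNReal.ofReal_mul (Real.log_nonneg (by norm_num))]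
        norm_num

end HeisLSI

open Real MeasureTheory Filter

namespace HeisLSI

/-- horizontal gradient squared -/
noncomputable def gsq (f : ℝ × ℝ × ℝ → ℝ) (p : ℝ × ℝ × ℝ) : ℝ := X1 f p ^ 2 + X2 f p ^ 2

lemma gsq_nonneg (f : ℝ × ℝ × ℝ → ℝ) (p : ℝ × ℝ × ℝ) : 0 ≤ gsq f p := by unfold gsq; positivity

/-- energy -/
noncomputable def En (W : ℝ × ℝ × ℝ → ℝ) (f : ℝ × ℝ × ℝ → ℝ) : ENNReal :=
  ∫⁻ p, ENNReal.ofReal (W p * gsq f p)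

noncomputable def dd (f : ℝ × ℝ × ℝ → ℝ) (A B : Set (ℝ × ℝ × ℝ)) : ENNReal :=
  ∫⁻ p in A, ∫⁻ q in B, ENNReal.ofReal ((f p - f q) ^ 2)

lemma continuous_X1 {f : ℝ × ℝ × ℝ → ℝ} (hf : ContDiff ℝ 1 f) : Continuous (X1 f) := by
  have h : Continuous (fderiv ℝ f) := hf.continuous_fderiv one_ne_zero
  unfold X1
  fun_prop

lemma continuous_X2 {f : ℝ × ℝ × ℝ → ℝ} (hf : ContDiff ℝ 1 f) : Continuous (X2 f) := by
  have h : Continuous (fderiv ℝ f) := hf.continuous_fderiv one_ne_zero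
  unfold X2
  fun_prop

lemma continuous_gsq {f : ℝ × ℝ × ℝ → ℝ} (hf : ContDiff ℝ 1 f) : Continuous (gsq f) := by
  have h1 := continuous_X1 hf
  have h2 := continuous_X2 hf
  unfold gsq; fun_prop

lemma deriv_fl1 {f : ℝ × ℝ × ℝ → ℝ} (hf : ContDiff ℝ 1 f) (p : ℝ × ℝ × ℝ) (s : ℝ) :
    HasDerivAt (fun s => f (fl1 s p)) (X1 f (fl1 s p)) s := by
  have h1 : HasFDerivAt f (fderiv ℝ f (fl1 s p)) (fl1 s p) :=
    ((hf.differentiable one_ne_zero) _).hasFDerivAt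
  have h2 : HasDerivAt (fun s => fl1 s p) ((1 : ℝ), (0 : ℝ), p.2.1 / 2) s := by
    unfold fl1
    refine ((hasDerivAt_id s).const_add _).prodMk ((hasDerivAt_const _ _).prodMk ?_)
    simpa using ((hasDerivAt_id s).mul_const (p.2.1 / 2)).const_add p.2.2
  have h3 := h1.comp_hasDerivAt s h2
  have h4 : X1 f (fl1 s p) = fderiv ℝ f (fl1 s p) ((1 : ℝ), (0 : ℝ), p.2.1 / 2) := by
    have : ((1 : ℝ), (0 : ℝ), p.2.1 / 2) = (1, 0, 0) + (p.2.1 / 2) • ((0 : ℝ), (0 : ℝ), (1 : ℝ)) := by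
      simp
    rw [this, map_add, map_smul]
    simp [X1, fl1]
  rw [h4]
  exact h3

lemma deriv_fl2 {f : ℝ × ℝ × ℝ → ℝ} (hf : ContDiff ℝ 1 f) (p : ℝ × ℝ × ℝ) (s : ℝ) :
    HasDerivAt (fun s => f (fl2 s p)) (X2 f (fl2 s p)) s := by
  have h1 : HasFDerivAt f (fderiv ℝ f (fl2 s p)) (fl2 s p) :=
    ((hf.differentiable one_ne_zero) _).hasFDerivAt
  have h2 : HasDerivAt (fun s => fl2 s p) ((0 : ℝ), (1 : ℝ), -(p.1 / 2)) s := by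
    unfold fl2
    refine (hasDerivAt_const _ _).prodMk (((hasDerivAt_id s).const_add _).prodMk ?_)
    simpa using ((hasDerivAt_id s).mul_const (p.1 / 2)).const_sub p.2.2
  have h3 := h1.comp_hasDerivAt s h2
  have h4 : X2 f (fl2 s p) = fderiv ℝ f (fl2 s p) ((0 : ℝ), (1 : ℝ), -(p.1 / 2)) := by
    have : ((0 : ℝ), (1 : ℝ), -(p.1 / 2)) = (0, 1, 0) + (-(p.1 / 2)) • ((0 : ℝ), (0 : ℝ), (1 : ℝ)) := by
      simp
    rw [this, map_add, map_smul]
    simp [X2, fl2]; ring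
  rw [h4]
  exact h3

lemma fl1_zero (p : ℝ × ℝ × ℝ) : fl1 0 p = p := by simp [fl1]
lemma fl2_zero (p : ℝ × ℝ × ℝ) : fl2 0 p = p := by simp [fl2]

lemma step1 {f : ℝ × ℝ × ℝ → ℝ} {d : ℝ × ℝ × ℝ → ℝ} {D : ℝ × ℝ × ℝ → ENNReal} {a : ℝ} (ha : 0 ≤ a)
    {Φ : ℝ → (ℝ × ℝ × ℝ) → (ℝ × ℝ × ℝ)} {p : ℝ × ℝ × ℝ} (h0 : Φ 0 p = p)
    (hd : ∀ s ∈ Set.Icc 0 a, HasDerivAt (fun s => f (Φ s p)) (d (Φ s p)) s)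
    (hc : ContinuousOn (fun s => d (Φ s p)) (Set.Icc 0 a))
    (hD : ∀ s ∈ Set.Ioc 0 a, ENNReal.ofReal (d (Φ s p) ^ 2) ≤ D (Φ s p)) : Step Φ f D a p := by
  unfold Step
  have := cs1d ha hd hc
  simp only [h0] at this
  refine this.trans ?_
  gcongr 1
  exact setLIntegral_mono' measurableSet_Ioc hD

def GoodPair (W : ℝ × ℝ × ℝ → ℝ) (A B : Set (ℝ × ℝ × ℝ)) : Prop :=
  ∃ C : NNReal, ∀ f, ContDiff ℝ 1 f → dd f A B ≤ C * En W f

lemma meas_sq {f : ℝ × ℝ × ℝ → ℝ} (hf : Continuous f) :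
    Measurable (fun z : (ℝ × ℝ × ℝ) × (ℝ × ℝ × ℝ) => ENNReal.ofReal ((f z.1 - f z.2) ^ 2)) := by
  have : Continuous (fun z : (ℝ × ℝ × ℝ) × (ℝ × ℝ × ℝ) => (f z.1 - f z.2) ^ 2) := by fun_prop
  exact this.measurable.ennreal_ofReal

lemma dd_symm {f : ℝ × ℝ × ℝ → ℝ} (hf : Continuous f) (A B : Set (ℝ × ℝ × ℝ)) :
    dd f A B = dd f B A := by
  unfold dd
  rw [lintegral_lintegral_swap (f := fun p q => ENNReal.ofReal ((f p - f q) ^ 2))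
    (meas_sq hf).aemeasurable]
  congr 1; ext p; congr 1; ext q; congr 1; ring

lemma gp_symm {W} {A B : Set (ℝ × ℝ × ℝ)} (h : GoodPair W A B) : GoodPair W B A := by
  obtain ⟨C, hC⟩ := h
  exact ⟨C, fun f hf => by rw [dd_symm hf.continuous]; exact hC f hf⟩

lemma gp_mono {W} {A B A' B' : Set (ℝ × ℝ × ℝ)} (h : GoodPair W A B) (hA : A' ⊆ A) (hB : B' ⊆ B) :
    GoodPair W A' B' := by
  obtain ⟨C, hC⟩ := h
  refine ⟨C, fun f hf => le_trans ?_ (hC f hf)⟩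
  unfold dd
  exact lintegral_mono' (Measure.restrict_mono hA le_rfl) fun p =>
    lintegral_mono' (Measure.restrict_mono hB le_rfl) le_rfl

lemma gp_union_left {W} {A A' B : Set (ℝ × ℝ × ℝ)} (h : GoodPair W A B) (h' : GoodPair W A' B) :
    GoodPair W (A ∪ A') B := by
  obtain ⟨C, hC⟩ := h
  obtain ⟨C', hC'⟩ := h'
  refine ⟨C + C', fun f hf => ?_⟩
  push_cast
  rw [add_mul]
  refine le_trans ?_ (add_le_add (hC f hf) (hC' f hf))
  exact lintegral_union_le _ _ _

lemma gp_union {W} {A B : Set (ℝ × ℝ × ℝ)} (h : GoodPair W A A) (h' : GoodPair W B B)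
    (h'' : GoodPair W A B) : GoodPair W (A ∪ B) (A ∪ B) :=
  gp_union_left (gp_symm (gp_union_left h (gp_symm h''))) (gp_symm (gp_union_left h'' h'))

lemma gp_trans {W} {A B E : Set (ℝ × ℝ × ℝ)} (h : GoodPair W A E) (h' : GoodPair W B E)
    (hA : volume A ≠ ⊤) (hB : volume B ≠ ⊤) (hE0 : volume E ≠ 0) (hE : volume E ≠ ⊤) :
    GoodPair W A B := by
  obtain ⟨C, hC⟩ := h
  obtain ⟨C', hC'⟩ := h'
  refine ⟨(volume E).toNNReal⁻¹ * (2 * (volume B).toNNReal * C + 2 * (volume A).toNNReal * C'),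
    fun f hf => ?_⟩
  have hfc := hf.continuous
  have key : volume E * dd f A B ≤ 2 * volume B * dd f A E + 2 * volume A * dd f B E := by
    have e1 : ∀ p q : ℝ × ℝ × ℝ, volume E * ENNReal.ofReal ((f p - f q) ^ 2) ≤
        2 * (∫⁻ e in E, ENNReal.ofReal ((f p - f e) ^ 2)) +
        2 * (∫⁻ e in E, ENNReal.ofReal ((f q - f e) ^ 2)) := by
      intro p q
      have m1 : ∀ p : ℝ × ℝ × ℝ, Measurable (fun e => ENNReal.ofReal ((f p - f e) ^ 2)) := fun p =>
        (Continuous.measurable (by fun_prop : Continuous (fun e => (f p - f e) ^ 2))).ennreal_ofReal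
      calc _ = ∫⁻ e in E, ENNReal.ofReal ((f p - f q) ^ 2) := by
            simp [mul_comm]
        _ ≤ ∫⁻ e in E, (2 * ENNReal.ofReal ((f p - f e) ^ 2) + 2 * ENNReal.ofReal ((f q - f e) ^ 2)) := by
            apply lintegral_mono
            intro e
            simp only
            rw [show (2 : ENNReal) = ENNReal.ofReal 2 by simp, ← ENNReal.ofReal_mul (by norm_num),
              ← ENNReal.ofReal_mul (by norm_num), ← ENNReal.ofReal_add (by positivity) (by positivity)]
            apply ENNReal.ofReal_le_ofReal
            nlinarith [sq_nonneg ((f p - f e) + (f q - f e))]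
        _ = _ := by
            rw [lintegral_add_left ((m1 p).const_mul 2), lintegral_const_mul' _ _ (by simp),
              lintegral_const_mul' _ _ (by simp)]
    have m2 : Measurable (fun p => ∫⁻ e in E, ENNReal.ofReal ((f p - f e) ^ 2)) :=
      (meas_sq hfc).lintegral_prod_right'
    calc volume E * dd f A B = ∫⁻ p in A, ∫⁻ q in B, volume E * ENNReal.ofReal ((f p - f q) ^ 2) := by
          unfold dd
          rw [← lintegral_const_mul' _ _ hE]
          congr 1; ext p
          rw [← lintegral_const_mul' _ _ hE]
      _ ≤ ∫⁻ p in A, ∫⁻ q in B, (2 * (∫⁻ e in E, ENNReal.ofReal ((f p - f e) ^ 2)) +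
        2 * (∫⁻ e in E, ENNReal.ofReal ((f q - f e) ^ 2))) :=
          lintegral_mono fun p => lintegral_mono fun q => e1 p q
      _ = ∫⁻ p in A, (volume B * (2 * (∫⁻ e in E, ENNReal.ofReal ((f p - f e) ^ 2))) +
            2 * dd f B E) := by
          congr 1; ext p
          rw [lintegral_add_left measurable_const, setLIntegral_const,
            lintegral_const_mul' 2 (fun q => ∫⁻ e in E, ENNReal.ofReal ((f q - f e) ^ 2)) (by simp)]
          unfold dd
          rw [mul_comm (volume B)]
      _ = _ := by
          rw [lintegral_add_right _ measurable_const, lintegral_const_mul' _ _ hB,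
            lintegral_const_mul' _ _ (by simp)]
          simp [dd]; ring
  have hEi : (volume E)⁻¹ * volume E = 1 := ENNReal.inv_mul_cancel hE0 hE
  calc dd f A B = (volume E)⁻¹ * (volume E * dd f A B) := by rw [← mul_assoc, hEi, one_mul]
    _ ≤ (volume E)⁻¹ * (2 * volume B * (C * En W f) + 2 * volume A * (C' * En W f)) := by
        refine mul_le_mul_right (key.trans ?_) _
        exact add_le_add (mul_le_mul_right (hC f hf) _) (mul_le_mul_right (hC' f hf) _)
    _ = _ := by
        have : (volume E).toNNReal ≠ 0 := by
          simp [ENNReal.toNNReal_eq_zero_iff, hE0, hE]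
        push_cast [ENNReal.coe_inv this]
        rw [ENNReal.coe_toNNReal hE, ENNReal.coe_toNNReal hA, ENNReal.coe_toNNReal hB]
        ring

lemma box_cv_rev {F : ℝ × ℝ × ℝ → ENNReal} (hF : Measurable F) {E : Set (ℝ × ℝ × ℝ)}
    (hE : MeasurableSet E) {T : ℝ} {p : ℝ × ℝ × ℝ}
    (hE1 : ∀ e ∈ E, p.2.1 < e.2.1)
    (hE2 : ∀ a b c, 0 < b → pth a b c p ∈ E → a ∈ Set.Ioo 0 T ∧ b ∈ Set.Ioo 0 T ∧ c ∈ Set.Ioo 0 T) :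
    ∫⁻ e in E, F e ≤ ENNReal.ofReal T *
      ∫⁻ θ, F (pth θ.2.1 θ.1 θ.2.2 p) ∂(bx (Set.Ioo 0 T) (Set.Ioo 0 T) (Set.Ioo 0 T)) := by
  have hm : Measurable (fun θ : ℝ × ℝ × ℝ => F (pth θ.2.1 θ.1 θ.2.2 p)) :=
    hF.comp (by unfold pth fl1 fl2; fun_prop)
  have hF' : Measurable (E.indicator F) := hF.indicator hE
  unfold bx
  rw [lintegral_prod _ hm.aemeasurable, ← lintegral_indicator hE, tri hF',
    ← lintegral_add_left_eq_self _ p.2.1, ← lintegral_const_mul' _ _ (by simp),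
    ← lintegral_indicator measurableSet_Ioo]
  apply lintegral_mono
  intro b
  simp only
  by_cases hb : 0 < b
  swap
  · have : ∀ u w, E.indicator F (u, p.2.1 + b, w) = 0 := by
      intro u w
      apply Set.indicator_of_notMem
      intro h
      have := hE1 _ h
      simp only at this
      linarith
    simp [this]
  have e : ∫⁻ u, ∫⁻ w, E.indicator F (u, p.2.1 + b, w) =
      ENNReal.ofReal b * ∫⁻ a, ∫⁻ c, E.indicator F (pth a b c p) := by
    rw [cv hF' hb, ← mul_assoc, ← ENNReal.ofReal_mul hb.le, mul_inv_cancel₀ hb.ne']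
    simp
  rw [e]
  by_cases hbT : b ∈ Set.Ioo 0 T
  swap
  · have : ∀ a c, E.indicator F (pth a b c p) = 0 := by
      intro a c
      apply Set.indicator_of_notMem
      intro h
      exact hbT (hE2 a b c hb h).2.1
    simp [this]
  rw [Set.indicator_of_mem hbT]
  have hm2 : Measurable (fun θ : ℝ × ℝ => F (pth θ.1 b θ.2 p)) :=
    hF.comp (by unfold pth fl1 fl2; fun_prop)
  rw [lintegral_prod _ hm2.aemeasurable]
  refine mul_le_mul' (ENNReal.ofReal_le_ofReal hbT.2.le) ?_
  rw [← lintegral_indicator measurableSet_Ioo]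
  apply lintegral_mono
  intro a
  simp only
  by_cases ha : a ∈ Set.Ioo 0 T
  swap
  · have : ∀ c, E.indicator F (pth a b c p) = 0 := by
      intro c
      apply Set.indicator_of_notMem
      intro h
      exact ha (hE2 a b c hb h).1
    simp [this]
  rw [Set.indicator_of_mem ha, ← lintegral_indicator measurableSet_Ioo]
  apply lintegral_mono
  intro c
  by_cases hc : pth a b c p ∈ E
  · simp [hc, (hE2 a b c hb hc).2.2.1, (hE2 a b c hb hc).2.2.2]
  · simp [hc]

end HeisLSI

open Real MeasureTheory Filter

namespace HeisLSI

lemma bx_fin (T : ℝ) : bx (Set.Ioo 0 T) (Set.Ioo 0 T) (Set.Ioo 0 T) Set.univ ≠ ⊤ := by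
  rw [bx, ← Set.univ_prod_univ, Measure.prod_prod, ← Set.univ_prod_univ, Measure.prod_prod]
  simp only [Measure.restrict_apply MeasurableSet.univ, Set.univ_inter, Real.volume_Ioo]
  exact ENNReal.mul_ne_top ENNReal.ofReal_ne_top (ENNReal.mul_ne_top ENNReal.ofReal_ne_top ENNReal.ofReal_ne_top)

lemma gp_of_path {W : ℝ × ℝ × ℝ → ℝ} {S E N : Set (ℝ × ℝ × ℝ)} (hS : MeasurableSet S)
    (hE : MeasurableSet E) (hN : MeasurableSet N) {T δ : ℝ} (hδ : 0 < δ)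
    (hW : ∀ p ∈ N, δ ≤ W p)
    (h1 : ∀ p ∈ S, ∀ e ∈ E, p.2.1 < e.2.1)
    (h2 : ∀ p ∈ S, ∀ a b c, 0 < b → pth a b c p ∈ E →
      a ∈ Set.Ioo 0 T ∧ b ∈ Set.Ioo 0 T ∧ c ∈ Set.Ioo 0 T)
    (h3 : ∀ p ∈ S, ∀ a b c, a ∈ Set.Icc 0 T → b ∈ Set.Icc 0 T → c ∈ Set.Icc 0 T → pth a b c p ∈ N) :
    GoodPair W S E := by
  set m := bx (Set.Ioo 0 T) (Set.Ioo 0 T) (Set.Ioo 0 T) with hm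
  have hmf : m Set.univ ≠ ⊤ := bx_fin T
  refine ⟨(m Set.univ).toNNReal * (Real.toNNReal T * (Real.toNNReal (9 * T ^ 2) * Real.toNNReal δ⁻¹)),
    fun f hf => ?_⟩
  set D : ℝ × ℝ × ℝ → ENNReal := N.indicator (fun p => ENNReal.ofReal (gsq f p)) with hD
  have hDm : Measurable D := ((continuous_gsq hf).measurable.ennreal_ofReal).indicator hN
  have hDI : ∫⁻ p, D p ≤ ENNReal.ofReal δ⁻¹ * En W f := by
    unfold En
    rw [← lintegral_const_mul' _ _ (by simp)]
    apply lintegral_mono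
    intro p
    by_cases hp : p ∈ N
    · simp only [hD, Set.indicator_of_mem hp]
      rw [← ENNReal.ofReal_mul (by positivity)]
      apply ENNReal.ofReal_le_ofReal
      have := hW p hp
      have h4 := mul_le_mul_of_nonneg_right this (gsq_nonneg f p)
      rw [← mul_le_mul_iff_right₀ hδ, ← mul_assoc, mul_inv_cancel₀ hδ.ne', one_mul]
      exact h4
    · simp [hD, hp]
  have hfc := hf.continuous
  have hstep : ∀ a b c, a ∈ Set.Icc 0 T → b ∈ Set.Icc 0 T → c ∈ Set.Icc 0 T →
      ∫⁻ p in S, ENNReal.ofReal ((f (pth a b c p) - f p) ^ 2) ≤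
        ENNReal.ofReal (9 * T ^ 2) * ∫⁻ p, D p := by
    intro a b c ha hb hc
    refine (path_bound (D := D) hDm ha.1 hb.1 hc.1 hS ?_).trans ?_
    · refine Eventually.of_forall fun p hp => ?_
      have hT : 0 ≤ T := ha.1.trans ha.2
      have z0 : (0 : ℝ) ∈ Set.Icc 0 T := ⟨le_rfl, hT⟩
      refine ⟨step1 (d := X1 f) ha.1 (fl1_zero _) (fun s _ => deriv_fl1 hf p s) ?_ ?_,
        step1 (d := X2 f) hb.1 (fl2_zero _) (fun s _ => deriv_fl2 hf _ s) ?_ ?_,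
        step1 (d := X1 f) hc.1 (fl1_zero _) (fun s _ => deriv_fl1 hf _ s) ?_ ?_⟩
      · have := continuous_X1 hf
        exact (this.comp (by unfold fl1; fun_prop)).continuousOn
      · intro s hs
        have : fl1 s p ∈ N := by
          have := h3 p hp s 0 0 ⟨hs.1.le, hs.2.trans ha.2⟩ z0 z0
          simpa [pth, fl1_zero, fl2_zero] using this
        simp only [hD, Set.indicator_of_mem this]
        apply ENNReal.ofReal_le_ofReal; unfold gsq; nlinarith [sq_nonneg (X2 f (fl1 s p))]
      · have := continuous_X2 hf
        exact (this.comp (by unfold fl2; fun_prop)).continuousOn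
      · intro s hs
        have : fl2 s (fl1 a p) ∈ N := by
          have := h3 p hp a s 0 ha ⟨hs.1.le, hs.2.trans hb.2⟩ z0
          simpa [pth, fl1_zero, fl2_zero] using this
        simp only [hD, Set.indicator_of_mem this]
        apply ENNReal.ofReal_le_ofReal; unfold gsq; nlinarith [sq_nonneg (X1 f (fl2 s (fl1 a p)))]
      · have := continuous_X1 hf
        exact (this.comp (by unfold fl1; fun_prop)).continuousOn
      · intro s hs
        have : fl1 s (fl2 b (fl1 a p)) ∈ N := h3 p hp a b s ha hb ⟨hs.1.le, hs.2.trans hc.2⟩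
        simp only [hD, Set.indicator_of_mem this]
        apply ENNReal.ofReal_le_ofReal; unfold gsq
        nlinarith [sq_nonneg (X2 f (fl1 s (fl2 b (fl1 a p))))]
    · gcongr 1
      apply ENNReal.ofReal_le_ofReal
      have := pow_le_pow_left₀ ha.1 ha.2 2
      have := pow_le_pow_left₀ hb.1 hb.2 2
      have := pow_le_pow_left₀ hc.1 hc.2 2
      linarith
  calc dd f S E ≤ ∫⁻ p in S, ENNReal.ofReal T *
        ∫⁻ θ, ENNReal.ofReal ((f (pth θ.2.1 θ.1 θ.2.2 p) - f p) ^ 2) ∂m := by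
        unfold dd
        refine setLIntegral_mono' hS fun p hp => ?_
        have := box_cv_rev (F := fun q => ENNReal.ofReal ((f q - f p) ^ 2))
          (Continuous.measurable (by fun_prop : Continuous fun q => (f q - f p) ^ 2)).ennreal_ofReal
          hE (h1 p hp) (h2 p hp)
        refine le_trans (le_of_eq ?_) this
        congr 1; ext q; congr 1; ring
    _ = ENNReal.ofReal T * ∫⁻ θ, (∫⁻ p in S, ENNReal.ofReal ((f (pth θ.2.1 θ.1 θ.2.2 p) - f p) ^ 2)) ∂m := by
        rw [lintegral_const_mul' _ _ (by simp),
          lintegral_lintegral_swap (f := fun (p θ : ℝ × ℝ × ℝ) => ENNReal.ofReal ((f (pth θ.2.1 θ.1 θ.2.2 p) - f p) ^ 2))]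
        exact (meas_dif hfc.measurable).aemeasurable
    _ ≤ ENNReal.ofReal T * ∫⁻ θ, (ENNReal.ofReal (9 * T ^ 2) * ∫⁻ p, D p) ∂m := by
        gcongr 1
        apply lintegral_mono_ae
        filter_upwards [bx_ae (A := Set.Ioo 0 T) (B := Set.Ioo 0 T) (C := Set.Ioo 0 T) measurableSet_Ioo
          measurableSet_Ioo measurableSet_Ioo] with θ hθ
        exact hstep _ _ _ (Set.Ioo_subset_Icc_self hθ.2.1) (Set.Ioo_subset_Icc_self hθ.1)
          (Set.Ioo_subset_Icc_self hθ.2.2)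
    _ = m Set.univ * (ENNReal.ofReal T * (ENNReal.ofReal (9 * T ^ 2) * ∫⁻ p, D p)) := by
        rw [lintegral_const]; ring
    _ ≤ m Set.univ * (ENNReal.ofReal T * (ENNReal.ofReal (9 * T ^ 2) * (ENNReal.ofReal δ⁻¹ * En W f))) := by
        gcongr 3
    _ = _ := by
        push_cast
        rw [ENNReal.coe_toNNReal hmf]
        simp only [ENNReal.ofReal]
        ring

lemma local_gp {W : ℝ × ℝ × ℝ → ℝ} {O : Set (ℝ × ℝ × ℝ)} (hO : IsOpen O)
    (hWp : ∀ p ∈ O, 0 < W p) (hWc : ContinuousOn W O) {p0 : ℝ × ℝ × ℝ} (hp0 : p0 ∈ O) :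
    ∃ S, IsOpen S ∧ p0 ∈ S ∧ volume S ≠ ⊤ ∧ GoodPair W S S := by
  set δ := W p0 / 2 with hδ
  have hδ0 : 0 < δ := by have := hWp p0 hp0; positivity
  set N := O ∩ W ⁻¹' (Set.Ioi δ) with hN
  have hNo : IsOpen N := hWc.isOpen_inter_preimage hO isOpen_Ioi
  have hp0N : p0 ∈ N := ⟨hp0, by simp only [Set.mem_preimage, Set.mem_Ioi]; linarith [hWp p0 hp0]⟩
  have hnb : (fun q : (ℝ × ℝ × ℝ) × (ℝ × ℝ × ℝ) => pth q.2.2.1 q.2.1 q.2.2.2 q.1) ⁻¹' N ∈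
      nhds (p0, ((0 : ℝ), (0 : ℝ), (0 : ℝ))) := by
    apply (hNo.preimage continuous_pth).mem_nhds
    simpa [pth, fl1_zero, fl2_zero] using hp0N
  obtain ⟨ρ, hρ, hball⟩ := Metric.mem_nhds_iff.1 hnb
  have hpt : ∀ p a b c, dist p p0 < ρ → |a| < ρ → |b| < ρ → |c| < ρ → pth a b c p ∈ N := by
    intro p a b c hp ha hb hc
    have : (p, (b, a, c)) ∈ Metric.ball (p0, ((0 : ℝ), (0 : ℝ), (0 : ℝ))) ρ := by
      simp only [Metric.mem_ball, Prod.dist_eq] at hp ⊢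
      simp [Real.dist_eq] at hp ⊢
      tauto
    exact hball this
  set t := ρ / 4 with ht
  have ht0 : 0 < t := by positivity
  set e0 := pth t t t p0 with he0
  let bf : (ℝ × ℝ × ℝ) × (ℝ × ℝ × ℝ) → ℝ := fun q => q.2.2.1 - q.1.2.1
  let af : (ℝ × ℝ × ℝ) × (ℝ × ℝ × ℝ) → ℝ := fun q =>
    (q.1.2.2 - bf q * q.1.1 / 2 + (q.2.1 - q.1.1) * (q.1.2.1 + bf q) / 2 - q.2.2.2) / bf q
  let cf : (ℝ × ℝ × ℝ) × (ℝ × ℝ × ℝ) → ℝ := fun q => q.2.1 - q.1.1 - af q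
  have hb : ∀ p a b c, bf (p, pth a b c p) = b := by
    intro p a b c; simp [bf, pth, fl1, fl2]
  have ha : ∀ p a b c, 0 < b → af (p, pth a b c p) = a := by
    intro p a b c h
    simp only [af, hb]
    rw [div_eq_iff h.ne']
    simp [pth, fl1, fl2]; ring
  have hc : ∀ p a b c, 0 < b → cf (p, pth a b c p) = c := by
    intro p a b c h
    simp only [cf, ha p a b c h]
    simp [pth, fl1, fl2]; ring
  have hbc : ContinuousAt bf (p0, e0) := by simp only [bf]; fun_prop
  have hac : ContinuousAt af (p0, e0) := by
    have : bf (p0, e0) ≠ 0 := by rw [he0, hb]; exact ht0.ne'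
    simp only [af]
    exact ContinuousAt.div (by simp only [bf]; fun_prop) hbc this
  have hcc : ContinuousAt cf (p0, e0) := by simp only [cf]; fun_prop
  have hI : Set.Ioo 0 (2 * t) ∈ nhds t := Ioo_mem_nhds ht0 (by linarith)
  have m1 : bf ⁻¹' Set.Ioo 0 (2 * t) ∈ nhds (p0, e0) := hbc.preimage_mem_nhds (by rw [he0, hb]; exact hI)
  have m2 : af ⁻¹' Set.Ioo 0 (2 * t) ∈ nhds (p0, e0) :=
    hac.preimage_mem_nhds (by rw [he0, ha _ _ _ _ ht0]; exact hI)
  have m3 : cf ⁻¹' Set.Ioo 0 (2 * t) ∈ nhds (p0, e0) :=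
    hcc.preimage_mem_nhds (by rw [he0, hc _ _ _ _ ht0]; exact hI)
  obtain ⟨S, E, hS, hpS, hE, heE, hSE⟩ := mem_nhds_prod_iff'.1 (inter_mem m1 (inter_mem m2 m3))
  set S' := S ∩ Metric.ball p0 ρ
  set E' := E ∩ Metric.ball e0 1
  have hS'o : IsOpen S' := hS.inter Metric.isOpen_ball
  have hE'o : IsOpen E' := hE.inter Metric.isOpen_ball
  have hp0S : p0 ∈ S' := ⟨hpS, by simp [hρ]⟩
  have he0E : e0 ∈ E' := ⟨heE, by simp⟩
  have hSf : volume S' ≠ ⊤ := ne_top_of_le_ne_top (measure_ball_lt_top (μ := volume) (x := p0) (r := ρ)).ne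
    (measure_mono Set.inter_subset_right)
  have hEf : volume E' ≠ ⊤ := ne_top_of_le_ne_top (measure_ball_lt_top (μ := volume) (x := e0) (r := 1)).ne
    (measure_mono Set.inter_subset_right)
  have gp : GoodPair W S' E' := by
    refine gp_of_path (T := 2 * t) hS'o.measurableSet hE'o.measurableSet hNo.measurableSet hδ0
      (fun p hp => (le_of_lt hp.2)) ?_ ?_ ?_
    · intro p hp e he
      have := (hSE (Set.mk_mem_prod hp.1 he.1)).1.1
      simp only [bf] at this
      linarith
    · intro p hp a b c hb0 he
      have := hSE (Set.mk_mem_prod hp.1 he.1)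
      have h1 := this.1
      have h2 := this.2.1
      have h3 := this.2.2
      simp only [Set.mem_preimage] at h1 h2 h3
      rw [hb] at h1
      rw [ha _ _ _ _ hb0] at h2
      rw [hc _ _ _ _ hb0] at h3
      exact ⟨h2, h1, h3⟩
    · intro p hp a b c h1 h2 h3
      have h4 : ∀ x ∈ Set.Icc 0 (2 * t), |x| < ρ := by
        intro x hx; rw [abs_of_nonneg hx.1]; linarith [hx.2]
      exact hpt p a b c hp.2 (h4 _ h1) (h4 _ h2) (h4 _ h3)
  exact ⟨S', hS'o, hp0S, hSf, gp_trans gp gp hSf hSf (hE'o.measure_pos volume ⟨e0, he0E⟩).ne' hEf⟩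

/-- The good set. -/
def Om : Set (ℝ × ℝ × ℝ) := {p | 0 < p.1 ^ 2 + p.2.1 ^ 2}

lemma Om_open : IsOpen Om := isOpen_lt (by fun_prop) (by fun_prop)

lemma Om_conn : IsPreconnected Om := by
  have h : IsConnected ({0}ᶜ : Set (ℝ × ℝ)) :=
    isConnected_compl_singleton_of_one_lt_rank (by simp; norm_num) 0
  have h2 : IsPreconnected (({0}ᶜ : Set (ℝ × ℝ)) ×ˢ (Set.univ : Set ℝ)) := h.isPreconnected.prod isPreconnected_univ
  have h3 := h2.image (fun q : (ℝ × ℝ) × ℝ => (q.1.1, q.1.2, q.2)) (by fun_prop)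
  convert h3 using 1
  ext p
  simp only [Om, Set.mem_ofPred_eq, Set.mem_image, Set.mem_prod, Set.mem_compl_iff,
    Set.mem_singleton_iff, Set.mem_univ, and_true]
  constructor
  · intro hp
    refine ⟨((p.1, p.2.1), p.2.2), ?_, rfl⟩
    intro h
    simp only [Prod.mk_eq_zero] at h
    simp [h.1, h.2] at hp
  · rintro ⟨⟨⟨a, b⟩, c⟩, hq, rfl⟩
    simp only [Prod.mk_eq_zero, not_and_or] at hq ⊢
    rcases hq with h | h
    · have := sq_pos_of_ne_zero h
      nlinarith [sq_nonneg b]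
    · have := sq_pos_of_ne_zero h
      nlinarith [sq_nonneg a]

lemma gp_join {W} {S1 S2 : Set (ℝ × ℝ × ℝ)} (h1 : IsOpen S1) (h2 : IsOpen S2) (v1 : volume S1 ≠ ⊤)
    (v2 : volume S2 ≠ ⊤) (g1 : GoodPair W S1 S1) (g2 : GoodPair W S2 S2) {x} (hx1 : x ∈ S1) (hx2 : x ∈ S2) :
    GoodPair W (S1 ∪ S2) (S1 ∪ S2) := by
  refine gp_union g1 g2 (gp_trans (E := S1 ∩ S2) (gp_mono g1 le_rfl Set.inter_subset_left)
    (gp_mono g2 le_rfl Set.inter_subset_right) v1 v2 ?_ ?_)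
  · exact ((h1.inter h2).measure_pos volume ⟨x, hx1, hx2⟩).ne'
  · exact ne_top_of_le_ne_top v1 (measure_mono Set.inter_subset_left)

lemma chain_gp {W : ℝ × ℝ × ℝ → ℝ}
    (hWp : ∀ p ∈ Om, 0 < W p) (hWc : ContinuousOn W Om) {x y : ℝ × ℝ × ℝ} (hx : x ∈ Om) (hy : y ∈ Om) :
    ∃ S, IsOpen S ∧ x ∈ S ∧ y ∈ S ∧ volume S ≠ ⊤ ∧ GoodPair W S S := by
  refine Om_conn.induction₂ (fun x y => ∃ S, IsOpen S ∧ x ∈ S ∧ y ∈ S ∧ volume S ≠ ⊤ ∧ GoodPair W S S)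
    ?_ ?_ ?_ hx hy
  · intro x hx
    obtain ⟨S, h1, h2, h3, h4⟩ := local_gp Om_open hWp hWc hx
    filter_upwards [mem_nhdsWithin_of_mem_nhds (h1.mem_nhds h2)] with y hy
    exact ⟨S, h1, h2, hy, h3, h4⟩
  · rintro x y z hx hy hz ⟨S, h1, h2, h3, h4, h5⟩ ⟨S', h1', h2', h3', h4', h5'⟩
    refine ⟨S ∪ S', h1.union h1', Or.inl h2, Or.inr h3', ?_, gp_join h1 h1' h4 h4' h5 h5' h3 h2'⟩
    exact (measure_union_lt_top h4.lt_top h4'.lt_top).ne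
  · rintro x y hx hy ⟨S, h1, h2, h3, h4, h5⟩
    exact ⟨S, h1, h3, h2, h4, h5⟩

lemma compact_gp {W : ℝ × ℝ × ℝ → ℝ}
    (hWp : ∀ p ∈ Om, 0 < W p) (hWc : ContinuousOn W Om) {K : Set (ℝ × ℝ × ℝ)} (hK : IsCompact K)
    (hKO : K ⊆ Om) : GoodPair W K K := by
  have hx : ((1 : ℝ), (0 : ℝ), (0 : ℝ)) ∈ Om := by simp [Om]
  obtain ⟨S, h1, h2, h3, h4, h5⟩ : ∃ S, IsOpen S ∧ ((1 : ℝ), (0 : ℝ), (0 : ℝ)) ∈ S ∧ K ⊆ S ∧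
      volume S ≠ ⊤ ∧ GoodPair W S S := by
    refine hK.induction_on (p := fun K => ∃ S, IsOpen S ∧ ((1 : ℝ), (0 : ℝ), (0 : ℝ)) ∈ S ∧ K ⊆ S ∧
      volume S ≠ ⊤ ∧ GoodPair W S S) ?_ ?_ ?_ ?_
    · obtain ⟨S, h1, h2, _, h4, h5⟩ := chain_gp hWp hWc hx hx
      exact ⟨S, h1, h2, Set.empty_subset _, h4, h5⟩
    · rintro s t hst ⟨S, h1, h2, h3, h4⟩
      exact ⟨S, h1, h2, hst.trans h3, h4⟩
    · rintro s t ⟨S, h1, h2, h3, h4, h5⟩ ⟨S', h1', h2', h3', h4', h5'⟩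
      exact ⟨S ∪ S', h1.union h1', Or.inl h2, Set.union_subset_union h3 h3',
        (measure_union_lt_top h4.lt_top h4'.lt_top).ne, gp_join h1 h1' h4 h4' h5 h5' h2 h2'⟩
    · intro y hy
      obtain ⟨S, h1, h2, h3, h4, h5⟩ := chain_gp hWp hWc hx (hKO hy)
      exact ⟨S, mem_nhdsWithin_of_mem_nhds (h1.mem_nhds h3), S, h1, h2, le_rfl, h4, h5⟩
  exact gp_mono h5 h3 h3

end HeisLSI

open Real MeasureTheory Filter

namespace HeisLSI

noncomputable def dF (β σ x n r M : ℝ) : ℝ := β * n * M ^ (-(3:ℝ)/4) - σ * x * r ^ (-σ/2 - 1)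
noncomputable def eF (β σ x n r M : ℝ) : ℝ :=
  β * (3 * r * M ^ (-(3:ℝ)/4) - 3 * n ^ 2 * M ^ (-(7:ℝ)/4)) - σ * r ^ (-σ/2 - 1)
    + σ * (σ + 2) * x ^ 2 * r ^ (-σ/2 - 2)

lemma oned (β σ : ℝ) {x n r M : ℝ → ℝ} {s : ℝ} (hx : HasDerivAt x 1 s)
    (hr : HasDerivAt r (2 * x s) s) (hM : HasDerivAt M (4 * n s) s) (hn : HasDerivAt n (3 * r s) s)
    (hr0 : 0 < r s) (hM0 : 0 < M s) :
    HasDerivAt (fun s => β * (M s) ^ ((1:ℝ)/4) + (r s) ^ (-σ/2)) (dF β σ (x s) (n s) (r s) (M s)) s ∧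
    HasDerivAt (fun s => dF β σ (x s) (n s) (r s) (M s)) (eF β σ (x s) (n s) (r s) (M s)) s := by
  constructor
  · have h1 := (hM.rpow_const (p := (1:ℝ)/4) (Or.inl hM0.ne')).const_mul β
    have h2 := hr.rpow_const (p := -σ/2) (Or.inl hr0.ne')
    refine (h1.add h2).congr_deriv ?_
    unfold dF
    rw [show (1:ℝ)/4 - 1 = -3/4 by norm_num]
    ring
  · have h1 := (hn.const_mul β).mul (hM.rpow_const (p := -(3:ℝ)/4) (Or.inl hM0.ne'))
    have h2 := (hx.const_mul σ).mul (hr.rpow_const (p := -σ/2 - 1) (Or.inl hr0.ne'))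
    refine (h1.sub h2).congr_deriv ?_
    unfold eF
    rw [show -(3:ℝ)/4 - 1 = -7/4 by norm_num, show -σ/2 - 1 - 1 = -σ/2 - 2 by ring]
    ring

noncomputable def rr (p : ℝ × ℝ × ℝ) : ℝ := p.1 ^ 2 + p.2.1 ^ 2
noncomputable def MM (p : ℝ × ℝ × ℝ) : ℝ := rr p ^ 2 + 16 * p.2.2 ^ 2
noncomputable def n1 (p : ℝ × ℝ × ℝ) : ℝ := rr p * p.1 + 4 * p.2.2 * p.2.1
noncomputable def n2 (p : ℝ × ℝ × ℝ) : ℝ := rr p * p.2.1 - 4 * p.2.2 * p.1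
noncomputable def psi (β σ : ℝ) (p : ℝ × ℝ × ℝ) : ℝ :=
  β * NH p + Real.sqrt (p.1 ^ 2 + p.2.1 ^ 2) ^ (-σ)
noncomputable def d1 (β σ : ℝ) (p : ℝ × ℝ × ℝ) : ℝ := dF β σ p.1 (n1 p) (rr p) (MM p)
noncomputable def d2 (β σ : ℝ) (p : ℝ × ℝ × ℝ) : ℝ := dF β σ p.2.1 (n2 p) (rr p) (MM p)
noncomputable def e1 (β σ : ℝ) (p : ℝ × ℝ × ℝ) : ℝ := eF β σ p.1 (n1 p) (rr p) (MM p)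
noncomputable def e2 (β σ : ℝ) (p : ℝ × ℝ × ℝ) : ℝ := eF β σ p.2.1 (n2 p) (rr p) (MM p)
noncomputable def qq (β σ : ℝ) (p : ℝ × ℝ × ℝ) : ℝ := d1 β σ p ^ 2 + d2 β σ p ^ 2

lemma qq_nonneg (β σ : ℝ) (p : ℝ × ℝ × ℝ) : 0 ≤ qq β σ p := by unfold qq; positivity

lemma psi_eq (β σ : ℝ) (p : ℝ × ℝ × ℝ) :
    psi β σ p = β * MM p ^ ((1:ℝ)/4) + rr p ^ (-σ/2) := by
  unfold psi NH MM rr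
  rw [Real.sqrt_eq_rpow, ← Real.rpow_mul (by positivity)]
  congr 2; ring

lemma MM_pos {p : ℝ × ℝ × ℝ} (hp : p ∈ Om) : 0 < MM p := by
  have : 0 < rr p := hp
  unfold MM; positivity

lemma rr_fl1 (p : ℝ × ℝ × ℝ) (s : ℝ) : HasDerivAt (fun s => rr (fl1 s p)) (2 * (fl1 s p).1) s := by
  have : HasDerivAt (fun s => (p.1 + s) ^ 2 + p.2.1 ^ 2) (2 * (p.1 + s)) s := by
    have := (((hasDerivAt_id s).const_add p.1).pow 2).add_const (p.2.1 ^ 2)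
    refine this.congr_deriv ?_
    simp
  exact this

lemma rr_fl2 (p : ℝ × ℝ × ℝ) (s : ℝ) : HasDerivAt (fun s => rr (fl2 s p)) (2 * (fl2 s p).2.1) s := by
  have : HasDerivAt (fun s => p.1 ^ 2 + (p.2.1 + s) ^ 2) (2 * (p.2.1 + s)) s := by
    have := (((hasDerivAt_id s).const_add p.2.1).pow 2).const_add (p.1 ^ 2)
    refine this.congr_deriv ?_
    simp
  exact this

lemma psi_fl1 (β σ : ℝ) {p : ℝ × ℝ × ℝ} {s : ℝ} (h : fl1 s p ∈ Om) :
    HasDerivAt (fun s => psi β σ (fl1 s p)) (d1 β σ (fl1 s p)) s ∧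
    HasDerivAt (fun s => d1 β σ (fl1 s p)) (e1 β σ (fl1 s p)) s := by
  simp only [psi_eq]
  have hx : HasDerivAt (fun s => (fl1 s p).1) 1 s := (hasDerivAt_id s).const_add p.1
  have hy : HasDerivAt (fun s => (fl1 s p).2.1) 0 s := hasDerivAt_const _ _
  have hz : HasDerivAt (fun s => (fl1 s p).2.2) ((fl1 s p).2.1 / 2) s := by
    have := ((hasDerivAt_id s).mul_const (p.2.1 / 2)).const_add p.2.2
    refine this.congr_deriv ?_
    simp [fl1]
  have hr := rr_fl1 p s
  refine oned β σ (x := fun s => (fl1 s p).1) (n := fun s => n1 (fl1 s p)) hx hr ?_ ?_ h (MM_pos h)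
  · refine ((hr.pow 2).add ((hz.pow 2).const_mul 16)).congr_deriv ?_
    simp [n1]; ring
  · refine ((hr.mul hx).add ((hz.const_mul 4).mul hy)).congr_deriv ?_
    simp [rr]; ring

lemma psi_fl2 (β σ : ℝ) {p : ℝ × ℝ × ℝ} {s : ℝ} (h : fl2 s p ∈ Om) :
    HasDerivAt (fun s => psi β σ (fl2 s p)) (d2 β σ (fl2 s p)) s ∧
    HasDerivAt (fun s => d2 β σ (fl2 s p)) (e2 β σ (fl2 s p)) s := by
  simp only [psi_eq]
  have hx : HasDerivAt (fun s => (fl2 s p).2.1) 1 s := (hasDerivAt_id s).const_add p.2.1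
  have hy : HasDerivAt (fun s => (fl2 s p).1) 0 s := hasDerivAt_const _ _
  have hz : HasDerivAt (fun s => (fl2 s p).2.2) (-((fl2 s p).1 / 2)) s := by
    have := ((hasDerivAt_id s).mul_const (p.1 / 2)).const_sub p.2.2
    refine this.congr_deriv ?_
    simp [fl2]
  have hr := rr_fl2 p s
  refine oned β σ (x := fun s => (fl2 s p).2.1) (n := fun s => n2 (fl2 s p)) hx hr ?_ ?_ h (MM_pos h)
  · refine ((hr.pow 2).add ((hz.pow 2).const_mul 16)).congr_deriv ?_
    simp [n2]; ring
  · refine ((hr.mul hx).sub ((hz.const_mul 4).mul hy)).congr_deriv ?_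
    simp [rr]; ring

lemma cont_rr : Continuous rr := by unfold rr; fun_prop
lemma cont_MM : Continuous MM := by unfold MM; have := cont_rr; fun_prop
lemma cont_n1 : Continuous n1 := by unfold n1; have := cont_rr; fun_prop
lemma cont_n2 : Continuous n2 := by unfold n2; have := cont_rr; fun_prop

lemma cont_rrp (a : ℝ) : ContinuousOn (fun p => rr p ^ a) Om :=
  cont_rr.continuousOn.rpow_const fun _ hp => Or.inl (ne_of_gt hp)
lemma cont_MMp (a : ℝ) : ContinuousOn (fun p => MM p ^ a) Om :=
  cont_MM.continuousOn.rpow_const fun _ hp => Or.inl (ne_of_gt (MM_pos hp))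

lemma cont_psi (β σ : ℝ) : ContinuousOn (psi β σ) Om := by
  have : psi β σ = fun p => β * MM p ^ ((1:ℝ)/4) + rr p ^ (-σ/2) := funext (psi_eq β σ)
  rw [this]
  have h1 := cont_rrp (-σ/2)
  have h2 := cont_MMp ((1:ℝ)/4)
  fun_prop

lemma cont_d1 (β σ : ℝ) : ContinuousOn (d1 β σ) Om := by
  unfold d1 dF
  have h1 := cont_rrp (-σ/2-1)
  have h2 := cont_MMp (-(3:ℝ)/4)
  have h3 := cont_n1
  fun_prop
lemma cont_d2 (β σ : ℝ) : ContinuousOn (d2 β σ) Om := by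
  unfold d2 dF
  have h1 := cont_rrp (-σ/2-1)
  have h2 := cont_MMp (-(3:ℝ)/4)
  have h3 := cont_n2
  fun_prop
lemma cont_e1 (β σ : ℝ) : ContinuousOn (e1 β σ) Om := by
  unfold e1 eF
  have h1 := cont_rrp (-σ/2-1)
  have h4 := cont_rrp (-σ/2-2)
  have h2 := cont_MMp (-(3:ℝ)/4)
  have h5 := cont_MMp (-(7:ℝ)/4)
  have h3 := cont_n1
  have h6 := cont_rr
  fun_prop
lemma cont_e2 (β σ : ℝ) : ContinuousOn (e2 β σ) Om := by
  unfold e2 eF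
  have h1 := cont_rrp (-σ/2-1)
  have h4 := cont_rrp (-σ/2-2)
  have h2 := cont_MMp (-(3:ℝ)/4)
  have h5 := cont_MMp (-(7:ℝ)/4)
  have h3 := cont_n2
  have h6 := cont_rr
  fun_prop
lemma cont_qq (β σ : ℝ) : ContinuousOn (qq β σ) Om := by
  unfold qq
  have h1 := cont_d1 β σ
  have h2 := cont_d2 β σ
  fun_prop

lemma psi_pos {β σ : ℝ} (hβ : 0 < β) {p : ℝ × ℝ × ℝ} (hp : p ∈ Om) : 0 < psi β σ p := by
  rw [psi_eq]
  have h1 := MM_pos hp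
  have h2 : 0 < rr p := hp
  positivity

/-- sublevel set -/
def Ks (β σ L : ℝ) : Set (ℝ × ℝ × ℝ) := {p | p ∈ Om ∧ psi β σ p ≤ L}

lemma Ks_compact {β σ : ℝ} (hβ : 0 < β) (hσ : 0 < σ) (L : ℝ) : IsCompact (Ks β σ L) := by
  by_cases hL : L ≤ 0
  · have : Ks β σ L = ∅ := by
      ext p
      simp only [Ks, Set.mem_ofPred_eq, Set.mem_empty_iff_false, iff_false, not_and, not_le]
      intro hp
      exact hL.trans_lt (psi_pos hβ hp)
    rw [this]; exact isCompact_empty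
  push Not at hL
  set ε := L ^ (-2/σ) with hε
  have hε0 : 0 < ε := by positivity
  have hbd : ∀ p ∈ Ks β σ L, ε ≤ rr p ∧ MM p ≤ (L / β) ^ 4 := by
    rintro p ⟨hp, hps⟩
    have hr : 0 < rr p := hp
    have hM := MM_pos hp
    rw [psi_eq] at hps
    constructor
    · have h1 : rr p ^ (-σ/2) ≤ L := by
        have : 0 < β * MM p ^ ((1:ℝ)/4) := by positivity
        linarith
      have h2 := Real.rpow_le_rpow_of_nonpos (by positivity) h1 (z := -2/σ)
        (by apply div_nonpos_of_nonpos_of_nonneg <;> linarith)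
      rw [← Real.rpow_mul hr.le, show -σ/2 * (-2/σ) = 1 by field_simp, Real.rpow_one] at h2
      exact h2
    · have h1 : β * MM p ^ ((1:ℝ)/4) ≤ L := by
        have : 0 < rr p ^ (-σ/2) := by positivity
        linarith
      have h2 : MM p ^ ((1:ℝ)/4) ≤ L / β := by rw [le_div_iff₀ hβ]; linarith
      have h3 := pow_le_pow_left₀ (by positivity) h2 4
      rw [← Real.rpow_natCast, ← Real.rpow_mul hM.le] at h3
      norm_num at h3 ⊢
      exact h3
  have hsub : {p : ℝ × ℝ × ℝ | ε ≤ rr p} ⊆ Om := fun p hp => hε0.trans_le hp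
  have hcl : IsClosed (Ks β σ L) := by
    have h1 : IsClosed {p : ℝ × ℝ × ℝ | ε ≤ rr p} := isClosed_le continuous_const cont_rr
    have := ((cont_psi β σ).mono hsub).preimage_isClosed_of_isClosed h1 (isClosed_Iic (a := L))
    convert this using 1
    ext p
    constructor
    · intro hp; exact ⟨(hbd p hp).1, hp.2⟩
    · intro hp; exact ⟨hsub hp.1, hp.2⟩
  refine Metric.isCompact_of_isClosed_isBounded hcl ?_
  rw [isBounded_iff_forall_norm_le]
  refine ⟨1 + (L/β)^4, fun p hp => ?_⟩
  have h := (hbd p hp).2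
  have hrn : 0 ≤ rr p := by unfold rr; positivity
  have hQ : 0 ≤ (L/β)^4 := by positivity
  set Q := (L/β)^4
  have h2 : rr p ^ 2 ≤ Q := by unfold MM at h; nlinarith [sq_nonneg p.2.2]
  have h3 : p.2.2 ^ 2 ≤ Q := by unfold MM at h; nlinarith [sq_nonneg p.2.2, sq_nonneg (rr p)]
  have h4 : p.1 ^ 2 ≤ rr p := by unfold rr; nlinarith [sq_nonneg p.2.1]
  have h5 : p.2.1 ^ 2 ≤ rr p := by unfold rr; nlinarith [sq_nonneg p.1]
  have h6 : rr p ≤ 1 + Q := by nlinarith [sq_nonneg (rr p - 1)]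
  have key : ∀ x : ℝ, x ^ 2 ≤ 1 + Q → |x| ≤ 1 + Q := fun x hx => by
    by_contra hh
    push Not at hh
    nlinarith [sq_abs x]
  simp only [Prod.norm_def, Real.norm_eq_abs, sup_le_iff]
  exact ⟨key _ (h4.trans h6), key _ (h5.trans h6), key _ (by linarith)⟩

end HeisLSI

open Real MeasureTheory Filter

namespace HeisLSI

set_option maxHeartbeats 1000000 in
lemma scal_q {β σ : ℝ} (hβ : 0 < β) (hσ : 0 < σ) : ∃ L0 ≥ (1:ℝ), ∀ r N y q : ℝ, 0 < r → r ≤ N →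
    y = r ^ (-σ) → q = β ^ 2 * r ^ 2 / N ^ 2 - 2 * β * σ * r ^ 2 * y / N ^ 3 + σ ^ 2 * y ^ 2 / r ^ 2 →
    L0 ≤ β * N + y → (β ^ 2 * r ^ 2 / N ^ 2 + σ ^ 2 * y ^ 2 / r ^ 2) / 8 ≤ q := by
  set r0 := min 1 (σ / (2 * β)) with hr0
  set r1 := max 1 (4 * σ / β) with hr1
  have hr0p : 0 < r0 := lt_min one_pos (by positivity)
  refine ⟨max 1 (2 * β * r1 + r0 ^ (-σ) + 1), le_max_left _ _, ?_⟩
  intro r N y q hr hrN hy hq hL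
  have hN : 0 < N := hr.trans_le hrN
  have hy0 : 0 < y := by rw [hy]; positivity
  have hL' := (le_max_right _ _).trans hL
  set a := r / N with ha
  set b := y / r with hb
  have ha0 : 0 < a := by positivity
  have hb0 : 0 < b := by positivity
  have ha1 : a ≤ 1 := by rw [ha, div_le_one hN]; exact hrN
  set A := β * a with hA
  set B := σ * b with hB
  have hA0 : 0 < A := by positivity
  have hB0 : 0 < B := by positivity
  have e1 : q = A ^ 2 + B ^ 2 - 2 * (A * B) * a ^ 2 := by
    rw [hq, hA, hB, ha, hb]; field_simp; ring
  have e2 : β ^ 2 * r ^ 2 / N ^ 2 + σ ^ 2 * y ^ 2 / r ^ 2 = A ^ 2 + B ^ 2 := by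
    rw [hA, hB, ha, hb]; field_simp
  rw [e2, e1]
  have hAB : 0 < A * B := by positivity
  have ha2 : a ^ 2 ≤ 1 := by nlinarith
  by_cases hc : a ^ 2 ≤ 1 / 2
  · nlinarith [sq_nonneg (A - B), mul_le_mul_of_nonneg_left hc hAB.le]
  push Not at hc
  have ha3 : 1 / 2 < a := by nlinarith
  have hN2 : N < 2 * r := by
    rw [ha, lt_div_iff₀ hN] at ha3; linarith
  have hAβ : A ≤ β := by rw [hA]; nlinarith
  have hAβ' : β / 2 ≤ A := by rw [hA]; nlinarith
  have hlow : (A - B) ^ 2 ≤ A ^ 2 + B ^ 2 - 2 * (A * B) * a ^ 2 := by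
    have h1 := mul_le_mul_of_nonneg_left ha2 hAB.le
    have h2 : (A - B) ^ 2 = A ^ 2 + B ^ 2 - 2 * (A * B * 1) := by ring
    rw [h2]
    linarith
  refine le_trans ?_ hlow
  by_cases h0 : r ≤ r0
  · have h1 : r ≤ 1 := h0.trans (min_le_left _ _)
    have h2 : r ≤ σ / (2 * β) := h0.trans (min_le_right _ _)
    have hy1 : 1 ≤ y := by rw [hy]; exact Real.one_le_rpow_of_pos_of_le_one_of_nonpos hr h1 (by linarith)
    have : 2 * β ≤ B := by
      rw [hB, hb, ← mul_div_assoc, le_div_iff₀ hr]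
      rw [le_div_iff₀ (by positivity)] at h2
      nlinarith
    nlinarith
  push Not at h0
  by_cases h1 : r1 ≤ r
  · have h2 : 1 ≤ r := (le_max_left _ _).trans h1
    have h3 : 4 * σ / β ≤ r := (le_max_right _ _).trans h1
    have hy1 : y ≤ 1 := by rw [hy]; exact Real.rpow_le_one_of_one_le_of_nonpos h2 (by linarith)
    have : B ≤ β / 4 := by
      rw [hB, hb, ← mul_div_assoc, div_le_iff₀ hr]
      rw [div_le_iff₀ hβ] at h3
      nlinarith
    nlinarith
  push Not at h1
  exfalso
  have : y ≤ r0 ^ (-σ) := by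
    rw [hy]; exact Real.rpow_le_rpow_of_nonpos hr0p h0.le (by linarith)
  nlinarith

set_option maxHeartbeats 1000000 in
lemma scal {β σ : ℝ} (hβ : 0 < β) (hσ : 0 < σ) : ∃ L0 ≥ (1:ℝ), ∃ c > (0:ℝ), ∃ C ≥ (0:ℝ),
    ∀ r N y q : ℝ, 0 < r → r ≤ N →
    y = r ^ (-σ) → q = β ^ 2 * r ^ 2 / N ^ 2 - 2 * β * σ * r ^ 2 * y / N ^ 3 + σ ^ 2 * y ^ 2 / r ^ 2 →
    L0 ≤ β * N + y → c ≤ (β * N + y) ^ 2 * q ∧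
      3 * β * r ^ 2 / N ^ 3 + σ ^ 2 * y / r ^ 2 ≤ C * ((β * N + y) ^ 2 * q) := by
  obtain ⟨L0, hL0, h⟩ := scal_q hβ hσ
  set m := min (β ^ 4) (σ ^ 2) / 8 with hm
  have hm0 : 0 < m := by have : 0 < min (β^4) (σ^2) := lt_min (by positivity) (by positivity)
                         positivity
  have hmβ : 8 * m ≤ β ^ 4 := by rw [hm]; linarith [min_le_left (β^4) (σ^2)]
  have hmσ : 8 * m ≤ σ ^ 2 := by rw [hm]; linarith [min_le_right (β^4) (σ^2)]
  refine ⟨L0, hL0, m, hm0, 8 * (3 * β) * (1 / σ ^ 2 + 1 / β ^ 2) + 8 + σ ^ 2 / m, by positivity, ?_⟩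
  intro r N y q hr hrN hy hq hL
  have hq8 := h r N y q hr hrN hy hq hL
  have hN : 0 < N := hr.trans_le hrN
  have hy0 : 0 < y := by rw [hy]; positivity
  set P := β * N + y with hP
  have hP1 : 1 ≤ P := hL0.trans hL
  have hP2 : 1 ≤ P ^ 2 := by nlinarith
  have t1 : 0 ≤ β ^ 2 * r ^ 2 / N ^ 2 := by positivity
  have t2 : 0 ≤ σ ^ 2 * y ^ 2 / r ^ 2 := by positivity
  have hq0 : 0 ≤ q := by linarith
  have hqP : q ≤ P ^ 2 * q := by nlinarith
  by_cases h1 : r ≤ 1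
  · have hy1 : 1 ≤ y := by rw [hy]; exact Real.one_le_rpow_of_pos_of_le_one_of_nonpos hr h1 (by linarith)
    have hy2 : 1 ≤ y ^ 2 := by nlinarith
    have hr2 : r ^ 2 ≤ 1 := by nlinarith
    have u1 : σ ^ 2 ≤ σ ^ 2 * y ^ 2 / r ^ 2 := by
      rw [le_div_iff₀ (by positivity)]
      have : 0 < σ ^ 2 := by positivity
      nlinarith
    have u2 : m ≤ P ^ 2 * q := by linarith
    refine ⟨u2, ?_⟩
    have u3 : σ ^ 2 * y / r ^ 2 ≤ 8 * (P ^ 2 * q) := by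
      have : σ ^ 2 * y / r ^ 2 ≤ σ ^ 2 * y ^ 2 / r ^ 2 := by
        gcongr; nlinarith
      linarith
    have u4 : r ^ 2 / N ^ 3 ≤ 8 / σ ^ 2 * (P ^ 2 * q) := by
      have v1 : r ^ 2 / N ^ 3 ≤ r ^ 2 / r ^ 3 := by gcongr
      have v2 : r ^ 2 / r ^ 3 ≤ y ^ 2 / r ^ 2 := by
        rw [div_le_div_iff₀ (by positivity) (by positivity)]
        have : r ^ 3 * r ≤ r ^ 3 * y ^ 2 := by
          apply mul_le_mul_of_nonneg_left _ (by positivity); linarith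
        nlinarith
      have v3 : y ^ 2 / r ^ 2 = (σ ^ 2 * y ^ 2 / r ^ 2) / σ ^ 2 := by field_simp
      rw [div_mul_eq_mul_div, le_div_iff₀ (by positivity)]
      have : y ^ 2 / r ^ 2 * σ ^ 2 = σ ^ 2 * y ^ 2 / r ^ 2 := by ring
      nlinarith [mul_le_mul_of_nonneg_right (v1.trans v2) (sq_nonneg σ)]
    have : 0 ≤ 8 * (3 * β) * (1 / β ^ 2) * (P ^ 2 * q) := by positivity
    have : 0 ≤ σ ^ 2 / m * (P ^ 2 * q) := by positivity
    have e : 3 * β * r ^ 2 / N ^ 3 = 3 * β * (r ^ 2 / N ^ 3) := by ring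
    rw [e]
    have := mul_le_mul_of_nonneg_left u4 (by positivity : 0 ≤ 3 * β)
    have e2 : 3 * β * (8 / σ ^ 2 * (P ^ 2 * q)) = 8 * (3 * β) * (1 / σ ^ 2) * (P ^ 2 * q) := by ring
    rw [e2] at this
    linarith
  · push Not at h1
    have hy1 : y ≤ 1 := by rw [hy]; exact Real.rpow_le_one_of_one_le_of_nonpos h1.le (by linarith)
    have hN1 : 1 ≤ N := by linarith
    have u2 : m ≤ P ^ 2 * q := by
      have w1 : β ^ 2 / N ^ 2 ≤ β ^ 2 * r ^ 2 / N ^ 2 := by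
        gcongr; exact le_mul_of_one_le_right (sq_nonneg β) (by nlinarith)
      have w2 : β ^ 2 / N ^ 2 ≤ 8 * q := by linarith
      have w3 : (β * N) ^ 2 ≤ P ^ 2 := by
        apply pow_le_pow_left₀ (by positivity); linarith
      have w4 : β ^ 4 = (β * N) ^ 2 * (β ^ 2 / N ^ 2) := by field_simp
      have w5 : (β * N) ^ 2 * (β ^ 2 / N ^ 2) ≤ P ^ 2 * (8 * q) :=
        mul_le_mul w3 w2 (by positivity) (by positivity)
      linarith
    refine ⟨u2, ?_⟩
    have u3 : σ ^ 2 * y / r ^ 2 ≤ σ ^ 2 / m * (P ^ 2 * q) := by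
      have v1 : σ ^ 2 * y / r ^ 2 ≤ σ ^ 2 := by
        rw [div_le_iff₀ (by positivity)]
        have : 1 ≤ r ^ 2 := by nlinarith
        have : y ≤ r ^ 2 := by linarith
        exact mul_le_mul_of_nonneg_left this (sq_nonneg _)
      have v2 : σ ^ 2 = σ ^ 2 / m * m := by field_simp
      have v3 : σ ^ 2 / m * m ≤ σ ^ 2 / m * (P ^ 2 * q) := by gcongr
      linarith
    have u4 : r ^ 2 / N ^ 3 ≤ 8 / β ^ 2 * (P ^ 2 * q) := by
      have v1 : r ^ 2 / N ^ 3 ≤ r ^ 2 / N ^ 2 := by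
        gcongr
        norm_num
      rw [div_mul_eq_mul_div, le_div_iff₀ (by positivity)]
      have : r ^ 2 / N ^ 2 * β ^ 2 = β ^ 2 * r ^ 2 / N ^ 2 := by ring
      nlinarith [mul_le_mul_of_nonneg_right v1 (sq_nonneg β)]
    have : 0 ≤ 8 * (3 * β) * (1 / σ ^ 2) * (P ^ 2 * q) := by positivity
    have : 0 ≤ 8 * (P ^ 2 * q) := by positivity
    have e : 3 * β * r ^ 2 / N ^ 3 = 3 * β * (r ^ 2 / N ^ 3) := by ring
    rw [e]
    have := mul_le_mul_of_nonneg_left u4 (by positivity : 0 ≤ 3 * β)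
    have e2 : 3 * β * (8 / β ^ 2 * (P ^ 2 * q)) = 8 * (3 * β) * (1 / β ^ 2) * (P ^ 2 * q) := by ring
    rw [e2] at this
    linarith

lemma geo {β σ : ℝ} (hβ : 0 < β) (hσ : 0 < σ) : ∃ L0 ≥ (1:ℝ), ∃ c > (0:ℝ), ∃ C ≥ (0:ℝ),
    ∀ p ∈ Om, L0 ≤ psi β σ p → c ≤ psi β σ p ^ 2 * qq β σ p ∧
      e1 β σ p + e2 β σ p ≤ C * (psi β σ p ^ 2 * qq β σ p) := by
  obtain ⟨L0, hL0, c, hc, C, hC, h⟩ := scal hβ hσ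
  refine ⟨L0, hL0, c, hc, C, hC, ?_⟩
  intro p hp hL
  have hr0 : 0 < rr p := hp
  have hM := MM_pos hp
  set r := Real.sqrt (rr p) with hr
  set N := MM p ^ ((1:ℝ)/4) with hN
  have hrp : 0 < r := Real.sqrt_pos.2 hr0
  have hNp : 0 < N := by positivity
  have er : rr p = r ^ 2 := (Real.sq_sqrt hr0.le).symm
  have eM : MM p = N ^ 4 := by
    rw [hN, ← Real.rpow_natCast, ← Real.rpow_mul hM.le]; norm_num
  have hrN : r ≤ N := by
    have : r ^ 4 ≤ N ^ 4 := by
      rw [← eM]; unfold MM; rw [er]; nlinarith [sq_nonneg p.2.2]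
    exact le_of_pow_le_pow_left₀ (by norm_num) hNp.le this
  set y := r ^ (-σ) with hy
  have ep : psi β σ p = β * N + y := rfl
  have eM3 : MM p ^ (-(3:ℝ)/4) = (N ^ 3)⁻¹ := by
    rw [hN, ← Real.rpow_natCast, ← Real.rpow_mul hM.le, ← Real.rpow_neg hM.le]; norm_num
  have eM7 : MM p ^ (-(7:ℝ)/4) = (N ^ 7)⁻¹ := by
    rw [hN, ← Real.rpow_natCast, ← Real.rpow_mul hM.le, ← Real.rpow_neg hM.le]; norm_num
  have er1 : rr p ^ (-σ/2 - 1) = y / r ^ 2 := by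
    rw [er, hy, ← Real.rpow_natCast, ← Real.rpow_mul hrp.le, ← Real.rpow_sub hrp]
    congr 1; push_cast; ring
  have er2 : rr p ^ (-σ/2 - 2) = y / r ^ 4 := by
    rw [er, hy, ← Real.rpow_natCast, ← Real.rpow_natCast, ← Real.rpow_mul hrp.le, ← Real.rpow_sub hrp]
    congr 1; push_cast; ring
  have en : n1 p ^ 2 + n2 p ^ 2 = r ^ 2 * N ^ 4 := by
    rw [← eM, ← er]; unfold n1 n2 MM rr; ring
  have ex : p.1 * n1 p + p.2.1 * n2 p = r ^ 4 := by
    rw [show r ^ 4 = (r ^ 2) ^ 2 by ring, ← er]; unfold n1 n2 rr; ring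
  have ex2 : p.1 ^ 2 + p.2.1 ^ 2 = r ^ 2 := er
  have eq : qq β σ p = β ^ 2 * r ^ 2 / N ^ 2 - 2 * β * σ * r ^ 2 * y / N ^ 3 + σ ^ 2 * y ^ 2 / r ^ 2 := by
    unfold qq d1 d2 dF
    rw [eM3, er1]
    have : (β * n1 p * (N ^ 3)⁻¹ - σ * p.1 * (y / r ^ 2)) ^ 2 + (β * n2 p * (N ^ 3)⁻¹ - σ * p.2.1 * (y / r ^ 2)) ^ 2
      = β ^ 2 * (n1 p ^ 2 + n2 p ^ 2) / N ^ 6 - 2 * β * σ * (p.1 * n1 p + p.2.1 * n2 p) * y / (N ^ 3 * r ^ 2)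
        + σ ^ 2 * (p.1 ^ 2 + p.2.1 ^ 2) * y ^ 2 / r ^ 4 := by
      field_simp; ring
    rw [this, en, ex, ex2]
    field_simp
  have ee : e1 β σ p + e2 β σ p = 3 * β * r ^ 2 / N ^ 3 + σ ^ 2 * y / r ^ 2 := by
    unfold e1 e2 eF
    rw [eM3, er1, er2, eM7, er]
    have : β * (3 * r ^ 2 * (N ^ 3)⁻¹ - 3 * n1 p ^ 2 * (N ^ 7)⁻¹) - σ * (y / r ^ 2) + σ * (σ + 2) * p.1 ^ 2 * (y / r ^ 4)
      + (β * (3 * r ^ 2 * (N ^ 3)⁻¹ - 3 * n2 p ^ 2 * (N ^ 7)⁻¹) - σ * (y / r ^ 2) + σ * (σ + 2) * p.2.1 ^ 2 * (y / r ^ 4))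
      = 6 * β * r ^ 2 / N ^ 3 - 3 * β * (n1 p ^ 2 + n2 p ^ 2) / N ^ 7 - 2 * σ * y / r ^ 2
        + σ * (σ + 2) * (p.1 ^ 2 + p.2.1 ^ 2) * y / r ^ 4 := by
      field_simp; ring
    rw [this, en, ex2]
    field_simp; ring
  rw [ee, ep]
  exact h r N y _ hrp hrN hy eq hL

end HeisLSI

open Real MeasureTheory Filter

namespace HeisLSI

lemma ibp {Φ : ℝ → (ℝ × ℝ × ℝ) → (ℝ × ℝ × ℝ)} (mp : ∀ s, MeasurePreserving (Φ s) volume volume)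
    (hΦ : Continuous (fun q : ℝ × (ℝ × ℝ × ℝ) => Φ q.1 q.2)) {w J : ℝ × ℝ × ℝ → ℝ}
    (hw : Integrable w) (hJ : Integrable J)
    (h : ∀ᵐ p, w (Φ 1 p) - w p ≤ ∫ s in (0:ℝ)..1, J (Φ s p)) : 0 ≤ ∫ p, J p := by
  set μ : Measure ℝ := volume.restrict (Set.Ioc 0 1)
  have hμ : μ Set.univ = 1 := by simp [μ]
  have mpp : MeasurePreserving (fun z : ℝ × (ℝ × ℝ × ℝ) => (z.1, Φ z.1 z.2)) (μ.prod volume) (μ.prod volume) := by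
    refine MeasurePreserving.skew_product (f := id) (g := Φ) (MeasurePreserving.id μ) hΦ.measurable ?_
    exact Eventually.of_forall fun s => (mp s).map_eq
  have hJ2 : Integrable (fun z : ℝ × (ℝ × ℝ × ℝ) => J z.2) (μ.prod volume) := hJ.comp_snd μ
  have hJ3 : Integrable (fun z : ℝ × (ℝ × ℝ × ℝ) => J (Φ z.1 z.2)) (μ.prod volume) :=
    mpp.integrable_comp_of_integrable hJ2
  have hwΦ : Integrable (fun p => w (Φ 1 p)) := (mp 1).integrable_comp_of_integrable hw
  have e0 : ∫ p, w (Φ 1 p) = ∫ p, w p := by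
    have := integral_map (μ := volume) (φ := Φ 1) (f := w) (mp 1).measurable.aemeasurable
      (by rw [(mp 1).map_eq]; exact hw.1)
    rw [(mp 1).map_eq] at this
    exact this.symm
  have e1 : ∀ s, ∫ p, J (Φ s p) = ∫ p, J p := by
    intro s
    have := integral_map (μ := volume) (φ := Φ s) (f := J) (mp s).measurable.aemeasurable
      (by rw [(mp s).map_eq]; exact hJ.1)
    rw [(mp s).map_eq] at this
    exact this.symm
  have e2 : ∫ p, ∫ s in (0:ℝ)..1, J (Φ s p) = ∫ p, J p := by
    simp only [intervalIntegral.integral_of_le zero_le_one]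
    rw [← integral_integral_swap (f := fun s p => J (Φ s p)) hJ3]
    simp only [e1]
    rw [integral_const, Measure.real, hμ]
    simp
  have hJint : Integrable (fun p => ∫ s in (0:ℝ)..1, J (Φ s p)) := by
    simp only [intervalIntegral.integral_of_le zero_le_one]
    exact hJ3.integral_prod_right
  have := integral_mono_ae (hwΦ.sub hw) hJint h
  rw [e2] at this
  refine le_trans (le_of_eq ?_) this
  simp only [Pi.sub_apply]
  rw [integral_sub hwΦ hw, e0, sub_self]

lemma meas_ind {g : ℝ × ℝ × ℝ → ℝ} (hg : ContinuousOn g Om) : Measurable (Om.indicator g) := by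
  classical
  rw [← Set.piecewise_eq_indicator]
  exact hg.measurable_piecewise continuousOn_const Om_open.measurableSet

lemma int_cs {β σ : ℝ} (hβ : 0 < β) (hσ : 0 < σ) {M : ℝ} {g : ℝ × ℝ × ℝ → ℝ} (hg : ContinuousOn g Om)
    (h : ∀ p ∈ Om, M ≤ psi β σ p → g p = 0) : Integrable (Om.indicator g) := by
  have hK := Ks_compact hβ hσ M
  have hsub : Ks β σ M ⊆ Om := fun p hp => hp.1
  have h1 : IntegrableOn g (Ks β σ M) := (hg.mono hsub).integrableOn_compact hK
  have h2 : IntegrableOn (Om.indicator g) (Ks β σ M) :=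
    h1.congr_fun (fun p hp => (Set.indicator_of_mem (hsub hp) g).symm) hK.measurableSet
  refine (integrableOn_iff_integrable_of_support_subset ?_).1 h2
  intro p hp
  by_contra hK'
  apply hp
  by_cases hO : p ∈ Om
  · rw [Set.indicator_of_mem hO]
    apply h p hO
    by_contra hlt
    push Not at hlt
    exact hK' ⟨hO, hlt.le⟩
  · rw [Set.indicator_of_notMem hO]

lemma ibp_dir {β σ : ℝ} (hβ : 0 < β) (hσ : 0 < σ)
    {Φ : ℝ → (ℝ × ℝ × ℝ) → (ℝ × ℝ × ℝ)} (mp : ∀ s, MeasurePreserving (Φ s) volume volume)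
    (hΦ : Continuous (fun q : ℝ × (ℝ × ℝ × ℝ) => Φ q.1 q.2)) (h0 : ∀ p, Φ 0 p = p)
    {d e f Xf : ℝ × ℝ × ℝ → ℝ}
    (hψ : ∀ p s, Φ s p ∈ Om → HasDerivAt (fun s => psi β σ (Φ s p)) (d (Φ s p)) s ∧
      HasDerivAt (fun s => d (Φ s p)) (e (Φ s p)) s)
    (hd : ContinuousOn d Om) (he : ContinuousOn e Om)
    (hf : ∀ p s, HasDerivAt (fun s => f (Φ s p)) (Xf (Φ s p)) s) (hfc : Continuous f) (hXc : Continuous Xf)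
    (hae : ∀ᵐ p, ∀ s, Φ s p ∈ Om) {k k' κ : ℝ → ℝ} {M : ℝ}
    (hk : ∀ s > 0, HasDerivAt k (k' s) s) (hkκ : ∀ s > 0, k' s ≤ κ s) (hκ : ContinuousOn κ (Set.Ioi 0))
    (hk0 : ∀ s ≥ M, k s = 0) (hκ0 : ∀ s ≥ M, κ s = 0) :
    Integrable (Om.indicator fun p => 2 * f p * Xf p * (k (psi β σ p) * d p) +
      f p ^ 2 * (κ (psi β σ p) * d p ^ 2 + k (psi β σ p) * e p)) ∧
    0 ≤ ∫ p, Om.indicator (fun p => 2 * f p * Xf p * (k (psi β σ p) * d p) +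
      f p ^ 2 * (κ (psi β σ p) * d p ^ 2 + k (psi β σ p) * e p)) p := by
  have hψc := cont_psi β σ
  have hmaps : Set.MapsTo (psi β σ) Om (Set.Ioi 0) := fun p hp => psi_pos hβ hp
  have hkc : ContinuousOn k (Set.Ioi 0) := fun s hs => (hk s hs).continuousAt.continuousWithinAt
  have hkψ : ContinuousOn (fun p => k (psi β σ p)) Om := hkc.comp hψc hmaps
  have hκψ : ContinuousOn (fun p => κ (psi β σ p)) Om := hκ.comp hψc hmaps
  set Jf : ℝ × ℝ × ℝ → ℝ := fun p => 2 * f p * Xf p * (k (psi β σ p) * d p) +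
      f p ^ 2 * (κ (psi β σ p) * d p ^ 2 + k (psi β σ p) * e p) with hJf
  have hJc : ContinuousOn Jf Om := by
    have h1 := hfc.continuousOn (s := Om)
    have h2 := hXc.continuousOn (s := Om)
    simp only [hJf]
    fun_prop
  set wf : ℝ × ℝ × ℝ → ℝ := fun p => f p ^ 2 * (k (psi β σ p) * d p) with hwf
  have hwc : ContinuousOn wf Om := by
    have h1 := hfc.continuousOn (s := Om)
    simp only [hwf]
    fun_prop
  have hJi : Integrable (Om.indicator Jf) := int_cs hβ hσ (M := M) hJc (by
    intro p _ hp; simp [hJf, hk0 _ hp, hκ0 _ hp])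
  have hwi : Integrable (Om.indicator wf) := int_cs hβ hσ (M := M) hwc (by
    intro p _ hp; simp [hwf, hk0 _ hp])
  refine ⟨hJi, ibp mp hΦ hwi hJi ?_⟩
  filter_upwards [hae] with p hp
  have hpO : p ∈ Om := by simpa [h0] using hp 0
  have hder : ∀ s, HasDerivAt (fun s => wf (Φ s p)) (2 * f (Φ s p) * Xf (Φ s p) * (k (psi β σ (Φ s p)) * d (Φ s p)) +
      f (Φ s p) ^ 2 * (k' (psi β σ (Φ s p)) * d (Φ s p) ^ 2 + k (psi β σ (Φ s p)) * e (Φ s p))) s := by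
    intro s
    have a1 := (hf p s).pow 2
    have a2 := (hk _ (psi_pos (σ := σ) hβ (hp s))).comp s (hψ p s (hp s)).1
    have a3 := a1.mul (a2.mul (hψ p s (hp s)).2)
    refine a3.congr_deriv ?_
    simp only [Function.comp_apply, Pi.mul_apply, Pi.pow_apply]
    push_cast
    ring
  have hline : Continuous (fun s => Jf (Φ s p)) := by
    have hc : Continuous (fun s => Φ s p) := hΦ.comp (by fun_prop : Continuous fun s : ℝ => (s, p))
    rw [← continuousOn_univ]
    exact hJc.comp hc.continuousOn fun s _ => hp s
  have key := intervalIntegral.sub_le_integral_of_hasDeriv_right_of_le (a := 0) (b := 1) zero_le_one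
    (g := fun s => wf (Φ s p)) (φ := fun s => Jf (Φ s p))
    (fun s _ => (hder s).continuousAt.continuousWithinAt)
    (fun s _ => (hder s).hasDerivWithinAt) (hline.continuousOn.integrableOn_compact isCompact_Icc) (by
      intro s _
      simp only [hJf]
      gcongr
      exact hkκ _ (psi_pos hβ (hp s)))
  simp only [h0] at key
  rw [Set.indicator_of_mem (hp 1), Set.indicator_of_mem hpO]
  refine key.trans (le_of_eq ?_)
  congr 1
  ext s
  rw [Set.indicator_of_mem (hp s)]

lemma ae_fl1 : ∀ᵐ p : ℝ × ℝ × ℝ, ∀ s, fl1 s p ∈ Om := by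
  have h : ∀ᵐ p : ℝ × ℝ × ℝ, p.2.1 ≠ 0 := by
    have h1 : Measure.QuasiMeasurePreserving (fun p : ℝ × ℝ × ℝ => p.2.1) volume volume :=
      (Measure.quasiMeasurePreserving_fst (μ := (volume : Measure ℝ)) (ν := (volume : Measure ℝ))).comp
        (Measure.quasiMeasurePreserving_snd (μ := (volume : Measure ℝ)) (ν := (volume : Measure (ℝ × ℝ))))
    exact h1.ae (Measure.ae_ne volume 0)
  filter_upwards [h] with p hp s
  have := sq_pos_of_ne_zero hp
  simp only [Om, fl1, Set.mem_ofPred_eq]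
  positivity

lemma ae_fl2 : ∀ᵐ p : ℝ × ℝ × ℝ, ∀ s, fl2 s p ∈ Om := by
  have h : ∀ᵐ p : ℝ × ℝ × ℝ, p.1 ≠ 0 := by
    have h1 : Measure.QuasiMeasurePreserving (fun p : ℝ × ℝ × ℝ => p.1) volume volume :=
      (Measure.quasiMeasurePreserving_fst (μ := (volume : Measure ℝ)) (ν := (volume : Measure (ℝ × ℝ))))
    exact h1.ae (Measure.ae_ne volume 0)
  filter_upwards [h] with p hp s
  have := sq_pos_of_ne_zero hp
  simp only [Om, fl2, Set.mem_ofPred_eq]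
  positivity

lemma ae_Om : ∀ᵐ p : ℝ × ℝ × ℝ, p ∈ Om := by
  filter_upwards [ae_fl1] with p hp
  simpa [fl1_zero] using hp 0

end HeisLSI

open Real MeasureTheory Filter

namespace HeisLSI

structure Hyp (β σ : ℝ) (V V' V'' : ℝ → ℝ) (R2 C0 : ℝ) : Prop where
  hβ : 0 < β
  hσ : 0 < σ
  V0 : ∀ s > (0:ℝ), 0 ≤ V s
  dV : ∀ s > (0:ℝ), HasDerivAt V (V' s) s
  dV' : ∀ s > (0:ℝ), HasDerivAt V' (V'' s) s
  V'0 : ∀ s > (0:ℝ), 0 ≤ V' s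
  R2pos : 1 ≤ R2
  C0pos : 0 ≤ C0
  h2 : ∀ s ≥ R2, V'' s ≤ V' s ^ 2 / 4
  G1 : ∀ p ∈ Om, R2 ≤ psi β σ p → e1 β σ p + e2 β σ p ≤ V' (psi β σ p) * qq β σ p / 4
  G2 : ∀ p ∈ Om, R2 ≤ psi β σ p → V (psi β σ p) ≤ C0 * (V' (psi β σ p) ^ 2 * qq β σ p)
  G3 : ∀ A : ℝ, ∃ L ≥ R2, ∀ p ∈ Om, L ≤ psi β σ p → A ≤ V' (psi β σ p) ^ 2 * qq β σ p

lemma hyp_of {β σ : ℝ} (hβ : 0 < β) (hσ : 0 < σ)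
    {V V' V'' : ℝ → ℝ}
    (hVnonneg : ∀ s > (0 : ℝ), 0 ≤ V s)
    (hVmono : StrictMonoOn V (Set.Ioi (0 : ℝ)))
    (hV' : ∀ s > (0 : ℝ), HasDerivAt V (V' s) s)
    (hV'' : ∀ s > (0 : ℝ), HasDerivAt V' (V'' s) s)
    (hRBD : ∃ R > (0 : ℝ), ∃ B > (0 : ℝ), ∃ D > (0 : ℝ),
      ∀ s ≥ R, D * s ^ 7 ≤ V' s ∧ B * V s ≤ s * V' s)
    (hV''pos : ∃ R₁ : ℝ, ∀ s ≥ R₁, 0 < V'' s)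
    (hratio : Tendsto (fun s => (V' s) ^ 2 / V'' s) atTop atTop) :
    ∃ R2 C0, Hyp β σ V V' V'' R2 C0 := by
  obtain ⟨R, hR, B, hB, D, hD, hRB⟩ := hRBD
  obtain ⟨R1, hR1⟩ := hV''pos
  obtain ⟨R3, hR3⟩ := eventually_atTop.1 (hratio.eventually_ge_atTop 4)
  obtain ⟨L0, hL0, c, hc, C, hC, hg⟩ := geo hβ hσ
  set R2 := max (max R R1) (max R3 (max L0 (4 * C / D))) with hR2
  have k1 : R ≤ R2 := (le_max_left _ _).trans (le_max_left _ _)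
  have k2 : R1 ≤ R2 := (le_max_right _ _).trans (le_max_left _ _)
  have k3 : R3 ≤ R2 := (le_max_left _ _).trans (le_max_right _ _)
  have k4 : L0 ≤ R2 := (le_max_left _ _).trans ((le_max_right _ _).trans (le_max_right _ _))
  have k5 : 4 * C / D ≤ R2 := (le_max_right _ _).trans ((le_max_right _ _).trans (le_max_right _ _))
  have k6 : 1 ≤ R2 := hL0.trans k4
  have hV'0 : ∀ s > (0:ℝ), 0 ≤ V' s := by
    intro s hs
    have h1 : ∀ᶠ y in nhdsWithin s (Set.Ioi s), 0 ≤ slope V s y := by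
      filter_upwards [self_mem_nhdsWithin] with y hy
      rw [slope_def_field]
      have hy' : s < y := hy
      have := hVmono (Set.mem_Ioi.2 hs) (Set.mem_Ioi.2 (hs.trans hy')) hy'
      apply div_nonneg <;> linarith
    have h2 := (hasDerivAt_iff_tendsto_slope.1 (hV' s hs)).mono_left
      (nhdsWithin_mono s (show Set.Ioi s ⊆ {s}ᶜ from fun y (hy : s < y) => hy.ne'))
    exact ge_of_tendsto h2 h1
  refine ⟨R2, 1 / (B * (D * c)), hβ, hσ, hVnonneg, hV', hV'', hV'0, k6, by positivity, ?_, ?_, ?_, ?_⟩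
  · intro s hs
    have h1 := hR3 s (k3.trans hs)
    have h2 := hR1 s (k2.trans hs)
    rw [le_div_iff₀ h2] at h1
    linarith
  · intro p hp hps
    have h1 := (hg p hp (k4.trans hps)).2
    have h2 := (hRB _ (k1.trans hps)).1
    have hq := qq_nonneg β σ p
    set s := psi β σ p
    have hs1 : 1 ≤ s := k6.trans hps
    have h3 : 4 * C ≤ D * s := by
      have := k5.trans hps
      rw [div_le_iff₀ hD] at this; linarith
    have h4 : 4 * C * s ^ 2 ≤ D * s ^ 7 := by
      have : s ^ 2 ≤ s ^ 6 := pow_le_pow_right₀ hs1 (by norm_num)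
      calc 4 * C * s ^ 2 ≤ (D * s) * s ^ 6 := mul_le_mul h3 this (by positivity) (by positivity)
        _ = _ := by ring
    have h5 := mul_le_mul_of_nonneg_right (h4.trans h2) hq
    linarith
  · intro p hp hps
    have h1 := (hg p hp (k4.trans hps)).1
    have h2 := (hRB _ (k1.trans hps)).1
    have h3 := (hRB _ (k1.trans hps)).2
    have hq := qq_nonneg β σ p
    set s := psi β σ p
    have hs1 : 1 ≤ s := k6.trans hps
    have hv : 0 ≤ V' s := hV'0 s (by linarith)
    have h4 : D * c * s ≤ V' s * qq β σ p := by
      have h6 : s ≤ s ^ 5 := by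
        calc s = s ^ 1 := by ring
          _ ≤ s ^ 5 := pow_le_pow_right₀ hs1 (by norm_num)
      calc D * c * s ≤ D * s ^ 5 * c := by nlinarith [mul_pos hD hc]
        _ ≤ D * s ^ 5 * (s ^ 2 * qq β σ p) := by gcongr
        _ = (D * s ^ 7) * qq β σ p := by ring
        _ ≤ _ := by gcongr
    have h7 : B * (D * c) * V s ≤ V' s ^ 2 * qq β σ p := by
      calc B * (D * c) * V s = (D * c) * (B * V s) := by ring
        _ ≤ (D * c) * (s * V' s) := by gcongr
        _ = (D * c * s) * V' s := by ring
        _ ≤ (V' s * qq β σ p) * V' s := by gcongr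
        _ = _ := by ring
    rw [one_div, inv_mul_eq_div, le_div_iff₀ (by positivity)]
    linarith
  · intro A
    refine ⟨max R2 (A / (D ^ 2 * c)), le_max_left _ _, ?_⟩
    intro p hp hps'
    have hps : R2 ≤ psi β σ p := (le_max_left _ _).trans hps'
    have hA : A / (D ^ 2 * c) ≤ psi β σ p := (le_max_right _ _).trans hps'
    have h1 := (hg p hp (k4.trans hps)).1
    have h2 := (hRB _ (k1.trans hps)).1
    have hq := qq_nonneg β σ p
    set s := psi β σ p
    have hs1 : 1 ≤ s := k6.trans hps
    rw [div_le_iff₀ (by positivity)] at hA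
    have h6 : s ≤ s ^ 12 := by
      calc s = s ^ 1 := by ring
        _ ≤ s ^ 12 := pow_le_pow_right₀ hs1 (by norm_num)
    calc A ≤ s * (D ^ 2 * c) := hA
      _ ≤ s ^ 12 * (D ^ 2 * c) := by gcongr
      _ = D ^ 2 * s ^ 12 * c := by ring
      _ ≤ D ^ 2 * s ^ 12 * (s ^ 2 * qq β σ p) := by gcongr
      _ = (D * s ^ 7) ^ 2 * qq β σ p := by ring
      _ ≤ _ := by gcongr

/-- the weight -/
noncomputable def Wt (β σ : ℝ) (V : ℝ → ℝ) : ℝ × ℝ × ℝ → ℝ :=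
  Om.indicator fun p => Real.exp (-V (psi β σ p))

section
variable {β σ : ℝ} {V V' V'' : ℝ → ℝ} {R2 C0 : ℝ}

lemma Hyp.contV (H : Hyp β σ V V' V'' R2 C0) : ContinuousOn V (Set.Ioi 0) :=
  fun s hs => (H.dV s hs).continuousAt.continuousWithinAt
lemma Hyp.contV' (H : Hyp β σ V V' V'' R2 C0) : ContinuousOn V' (Set.Ioi 0) :=
  fun s hs => (H.dV' s hs).continuousAt.continuousWithinAt
lemma Hyp.maps (H : Hyp β σ V V' V'' R2 C0) : Set.MapsTo (psi β σ) Om (Set.Ioi 0) :=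
  fun _ hp => psi_pos H.hβ hp
lemma Hyp.contVp (H : Hyp β σ V V' V'' R2 C0) : ContinuousOn (fun p => V (psi β σ p)) Om :=
  H.contV.comp (cont_psi β σ) H.maps
lemma Hyp.contVp' (H : Hyp β σ V V' V'' R2 C0) : ContinuousOn (fun p => V' (psi β σ p)) Om :=
  H.contV'.comp (cont_psi β σ) H.maps
lemma Hyp.contW (H : Hyp β σ V V' V'' R2 C0) : ContinuousOn (fun p => Real.exp (-V (psi β σ p))) Om := by
  exact H.contVp.neg.rexp
lemma Hyp.contWt (H : Hyp β σ V V' V'' R2 C0) : ContinuousOn (Wt β σ V) Om :=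
  H.contW.congr fun _ hp => Set.indicator_of_mem hp _
lemma Hyp.measW (H : Hyp β σ V V' V'' R2 C0) : Measurable (Wt β σ V) := meas_ind H.contW
lemma Hyp.Wpos (_H : Hyp β σ V V' V'' R2 C0) : ∀ p ∈ Om, 0 < Wt β σ V p := by
  intro p hp; unfold Wt; rw [Set.indicator_of_mem hp]; positivity
lemma Wt_nonneg (p) : 0 ≤ Wt β σ V p := Set.indicator_nonneg (fun _ _ => by positivity) p
lemma Hyp.Wle (H : Hyp β σ V V' V'' R2 C0) (p) : Wt β σ V p ≤ 1 := by
  refine Set.indicator_le' (f := fun p => Real.exp (-V (psi β σ p))) (g := fun _ => 1) ?_ ?_ p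
  · intro p hp
    rw [Real.exp_le_one_iff]
    linarith [H.V0 _ (psi_pos (σ := σ) H.hβ hp)]
  · intro _ _; exact zero_le_one

end

end HeisLSI

open Real MeasureTheory Filter

namespace HeisLSI
section
variable {β σ : ℝ} {V V' V'' : ℝ → ℝ} {R2 C0 : ℝ}

lemma bd_on (hβ : 0 < β) (hσ : 0 < σ) {g : ℝ × ℝ × ℝ → ℝ} (hg : ContinuousOn g Om) (L : ℝ) :
    ∃ C ≥ (0:ℝ), ∀ p ∈ Om, psi β σ p ≤ L → g p ≤ C := by
  have hK := Ks_compact hβ hσ L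
  have hsub : Ks β σ L ⊆ Om := fun p hp => hp.1
  obtain ⟨C, hC⟩ := hK.exists_bound_of_continuousOn (hg.mono hsub)
  refine ⟨max C 0, le_max_right _ _, fun p hp hps => ?_⟩
  exact (le_abs_self _).trans ((hC p ⟨hp, hps⟩).trans (le_max_left _ _))

lemma st_deriv (s : ℝ) : HasDerivAt Real.smoothTransition (deriv Real.smoothTransition s) s :=
  ((Real.smoothTransition.contDiff (n := 1)).differentiable (by norm_num) s).hasDerivAt

lemma st_deriv_nonneg (s : ℝ) : 0 ≤ deriv Real.smoothTransition s :=
  Real.smoothTransition.monotone.deriv_nonneg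

lemma st_deriv_cont : Continuous (deriv Real.smoothTransition) :=
  (Real.smoothTransition.contDiff (n := 1)).continuous_deriv le_rfl

lemma st_deriv_zero {s : ℝ} (hs : 1 ≤ s) : deriv Real.smoothTransition s = 0 := by
  have h1 : ∀ x ∈ Set.Ioi (1:ℝ), deriv Real.smoothTransition x = 0 := by
    intro x hx
    have : Real.smoothTransition =ᶠ[nhds x] fun _ => 1 := by
      filter_upwards [Ioi_mem_nhds hx] with y hy
      exact Real.smoothTransition.one_of_one_le (le_of_lt hy)
    rw [this.deriv_eq]; simp
  have h2 : Set.EqOn (deriv Real.smoothTransition) (fun _ => 0) (closure (Set.Ioi 1)) :=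
    Set.EqOn.closure h1 st_deriv_cont continuous_const
  rw [closure_Ioi] at h2
  exact h2 hs

lemma Hyp.ubn (H : Hyp β σ V V' V'' R2 C0) : ∃ C1 ≥ (0:ℝ), ∀ f : ℝ × ℝ × ℝ → ℝ, ContDiff ℝ 1 f → ∀ n : ℕ,
    ∫⁻ p, ENNReal.ofReal (Real.smoothTransition (psi β σ p - R2) * (1 - Real.smoothTransition (psi β σ p - n)) *
      (f p ^ 2 * (V' (psi β σ p) ^ 2 * qq β σ p) * Wt β σ V p)) ≤
      16 * En (Wt β σ V) f + ENNReal.ofReal (4 * C1) * ∫⁻ p, ENNReal.ofReal (f p ^ 2 * Wt β σ V p) := by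
  have hcψ := cont_psi β σ
  have hst : Continuous Real.smoothTransition := Real.smoothTransition.continuous
  have hθ'c : ContinuousOn (fun p => deriv Real.smoothTransition (psi β σ p - R2)) Om :=
    st_deriv_cont.comp_continuousOn (hcψ.sub continuousOn_const)
  have hθc : ContinuousOn (fun p => Real.smoothTransition (psi β σ p - R2)) Om :=
    hst.comp_continuousOn (hcψ.sub continuousOn_const)
  have hqc := cont_qq β σ
  obtain ⟨C1, hC1, hC1'⟩ := bd_on H.hβ H.hσ
    ((H.contVp'.mul hθ'c).mul hqc) (R2 + 1)
  refine ⟨C1, hC1, fun f hf n => ?_⟩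
  have hfc : Continuous f := hf.continuous
  have hχc : ContinuousOn (fun p => 1 - Real.smoothTransition (psi β σ p - n)) Om :=
    continuousOn_const.sub (hst.comp_continuousOn (hcψ.sub continuousOn_const))
  set θ : ℝ → ℝ := fun s => Real.smoothTransition (s - R2) with hθ
  set θ' : ℝ → ℝ := fun s => deriv Real.smoothTransition (s - R2) with hθ'
  set χ : ℝ → ℝ := fun s => 1 - Real.smoothTransition (s - n) with hχ
  have hθd : ∀ s, HasDerivAt θ (θ' s) s := fun s => by
    exact ((st_deriv (s - R2)).comp s ((hasDerivAt_id s).sub_const R2)).congr_deriv (mul_one _)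
  have hχd : ∀ s, HasDerivAt χ (- deriv Real.smoothTransition (s - n)) s := fun s => by
    simpa using ((st_deriv (s - n)).comp s ((hasDerivAt_id s).sub_const (n:ℝ))).const_sub 1
  have hθ0 : ∀ s, 0 ≤ θ s := fun s => Real.smoothTransition.nonneg _
  have hθ1 : ∀ s, θ s ≤ 1 := fun s => Real.smoothTransition.le_one _
  have hχ0 : ∀ s, 0 ≤ χ s := fun s => sub_nonneg.2 (Real.smoothTransition.le_one _)
  have hχ1 : ∀ s, χ s ≤ 1 := fun s => sub_le_self _ (Real.smoothTransition.nonneg _)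
  have hθz : ∀ s, s < R2 → θ s = 0 := fun s hs => Real.smoothTransition.zero_of_nonpos (by linarith)
  have hχz : ∀ s ≥ (n:ℝ) + 1, χ s = 0 := fun s hs => by
    simp only [hχ]; rw [Real.smoothTransition.one_of_one_le (by linarith)]; simp
  set k : ℝ → ℝ := fun s => θ s * χ s * V' s * Real.exp (-V s) with hk
  set κ : ℝ → ℝ := fun s => Real.exp (-V s) * χ s * (-(3/4) * V' s ^ 2 * θ s + V' s * θ' s) with hκ
  set k' : ℝ → ℝ := fun s => ((θ' s * χ s + θ s * (- deriv Real.smoothTransition (s - n))) * V' s +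
      θ s * χ s * V'' s) * Real.exp (-V s) + θ s * χ s * V' s * (Real.exp (-V s) * (-V' s)) with hk'
  have hkd : ∀ s > 0, HasDerivAt k (k' s) s := fun s hs =>
    (((hθd s).mul (hχd s)).mul (H.dV' s hs)).mul ((H.dV s hs).neg.exp)
  have hkκ : ∀ s > 0, k' s ≤ κ s := by
    intro s hs
    have e0 := (Real.exp_pos (-V s)).le
    have a1 : 0 ≤ θ s * deriv Real.smoothTransition (s - n) * V' s * Real.exp (-V s) :=
      mul_nonneg (mul_nonneg (mul_nonneg (hθ0 s) (st_deriv_nonneg _)) (H.V'0 s hs)) e0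
    have a2 : θ s * χ s * V'' s * Real.exp (-V s) ≤ θ s * χ s * (V' s ^ 2 / 4) * Real.exp (-V s) := by
      rcases lt_or_ge s R2 with h | h
      · simp [hθz s h]
      · have := H.h2 s h
        have := hθ0 s
        have := hχ0 s
        gcongr
    simp only [hk', hκ]
    linarith
  have hκc : ContinuousOn κ (Set.Ioi 0) := by
    have hθcc : Continuous θ := hst.comp (by fun_prop)
    have hθ'cc : Continuous θ' := st_deriv_cont.comp (by fun_prop)
    have hχcc : Continuous χ := continuous_const.sub (hst.comp (by fun_prop))
    exact (H.contV.neg.rexp.mul hχcc.continuousOn).mul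
      (((continuousOn_const.mul (H.contV'.pow 2)).mul hθcc.continuousOn).add (H.contV'.mul hθ'cc.continuousOn))
  have hk0 : ∀ s ≥ (n:ℝ) + 1, k s = 0 := fun s hs => by simp [hk, hχz s hs]
  have hκ0 : ∀ s ≥ (n:ℝ) + 1, κ s = 0 := fun s hs => by simp [hκ, hχz s hs]
  obtain ⟨i1, j1⟩ := ibp_dir H.hβ H.hσ mp_fl1 continuous_fl1 fl1_zero (fun p s h => psi_fl1 β σ h)
    (cont_d1 β σ) (cont_e1 β σ) (fun p s => deriv_fl1 hf p s) hfc (continuous_X1 hf) ae_fl1 hkd hkκ hκc hk0 hκ0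
  obtain ⟨i2, j2⟩ := ibp_dir H.hβ H.hσ mp_fl2 continuous_fl2 fl2_zero (fun p s h => psi_fl2 β σ h)
    (cont_d2 β σ) (cont_e2 β σ) (fun p s => deriv_fl2 hf p s) hfc (continuous_X2 hf) ae_fl2 hkd hkκ hκc hk0 hκ0
  set A : ℝ × ℝ × ℝ → ℝ := fun p => θ (psi β σ p) * χ (psi β σ p) *
    (f p ^ 2 * (V' (psi β σ p) ^ 2 * qq β σ p) * Real.exp (-V (psi β σ p))) with hA
  set B : ℝ × ℝ × ℝ → ℝ := fun p => χ (psi β σ p) * Real.exp (-V (psi β σ p)) * (4 * θ (psi β σ p) * gsq f p +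
    f p ^ 2 * (V' (psi β σ p) * θ' (psi β σ p) * qq β σ p)) with hB
  have cE := H.contW
  have cA : ContinuousOn A Om := (hθc.mul hχc).mul
    (((hfc.continuousOn.pow 2).mul ((H.contVp'.pow 2).mul hqc)).mul cE)
  have cB : ContinuousOn B Om := (hχc.mul cE).mul
    (((continuousOn_const.mul hθc).mul (continuous_gsq hf).continuousOn).add
      ((hfc.continuousOn.pow 2).mul ((H.contVp'.mul hθ'c).mul hqc)))
  have iA := int_cs H.hβ H.hσ (M := (n:ℝ)+1) cA (fun p _ hp => by simp [hA, hχz _ hp])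
  have iB := int_cs H.hβ H.hσ (M := (n:ℝ)+1) cB (fun p _ hp => by simp [hB, hχz _ hp])
  have A0 : ∀ p, 0 ≤ Om.indicator A p := Set.indicator_nonneg (fun p _ => by
    have := hθ0 (psi β σ p); have := hχ0 (psi β σ p); have := qq_nonneg β σ p
    simp only [hA]; positivity)
  have B0 : ∀ p, 0 ≤ Om.indicator B p := Set.indicator_nonneg (fun p hp => by
    have := hθ0 (psi β σ p); have := hχ0 (psi β σ p); have := qq_nonneg β σ p
    have := gsq_nonneg f p; have := H.V'0 _ (psi_pos (σ := σ) H.hβ hp)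
    have : 0 ≤ θ' (psi β σ p) := st_deriv_nonneg _
    simp only [hB]; positivity)
  have main : ∫ p, Om.indicator A p ≤ 4 * ∫ p, Om.indicator B p := by
    have h1 := add_nonneg j1 j2
    rw [← integral_add i1 i2] at h1
    have h2 := integral_mono (i1.add i2) (iB.sub (iA.div_const 4)) (by
      intro p
      simp only [Pi.add_apply, Pi.sub_apply]
      by_cases hp : p ∈ Om
      · simp only [Set.indicator_of_mem hp]
        simp only [hA, hB, hk, hκ]
        have t0 := hθ0 (psi β σ p)
        have c0 := hχ0 (psi β σ p)
        have e0 := (Real.exp_pos (-V (psi β σ p))).le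
        have v0 := H.V'0 _ (psi_pos (σ := σ) H.hβ hp)
        have g1 : θ (psi β σ p) * (e1 β σ p + e2 β σ p) ≤ θ (psi β σ p) * (V' (psi β σ p) * qq β σ p / 4) := by
          rcases lt_or_ge (psi β σ p) R2 with h | h
          · simp [hθz _ h]
          · exact mul_le_mul_of_nonneg_left (H.G1 p hp h) t0
        generalize θ (psi β σ p) = t at *
        generalize θ' (psi β σ p) = t' at *
        generalize χ (psi β σ p) = c at *
        generalize Real.exp (-V (psi β σ p)) = e at *
        generalize V' (psi β σ p) = v at *
        unfold gsq
        have hq : qq β σ p = d1 β σ p ^ 2 + d2 β σ p ^ 2 := rfl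
        rw [hq] at g1 ⊢
        generalize d1 β σ p = a at *
        generalize d2 β σ p = b at *
        generalize e1 β σ p = x at *
        generalize e2 β σ p = y at *
        generalize f p = F at *
        generalize X1 f p = G1 at *
        generalize X2 f p = G2 at *
        have m0 : 0 ≤ t * c * e := by positivity
        have s1 := mul_le_mul_of_nonneg_left g1 (by positivity : 0 ≤ F ^ 2 * c * e * v)
        have s2 := mul_nonneg m0 (sq_nonneg (2 * G1 - F * v * a / 2))
        have s3 := mul_nonneg m0 (sq_nonneg (2 * G2 - F * v * b / 2))
        linarith
      · simp [Set.indicator_of_notMem hp])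
    have h3 : ∫ p, (Om.indicator B - fun p => Om.indicator A p / 4) p =
        (∫ p, Om.indicator B p) - (∫ p, Om.indicator A p) / 4 := by
      rw [← integral_div, ← integral_sub iB (iA.div_const 4)]; rfl
    have h4 : 0 ≤ (∫ p, Om.indicator B p) - (∫ p, Om.indicator A p) / 4 := h3 ▸ (h1.trans h2)
    linarith
  calc ∫⁻ p, ENNReal.ofReal (Real.smoothTransition (psi β σ p - R2) * (1 - Real.smoothTransition (psi β σ p - n)) *
      (f p ^ 2 * (V' (psi β σ p) ^ 2 * qq β σ p) * Wt β σ V p))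
      = ∫⁻ p, ENNReal.ofReal (Om.indicator A p) := by
        congr 1; ext p
        by_cases hp : p ∈ Om
        · simp [Wt, hp, hA, hθ, hχ]
        · simp [Wt, hp]
    _ = ENNReal.ofReal (∫ p, Om.indicator A p) :=
        (ofReal_integral_eq_lintegral_ofReal iA (ae_of_all _ A0)).symm
    _ ≤ ENNReal.ofReal (4 * ∫ p, Om.indicator B p) := ENNReal.ofReal_le_ofReal main
    _ = 4 * ∫⁻ p, ENNReal.ofReal (Om.indicator B p) := by
        rw [ENNReal.ofReal_mul (by norm_num), ofReal_integral_eq_lintegral_ofReal iB (ae_of_all _ B0)]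
        simp
    _ ≤ 4 * ∫⁻ p, (4 * ENNReal.ofReal (Wt β σ V p * gsq f p) +
          ENNReal.ofReal C1 * ENNReal.ofReal (f p ^ 2 * Wt β σ V p)) := by
        gcongr with p
        rw [← ENNReal.ofReal_mul hC1, show (4:ENNReal) = ENNReal.ofReal 4 by simp, ← ENNReal.ofReal_mul (by norm_num),
          ← ENNReal.ofReal_add (by have := gsq_nonneg f p; have := Wt_nonneg (β := β) (σ := σ) (V := V) p; positivity)
            (by have := Wt_nonneg (β := β) (σ := σ) (V := V) p; positivity)]
        apply ENNReal.ofReal_le_ofReal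
        by_cases hp : p ∈ Om
        · simp only [Wt, Set.indicator_of_mem hp, hB]
          have g0 := gsq_nonneg f p
          have e0 := (Real.exp_pos (-V (psi β σ p))).le
          have q0 := qq_nonneg β σ p
          have v0 := H.V'0 _ (psi_pos (σ := σ) H.hβ hp)
          have t0' : 0 ≤ θ' (psi β σ p) := st_deriv_nonneg _
          have b1 : V' (psi β σ p) * θ' (psi β σ p) * qq β σ p ≤ C1 := by
            rcases le_or_gt (psi β σ p) (R2 + 1) with h | h
            · exact hC1' p hp h
            · simp only [hθ']; rw [st_deriv_zero (by linarith)]; simpa using hC1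
          have b2 : 4 * θ (psi β σ p) * gsq f p ≤ 4 * 1 * gsq f p := by
            gcongr; exact hθ1 _
          calc χ (psi β σ p) * Real.exp (-V (psi β σ p)) * (4 * θ (psi β σ p) * gsq f p +
                f p ^ 2 * (V' (psi β σ p) * θ' (psi β σ p) * qq β σ p))
              ≤ 1 * Real.exp (-V (psi β σ p)) * (4 * 1 * gsq f p + f p ^ 2 * C1) := by
                have := hχ1 (psi β σ p)
                have := hθ0 (psi β σ p)
                have := hχ0 (psi β σ p)
                gcongr
            _ = _ := by ring
        · simp [Wt, hp]
    _ = _ := by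
        have mW := H.measW
        have mg := (continuous_gsq hf).measurable
        have mf := hfc.measurable
        rw [lintegral_add_left (by fun_prop), lintegral_const_mul _ (by fun_prop),
          lintegral_const_mul _ (by fun_prop), mul_add, ← mul_assoc, ← mul_assoc, ENNReal.ofReal_mul (by norm_num)]
        norm_num [En]

lemma Hyp.ub (H : Hyp β σ V V' V'' R2 C0) : ∃ C : NNReal, ∀ f : ℝ × ℝ × ℝ → ℝ, ContDiff ℝ 1 f →
    ∫⁻ p, ENNReal.ofReal (f p ^ 2 * (V' (psi β σ p) ^ 2 * qq β σ p + V (psi β σ p)) * Wt β σ V p) ≤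
      C * (En (Wt β σ V) f + ∫⁻ p, ENNReal.ofReal (f p ^ 2 * Wt β σ V p)) := by
  obtain ⟨C1, hC1, h1⟩ := H.ubn
  obtain ⟨C2, hC2, h2⟩ := bd_on H.hβ H.hσ (((H.contVp'.pow 2).mul (cont_qq β σ)).add H.contVp) (R2 + 1)
  have mT : Measurable (Om.indicator fun p => Real.smoothTransition (psi β σ p - R2) * (V' (psi β σ p) ^ 2 * qq β σ p)) :=
    meas_ind ((Real.smoothTransition.continuous.comp_continuousOn ((cont_psi β σ).sub continuousOn_const)).mul
      ((H.contVp'.pow 2).mul (cont_qq β σ)))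
  have mW := H.measW
  set C : NNReal := ((1 + C0) * 16 + (1 + C0) * (4 * C1) + C2).toNNReal with hC
  refine ⟨C, fun f hf => ?_⟩
  have mf := hf.continuous.measurable
  set I := ∫⁻ p, ENNReal.ofReal (f p ^ 2 * Wt β σ V p) with hI
  have hT : ∫⁻ p, ENNReal.ofReal (f p ^ 2 * Wt β σ V p * Om.indicator (fun p => Real.smoothTransition (psi β σ p - R2) * (V' (psi β σ p) ^ 2 * qq β σ p)) p)
      ≤ 16 * En (Wt β σ V) f + ENNReal.ofReal (4 * C1) * I := by
    set u : ℕ → ℝ × ℝ × ℝ → ENNReal := fun n p => ENNReal.ofReal (f p ^ 2 * Wt β σ V p * Om.indicator (fun p => Real.smoothTransition (psi β σ p - R2) * (1 - Real.smoothTransition (psi β σ p - n)) * (V' (psi β σ p) ^ 2 * qq β σ p)) p) with hu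
    have hum : ∀ n, Measurable (u n) := by
      intro n
      have : Measurable (Om.indicator (fun p => Real.smoothTransition (psi β σ p - R2) * (1 - Real.smoothTransition (psi β σ p - n)) * (V' (psi β σ p) ^ 2 * qq β σ p))) :=
        meas_ind (((Real.smoothTransition.continuous.comp_continuousOn ((cont_psi β σ).sub continuousOn_const)).mul
          (continuousOn_const.sub (Real.smoothTransition.continuous.comp_continuousOn ((cont_psi β σ).sub continuousOn_const)))).mul
          ((H.contVp'.pow 2).mul (cont_qq β σ)))
      simp only [hu]
      fun_prop
    have hule : ∀ n, ∫⁻ p, u n p ≤ 16 * En (Wt β σ V) f + ENNReal.ofReal (4 * C1) * I := by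
      intro n
      refine le_trans (le_of_eq ?_) (h1 f hf n)
      congr 1; ext p
      simp only [hu]
      congr 1
      by_cases hp : p ∈ Om
      · simp [Wt, hp]; ring
      · simp [Wt, hp]
    calc _ = ∫⁻ p, liminf (fun n => u n p) atTop := by
          congr 1; ext p
          refine (Tendsto.liminf_eq ?_).symm
          refine tendsto_const_nhds.congr' ?_
          filter_upwards [eventually_ge_atTop ⌈psi β σ p⌉₊] with n hn
          have : psi β σ p ≤ n := Nat.ceil_le.1 hn
          simp only [hu]
          congr 2
          by_cases hp : p ∈ Om
          · simp only [Set.indicator_of_mem hp]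
            rw [Real.smoothTransition.zero_of_nonpos (x := psi β σ p - n) (by linarith)]; ring
          · simp [hp]
      _ ≤ liminf (fun n => ∫⁻ p, u n p) atTop := lintegral_liminf_le hum
      _ ≤ liminf (fun _ : ℕ => 16 * En (Wt β σ V) f + ENNReal.ofReal (4 * C1) * I) atTop :=
          liminf_le_liminf (Eventually.of_forall hule)
      _ = _ := liminf_const _
  calc _ ≤ ∫⁻ p, (ENNReal.ofReal (1 + C0) * ENNReal.ofReal (f p ^ 2 * Wt β σ V p * Om.indicator (fun p => Real.smoothTransition (psi β σ p - R2) * (V' (psi β σ p) ^ 2 * qq β σ p)) p)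
        + ENNReal.ofReal C2 * ENNReal.ofReal (f p ^ 2 * Wt β σ V p)) := by
        gcongr with p
        have w0 := Wt_nonneg (β := β) (σ := σ) (V := V) p
        have c0 := H.C0pos
        have q0 := qq_nonneg β σ p
        have i0 : 0 ≤ Om.indicator (fun p => Real.smoothTransition (psi β σ p - R2) * (V' (psi β σ p) ^ 2 * qq β σ p)) p :=
          Set.indicator_nonneg (fun p _ => by
            have := Real.smoothTransition.nonneg (psi β σ p - R2)
            have := qq_nonneg β σ p
            positivity) p
        rw [← ENNReal.ofReal_mul (by positivity), ← ENNReal.ofReal_mul (by positivity),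
          ← ENNReal.ofReal_add (by positivity) (by positivity)]
        apply ENNReal.ofReal_le_ofReal
        by_cases hp : p ∈ Om
        · simp only [Set.indicator_of_mem hp] at i0 ⊢
          have key : V' (psi β σ p) ^ 2 * qq β σ p + V (psi β σ p) ≤ (1 + C0) * (Real.smoothTransition (psi β σ p - R2) * (V' (psi β σ p) ^ 2 * qq β σ p)) + C2 := by
            rcases le_or_gt (psi β σ p) (R2 + 1) with h | h
            · have h3 : V' (psi β σ p) ^ 2 * qq β σ p + V (psi β σ p) ≤ C2 := h2 p hp h
              have : 0 ≤ (1 + C0) * (Real.smoothTransition (psi β σ p - R2) * (V' (psi β σ p) ^ 2 * qq β σ p)) := by positivity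
              linarith
            · rw [Real.smoothTransition.one_of_one_le (by linarith)]
              have := H.G2 p hp (by linarith)
              linarith
          have := mul_le_mul_of_nonneg_left key (by positivity : 0 ≤ f p ^ 2 * Wt β σ V p)
          linarith
        · simp [Wt, hp]
    _ = ENNReal.ofReal (1 + C0) * (∫⁻ p, ENNReal.ofReal (f p ^ 2 * Wt β σ V p * Om.indicator (fun p => Real.smoothTransition (psi β σ p - R2) * (V' (psi β σ p) ^ 2 * qq β σ p)) p)) + ENNReal.ofReal C2 * I := by
        rw [lintegral_add_left (by fun_prop), lintegral_const_mul _ (by fun_prop),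
          lintegral_const_mul _ (by fun_prop)]
    _ ≤ ENNReal.ofReal (1 + C0) * (16 * En (Wt β σ V) f + ENNReal.ofReal (4 * C1) * I) + ENNReal.ofReal C2 * I := by
        gcongr
    _ ≤ C * En (Wt β σ V) f + C * I := by
        have hCe : (C : ENNReal) = ENNReal.ofReal (1 + C0) * 16 + ENNReal.ofReal (1 + C0) * ENNReal.ofReal (4 * C1) + ENNReal.ofReal C2 := by
          have c0 := H.C0pos
          rw [show (16 : ENNReal) = ENNReal.ofReal 16 by simp, ← ENNReal.ofReal_mul (by positivity), ← ENNReal.ofReal_mul (by positivity),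
            ← ENNReal.ofReal_add (by positivity) (by positivity), ← ENNReal.ofReal_add (by positivity) (by positivity)]
          rfl
        have b1 : ENNReal.ofReal (1 + C0) * 16 ≤ C := by rw [hCe, add_assoc]; exact le_self_add
        have b2 : ENNReal.ofReal (1 + C0) * ENNReal.ofReal (4 * C1) + ENNReal.ofReal C2 ≤ C := by
          rw [hCe, add_assoc]; exact le_add_self
        calc _ = (ENNReal.ofReal (1 + C0) * 16) * En (Wt β σ V) f + (ENNReal.ofReal (1 + C0) * ENNReal.ofReal (4 * C1) + ENNReal.ofReal C2) * I := by ring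
          _ ≤ _ := by gcongr
    _ = _ := by ring

end
end HeisLSI

open Real MeasureTheory Filter

namespace HeisLSI
section
variable {β σ : ℝ} {V V' V'' : ℝ → ℝ} {R2 C0 : ℝ}

lemma Hyp.stepG (H : Hyp β σ V V' V'' R2 C0) {g : ℝ × ℝ × ℝ → ℝ} (hg : Continuous g) (c : ℝ)
    {Φ : ℝ → (ℝ × ℝ × ℝ) → (ℝ × ℝ × ℝ)}
    (hΦ : Continuous (fun q : ℝ × (ℝ × ℝ × ℝ) => Φ q.1 q.2)) (h0 : ∀ p, Φ 0 p = p)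
    {d Xg : ℝ × ℝ × ℝ → ℝ} {p : ℝ × ℝ × ℝ} (hp : ∀ s, Φ s p ∈ Om)
    (hψ : ∀ s, Φ s p ∈ Om → HasDerivAt (fun s => psi β σ (Φ s p)) (d (Φ s p)) s)
    (hd : ContinuousOn d Om) (hXc : Continuous Xg)
    (hX : ∀ s, HasDerivAt (fun s => g (Φ s p)) (Xg (Φ s p)) s)
    (hdq : ∀ p, d p ^ 2 ≤ qq β σ p) (hXq : ∀ p, Xg p ^ 2 ≤ gsq g p) {a : ℝ} (ha : 0 ≤ a) :
    Step Φ (Om.indicator fun p => g p * Real.exp (-V (psi β σ p) / 2) * c)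
      (fun p => ENNReal.ofReal (Om.indicator (fun p => (2 * gsq g p + g p ^ 2 * (V' (psi β σ p) ^ 2 * qq β σ p)) *
        Real.exp (-V (psi β σ p)) * c ^ 2) p)) a p := by
  have hc : Continuous (fun s => Φ s p) := hΦ.comp (by fun_prop : Continuous fun s : ℝ => (s, p))
  refine step1 (d := fun p => (Xg p * Real.exp (-V (psi β σ p) / 2) +
    g p * (Real.exp (-V (psi β σ p) / 2) * (-(V' (psi β σ p) * d p) / 2))) * c) ha (h0 p) ?_ ?_ ?_
  · intro s _
    have e : (fun s => (Om.indicator fun p => g p * Real.exp (-V (psi β σ p) / 2) * c) (Φ s p)) =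
      fun s => g (Φ s p) * Real.exp (-V (psi β σ (Φ s p)) / 2) * c := by
      funext s; rw [Set.indicator_of_mem (hp s)]
    rw [e]
    have a1 := (H.dV _ (psi_pos (σ := σ) H.hβ (hp s))).comp s (hψ s (hp s))
    exact ((hX s).mul (a1.neg.div_const 2).exp).mul_const c
  · refine Continuous.continuousOn ?_
    rw [← continuousOn_univ]
    refine ContinuousOn.comp (t := Om) (f := fun s => Φ s p) (g := fun p => (Xg p * Real.exp (-V (psi β σ p) / 2) +
      g p * (Real.exp (-V (psi β σ p) / 2) * (-(V' (psi β σ p) * d p) / 2))) * c) ?_ hc.continuousOn (fun s _ => hp s)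
    have c1 : ContinuousOn (fun p => Real.exp (-V (psi β σ p) / 2)) Om := (H.contVp.neg.div_const 2).rexp
    exact ((hXc.continuousOn.mul c1).add (hg.continuousOn.mul
      (c1.mul ((H.contVp'.mul hd).neg.div_const 2)))).mul continuousOn_const
  · intro s _
    simp only [Set.indicator_of_mem (hp s)]
    apply ENNReal.ofReal_le_ofReal
    generalize Φ s p = y
    have h1 := hdq y
    have h2 := hXq y
    have h3 : Real.exp (-V (psi β σ y)) = Real.exp (-V (psi β σ y) / 2) ^ 2 := by
      rw [← Real.exp_nat_mul]; congr 1; push_cast; ring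
    rw [h3]
    have q0 := qq_nonneg β σ y
    generalize Real.exp (-V (psi β σ y) / 2) = e at *
    generalize V' (psi β σ y) = v at *
    generalize d y = d at *
    generalize Xg y = X at *
    generalize g y = F at *
    generalize gsq g y = Q at *
    generalize qq β σ y = q at *
    have k1 := mul_le_mul_of_nonneg_left h2 (by positivity : 0 ≤ 2 * e ^ 2 * c ^ 2)
    have k2 := mul_le_mul_of_nonneg_left h1 (by positivity : 0 ≤ F ^ 2 * v ^ 2 * e ^ 2 * c ^ 2)
    have k3 := mul_nonneg (by positivity : 0 ≤ e ^ 2 * c ^ 2) (sq_nonneg (X + F * v * d / 2))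
    have k4 := mul_nonneg (by positivity : 0 ≤ F ^ 2 * v ^ 2 * e ^ 2 * c ^ 2) (sq_nonneg d)
    linarith

lemma Hyp.dlsi (H : Hyp β σ V V' V'' R2 C0) : ∃ C : NNReal, ∀ g : ℝ × ℝ × ℝ → ℝ, ContDiff ℝ 1 g → ∀ w > (0:ℝ),
    ∫⁻ p, ENNReal.ofReal (g p ^ 2 * Wt β σ V p) ≤ ENNReal.ofReal w →
    ∫⁻ p, ENNReal.ofReal (g p ^ 2 * log⁺ (g p ^ 2 / w) * Wt β σ V p) ≤
      C * (En (Wt β σ V) g + ∫⁻ p, ENNReal.ofReal (g p ^ 2 * Wt β σ V p)) := by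
  obtain ⟨C, hC⟩ := H.ub
  set N : NNReal := (Real.log 4 * 288).toNNReal with hN
  refine ⟨N * (2 + C) + C, fun g hg w hw hgw => ?_⟩
  have hgc := hg.continuous
  have mg := hgc.measurable
  have mW := H.measW
  set c := (Real.sqrt w)⁻¹ with hc
  have hc2 : c ^ 2 = w⁻¹ := by rw [hc, inv_pow, Real.sq_sqrt hw.le]
  set G := Om.indicator fun p => g p * Real.exp (-V (psi β σ p) / 2) * c with hG
  set Dr : ℝ × ℝ × ℝ → ℝ := Om.indicator (fun p => (2 * gsq g p + g p ^ 2 * (V' (psi β σ p) ^ 2 * qq β σ p)) *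
        Real.exp (-V (psi β σ p)) * c ^ 2) with hDr
  have mG : Measurable G := meas_ind ((hgc.continuousOn.mul (H.contVp.neg.div_const 2).rexp).mul continuousOn_const)
  have mD : Measurable Dr := meas_ind ((((continuousOn_const.mul (continuous_gsq hg).continuousOn).add
    ((hgc.continuousOn.pow 2).mul ((H.contVp'.pow 2).mul (cont_qq β σ)))).mul H.contW).mul continuousOn_const)
  have hG2 : ∀ p, w * G p ^ 2 = g p ^ 2 * Wt β σ V p := by
    intro p
    by_cases hp : p ∈ Om
    · simp only [hG, Wt, Set.indicator_of_mem hp]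
      have h3 : Real.exp (-V (psi β σ p)) = Real.exp (-V (psi β σ p) / 2) ^ 2 := by
        rw [← Real.exp_nat_mul]; congr 1; push_cast; ring
      rw [h3, mul_pow, mul_pow, hc2]; field_simp
    · simp [hG, Wt, hp]
  have h1 : ∫⁻ p, ENNReal.ofReal (G p ^ 2) ≤ 1 := by
    have : ENNReal.ofReal w * ∫⁻ p, ENNReal.ofReal (G p ^ 2) ≤ ENNReal.ofReal w * 1 := by
      rw [← lintegral_const_mul _ (by fun_prop), mul_one]
      refine le_trans (le_of_eq ?_) hgw
      congr 1; ext p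
      rw [← ENNReal.ofReal_mul hw.le, hG2]
    exact (ENNReal.mul_le_mul_iff_right (by simpa using hw) ENNReal.ofReal_ne_top).1 this
  have hd1 : ∀ p, d1 β σ p ^ 2 ≤ qq β σ p := fun p => le_add_of_nonneg_right (sq_nonneg _)
  have hd2 : ∀ p, d2 β σ p ^ 2 ≤ qq β σ p := fun p => le_add_of_nonneg_left (sq_nonneg _)
  have hX1 : ∀ p, X1 g p ^ 2 ≤ gsq g p := fun p => le_add_of_nonneg_right (sq_nonneg _)
  have hX2 : ∀ p, X2 g p ^ 2 ≤ gsq g p := fun p => le_add_of_nonneg_left (sq_nonneg _)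
  have hI := nash_log mG h1 (I := ∫⁻ p, ENNReal.ofReal (Dr p)) (by
    intro a b e ha hb he
    have := path_bound (f := G) (D := fun p => ENNReal.ofReal (Dr p)) (by fun_prop) ha hb he MeasurableSet.univ (by
      filter_upwards [ae_fl1, (mp_fl1 a).quasiMeasurePreserving.ae ae_fl2,
        ((mp_fl2 b).comp (mp_fl1 a)).quasiMeasurePreserving.ae ae_fl1] with p p1 p2 p3 _
      refine ⟨?_, ?_, ?_⟩
      · exact H.stepG hgc c continuous_fl1 fl1_zero p1 (fun s h => (psi_fl1 β σ h).1) (cont_d1 β σ)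
          (continuous_X1 hg) (fun s => deriv_fl1 hg _ s) hd1 hX1 ha
      · exact H.stepG hgc c continuous_fl2 fl2_zero p2 (fun s h => (psi_fl2 β σ h).1) (cont_d2 β σ)
          (continuous_X2 hg) (fun s => deriv_fl2 hg _ s) hd2 hX2 hb
      · exact H.stepG hgc c continuous_fl1 fl1_zero p3 (fun s h => (psi_fl1 β σ h).1) (cont_d1 β σ)
          (continuous_X1 hg) (fun s => deriv_fl1 hg _ s) hd1 hX1 he)
    simpa using this)
  set I := ∫⁻ p, ENNReal.ofReal (g p ^ 2 * Wt β σ V p) with hIdef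
  have mH : Measurable (fun p => g p ^ 2 * (V' (psi β σ p) ^ 2 * qq β σ p + V (psi β σ p)) * Wt β σ V p) := by
    have : (fun p => g p ^ 2 * (V' (psi β σ p) ^ 2 * qq β σ p + V (psi β σ p)) * Wt β σ V p) =
      fun p => g p ^ 2 * Wt β σ V p * Om.indicator (fun p => V' (psi β σ p) ^ 2 * qq β σ p + V (psi β σ p)) p := by
      ext p
      by_cases hp : p ∈ Om
      · simp [hp]; ring
      · simp [Wt, hp]
    rw [this]
    have := meas_ind (((H.contVp'.pow 2).mul (cont_qq β σ)).add H.contVp)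
    exact ((mg.pow_const 2).mul mW).mul this
  have hDI : ENNReal.ofReal w * ∫⁻ p, ENNReal.ofReal (Dr p) ≤ 2 * En (Wt β σ V) g + C * (En (Wt β σ V) g + I) := by
    rw [← lintegral_const_mul _ (by fun_prop)]
    calc _ ≤ ∫⁻ p, (2 * ENNReal.ofReal (Wt β σ V p * gsq g p) +
          ENNReal.ofReal (g p ^ 2 * (V' (psi β σ p) ^ 2 * qq β σ p + V (psi β σ p)) * Wt β σ V p)) := by
          gcongr with p
          by_cases hp : p ∈ Om
          · have v0 := H.V0 _ (psi_pos (σ := σ) H.hβ hp)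
            have w0 := Wt_nonneg (β := β) (σ := σ) (V := V) p
            have q0 := qq_nonneg β σ p
            have g0 := gsq_nonneg g p
            rw [show (2:ENNReal) = ENNReal.ofReal 2 by simp, ← ENNReal.ofReal_mul hw.le,
              ← ENNReal.ofReal_mul (by norm_num), ← ENNReal.ofReal_add (by positivity) (by positivity)]
            apply ENNReal.ofReal_le_ofReal
            simp only [hDr, Set.indicator_of_mem hp, hc2]
            have : Wt β σ V p = Real.exp (-V (psi β σ p)) := Set.indicator_of_mem hp _
            rw [← this]
            have e1 : w * ((2 * gsq g p + g p ^ 2 * (V' (psi β σ p) ^ 2 * qq β σ p)) * Wt β σ V p * w⁻¹) =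
              (2 * gsq g p + g p ^ 2 * (V' (psi β σ p) ^ 2 * qq β σ p)) * Wt β σ V p := by field_simp
            rw [e1]
            have : 0 ≤ g p ^ 2 * V (psi β σ p) * Wt β σ V p := by positivity
            linarith
          · simp [hDr, hp]
      _ = 2 * En (Wt β σ V) g + ∫⁻ p, ENNReal.ofReal (g p ^ 2 * (V' (psi β σ p) ^ 2 * qq β σ p + V (psi β σ p)) * Wt β σ V p) := by
          rw [lintegral_add_right _ (by fun_prop), lintegral_const_mul _ (by
            have := (continuous_gsq hg).measurable
            fun_prop)]
          rfl
      _ ≤ _ := by gcongr; exact hC g hg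
  have hNe : ENNReal.ofReal (Real.log 4 * 288) = N := rfl
  calc ∫⁻ p, ENNReal.ofReal (g p ^ 2 * log⁺ (g p ^ 2 / w) * Wt β σ V p)
      ≤ ∫⁻ p, (ENNReal.ofReal w * ENNReal.ofReal (G p ^ 2 * log⁺ (G p ^ 2)) +
          ENNReal.ofReal (g p ^ 2 * (V' (psi β σ p) ^ 2 * qq β σ p + V (psi β σ p)) * Wt β σ V p)) := by
        gcongr with p
        by_cases hp : p ∈ Om
        · have v0 := H.V0 _ (psi_pos (σ := σ) H.hβ hp)
          have w0 := Wt_nonneg (β := β) (σ := σ) (V := V) p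
          have q0 := qq_nonneg β σ p
          have l0 : 0 ≤ log⁺ (G p ^ 2) := Real.posLog_nonneg
          rw [← ENNReal.ofReal_mul hw.le, ← ENNReal.ofReal_add (by positivity) (by positivity)]
          apply ENNReal.ofReal_le_ofReal
          have hW : Wt β σ V p = Real.exp (-V (psi β σ p)) := Set.indicator_of_mem hp _
          have e1 : g p ^ 2 / w = G p ^ 2 * Real.exp (V (psi β σ p)) := by
            rw [div_eq_iff hw.ne', show G p ^ 2 * Real.exp (V (psi β σ p)) * w = (w * G p ^ 2) * Real.exp (V (psi β σ p)) by ring,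
              hG2, hW, mul_assoc, ← Real.exp_add]; simp
          have e2 : log⁺ (g p ^ 2 / w) ≤ log⁺ (G p ^ 2) + V (psi β σ p) := by
            rw [e1]
            refine Real.posLog_mul.trans ?_
            rw [Real.posLog_eq_log (x := Real.exp (V (psi β σ p))) (by rw [abs_of_pos (Real.exp_pos _)]; exact Real.one_le_exp v0), Real.log_exp]
          have e3 := mul_le_mul_of_nonneg_left e2 (by positivity : 0 ≤ g p ^ 2 * Wt β σ V p)
          have e4 : 0 ≤ g p ^ 2 * (V' (psi β σ p) ^ 2 * qq β σ p) * Wt β σ V p := by positivity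
          have e5 : w * (G p ^ 2 * log⁺ (G p ^ 2)) = g p ^ 2 * Wt β σ V p * log⁺ (G p ^ 2) := by
            rw [← hG2]; ring
          linarith
        · simp [Wt, hp]
    _ = ENNReal.ofReal w * (∫⁻ p, ENNReal.ofReal (G p ^ 2 * log⁺ (G p ^ 2))) +
          ∫⁻ p, ENNReal.ofReal (g p ^ 2 * (V' (psi β σ p) ^ 2 * qq β σ p + V (psi β σ p)) * Wt β σ V p) := by
        have ml : Measurable (fun p => ENNReal.ofReal (G p ^ 2 * log⁺ (G p ^ 2))) :=
          ((mG.pow_const 2).mul (Real.continuous_posLog.measurable.comp (mG.pow_const 2))).ennreal_ofReal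
        rw [lintegral_add_right _ (by fun_prop), lintegral_const_mul _ ml]
    _ ≤ ENNReal.ofReal w * (N * ∫⁻ p, ENNReal.ofReal (Dr p)) + C * (En (Wt β σ V) g + I) := by
        gcongr
        · exact hI
        · exact hC g hg
    _ = N * (ENNReal.ofReal w * ∫⁻ p, ENNReal.ofReal (Dr p)) + C * (En (Wt β σ V) g + I) := by ring
    _ ≤ N * (2 * En (Wt β σ V) g + C * (En (Wt β σ V) g + I)) + C * (En (Wt β σ V) g + I) := by gcongr
    _ ≤ N * (2 * (En (Wt β σ V) g + I) + C * (En (Wt β σ V) g + I)) + C * (En (Wt β σ V) g + I) := by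
        gcongr; exact le_self_add
    _ = _ := by push_cast; ring

end
end HeisLSI

open Real MeasureTheory Filter

namespace HeisLSI
section
variable {β σ : ℝ} {V V' V'' : ℝ → ℝ} {R2 C0 : ℝ}

lemma gsq_sub_const (f : ℝ × ℝ × ℝ → ℝ) (c : ℝ) (p) : gsq (fun p => f p - c) p = gsq f p := by
  unfold gsq X1 X2
  rw [fderiv_sub_const]

lemma En_sub_const (W f : ℝ × ℝ × ℝ → ℝ) (c : ℝ) : En W (fun p => f p - c) = En W f := by
  unfold En; simp only [gsq_sub_const]

lemma Ks_pos (hβ : 0 < β) (L0 : ℝ) : ∃ L ≥ L0, volume (Ks β σ L) ≠ 0 := by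
  refine ⟨max L0 (psi β σ (1, 0, 0) + 1), le_max_left _ _, ?_⟩
  have ho : IsOpen (Om ∩ psi β σ ⁻¹' Set.Iio (psi β σ (1, 0, 0) + 1)) :=
    (cont_psi β σ).isOpen_inter_preimage Om_open isOpen_Iio
  have hne : (Om ∩ psi β σ ⁻¹' Set.Iio (psi β σ (1, 0, 0) + 1)).Nonempty :=
    ⟨(1, 0, 0), by simp [Om], by simp⟩
  have h1 := ho.measure_pos volume hne
  refine (h1.trans_le (measure_mono ?_)).ne'
  rintro p ⟨hp, hp2⟩
  exact ⟨hp, (le_of_lt hp2).trans (le_max_right _ _)⟩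

lemma Hyp.poinc (H : Hyp β σ V V' V'' R2 C0) (hWi : ∫⁻ p, ENNReal.ofReal (Wt β σ V p) ≠ ⊤) :
    ∃ C : NNReal, ∀ f : ℝ × ℝ × ℝ → ℝ, ContDiff ℝ 1 f → ∀ B : ℝ, (∀ p, |f p| ≤ B) → ∀ x : ENNReal,
      (∀ c : ℝ, x ≤ ∫⁻ p, ENNReal.ofReal ((f p - c) ^ 2 * Wt β σ V p)) → x ≤ C * En (Wt β σ V) f := by
  obtain ⟨C, hC⟩ := H.ub
  obtain ⟨L1, hL1, hL1'⟩ := H.G3 (2 * (C + 1))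
  obtain ⟨L, hL, hvol⟩ := Ks_pos (σ := σ) H.hβ L1
  set K := Ks β σ L with hK
  have hKc : IsCompact K := Ks_compact H.hβ H.hσ L
  have hKO : K ⊆ Om := fun p hp => hp.1
  obtain ⟨C', hC'⟩ := compact_gp H.Wpos H.contWt hKc hKO
  have hfin : volume K ≠ ⊤ := hKc.measure_ne_top
  have mW := H.measW
  set S : ENNReal := (volume K)⁻¹ * (volume K + 2 * C') with hS
  have hSf : S ≠ ⊤ := ENNReal.mul_ne_top (by simpa using hvol) (by finiteness)
  refine ⟨S.toNNReal, fun f hf B hB x hx => ?_⟩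
  rw [ENNReal.coe_toNNReal hSf]
  set E := En (Wt β σ V) f with hE
  have key : ∀ c : ℝ, x ≤ E + 2 * ∫⁻ p in K, ENNReal.ofReal ((f p - c) ^ 2) := by
    intro c
    have hh : ContDiff ℝ 1 (fun p => f p - c) := hf.sub contDiff_const
    have mh := hh.continuous.measurable
    have h1 := hC _ hh
    rw [En_sub_const] at h1
    set A := ∫⁻ p, ENNReal.ofReal ((f p - c) ^ 2 * Wt β σ V p) with hA
    have hAf : A ≠ ⊤ := by
      have : A ≤ ENNReal.ofReal ((B + |c|) ^ 2) * ∫⁻ p, ENNReal.ofReal (Wt β σ V p) := by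
        rw [← lintegral_const_mul _ (by fun_prop)]
        refine lintegral_mono fun p => ?_
        rw [← ENNReal.ofReal_mul (by positivity)]
        have w0 := Wt_nonneg (β := β) (σ := σ) (V := V) p
        gcongr ENNReal.ofReal (?_ * _)
        rw [← sq_abs (f p - c)]
        gcongr
        exact (abs_sub _ _).trans (by gcongr; exact hB p)
      exact ne_top_of_le_ne_top (ENNReal.mul_ne_top ENNReal.ofReal_ne_top hWi) this
    refine (hx c).trans ?_
    change A ≤ _
    set AK := ∫⁻ p in K, ENNReal.ofReal ((f p - c) ^ 2) with hAK
    by_cases hAKf : AK = ⊤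
    · rw [hAKf]; simp
    by_cases hEf : E = ⊤
    · rw [hEf]; simp
    -- 2(C+1) A ≤ LHS + 2(C+1) AK
    have h2 : ENNReal.ofReal (2 * (C + 1)) * A ≤ C * (E + A) + ENNReal.ofReal (2 * (C + 1)) * AK := by
      rw [hA, hAK, ← lintegral_indicator hKc.measurableSet, ← lintegral_const_mul _ (by fun_prop),
        ← lintegral_const_mul _ ((by fun_prop : Measurable fun p => ENNReal.ofReal ((f p - c) ^ 2)).indicator hKc.measurableSet)]
      refine le_trans ?_ (add_le_add_left h1 _)
      rw [← lintegral_add_right _ (((by fun_prop : Measurable fun p => ENNReal.ofReal ((f p - c) ^ 2)).indicator hKc.measurableSet).const_mul _)]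
      refine lintegral_mono fun p => ?_
      have w0 := Wt_nonneg (β := β) (σ := σ) (V := V) p
      have w1 := H.Wle p
      by_cases hp : p ∈ K
      · rw [Set.indicator_of_mem hp]
        refine le_trans ?_ le_add_self
        gcongr
        exact mul_le_of_le_one_right (sq_nonneg _) w1
      · rw [Set.indicator_of_notMem hp, mul_zero, add_zero]
        by_cases hpO : p ∈ Om
        · rw [← ENNReal.ofReal_mul (by positivity)]
          apply ENNReal.ofReal_le_ofReal
          have hps : L < psi β σ p := by
            by_contra hlt
            exact hp ⟨hpO, not_lt.1 hlt⟩
          have k1 := hL1' p hpO (hL.le.trans hps.le)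
          have v0 := H.V0 _ (psi_pos (σ := σ) H.hβ hpO)
          have k2 : 2 * ((C:ℝ) + 1) ≤ V' (psi β σ p) ^ 2 * qq β σ p + V (psi β σ p) := by linarith
          have := mul_le_mul_of_nonneg_left k2 (by positivity : 0 ≤ (f p - c) ^ 2 * Wt β σ V p)
          linarith
        · simp [Wt, hpO]
    have hAf' := hAf
    have hEf' := hEf
    clear_value A E AK
    lift A to NNReal using hAf
    lift E to NNReal using hEf
    lift AK to NNReal using hAKf
    have e1 : ENNReal.ofReal (2 * ((C:ℝ) + 1)) = ((2 * (C + 1) : NNReal) : ENNReal) := by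
      rw [← ENNReal.ofReal_coe_nnreal]; push_cast; rfl
    rw [e1] at h2
    norm_cast at h2 ⊢
    have h3 : (2 * ((C:ℝ) + 1)) * A ≤ C * (E + A) + 2 * (C + 1) * AK := by exact_mod_cast h2
    have h4 : (A:ℝ) ≤ E + 2 * AK := by
      have c0 : (0:ℝ) ≤ C := C.2
      have a0 : (0:ℝ) ≤ A := A.2
      have e0 : (0:ℝ) ≤ E := E.2
      have k0 : (0:ℝ) ≤ AK := AK.2
      by_contra hlt
      push Not at hlt
      have := mul_lt_mul_of_pos_left hlt (by linarith : (0:ℝ) < C + 1)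
      nlinarith
    exact_mod_cast h4
  have hvx : volume K * x ≤ (volume K + 2 * C') * E := by
    calc volume K * x = ∫⁻ q in K, x := by rw [setLIntegral_const, mul_comm]
      _ ≤ ∫⁻ q in K, (E + 2 * ∫⁻ p in K, ENNReal.ofReal ((f q - f p) ^ 2)) := by
          refine lintegral_mono fun q => ?_
          refine (key (f q)).trans (le_of_eq ?_)
          congr 3; ext p; rw [← neg_sub, neg_sq]
      _ = E * volume K + 2 * dd f K K := by
          rw [lintegral_add_left measurable_const, setLIntegral_const, lintegral_const_mul' _ _ (by simp)]
          rfl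
      _ ≤ E * volume K + 2 * (C' * E) := by gcongr; exact hC' f hf
      _ = _ := by ring
  calc x = (volume K)⁻¹ * (volume K * x) := by rw [← mul_assoc, ENNReal.inv_mul_cancel hvol hfin, one_mul]
    _ ≤ (volume K)⁻¹ * ((volume K + 2 * C') * E) := by gcongr
    _ = S * E := by rw [hS, mul_assoc]

end
end HeisLSI

open Real MeasureTheory Filter

namespace HeisLSI

lemma ptw (a m v T : ℝ) (hv : 0 < v) (hT : T = m ^ 2 + v) :
    a ^ 2 * Real.log (a ^ 2 / T) - a ^ 2 + T ≤ 68 * (a - m) ^ 2 + 2 * v + 3 * ((a - m) ^ 2 * log⁺ ((a - m) ^ 2 / v)) := by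
  have hTp : 0 < T := by rw [hT]; positivity
  have hvT : v ≤ T := by rw [hT]; nlinarith [sq_nonneg m]
  have hmT : m ^ 2 ≤ T := by rw [hT]; linarith
  have l0 : 0 ≤ log⁺ ((a - m) ^ 2 / v) := Real.posLog_nonneg
  rcases le_or_gt (a ^ 2) (16 * T) with h | h
  · have h1 : a ^ 2 * Real.log (a ^ 2 / T) - a ^ 2 + T ≤ (a ^ 2 - T) ^ 2 / T := by
      rcases eq_or_ne a 0 with ha | ha
      · subst ha
        have : T = (0 ^ 2 - T) ^ 2 / T := by field_simp; ring
        simp only [ne_eq, OfNat.ofNat_ne_zero, not_false_eq_true, zero_pow, zero_mul] at this ⊢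
        linarith
      · have := Real.log_le_sub_one_of_pos (show 0 < a ^ 2 / T by positivity)
        have := mul_le_mul_of_nonneg_left this (sq_nonneg a)
        have e : (a ^ 2 - T) ^ 2 / T = a ^ 2 * (a ^ 2 / T - 1) - a ^ 2 + T := by field_simp; ring
        linarith
    have h2 : (a ^ 2 - T) ^ 2 / T ≤ 68 * (a - m) ^ 2 + 2 * v := by
      rw [div_le_iff₀ hTp]
      have k1 : (a + m) ^ 2 ≤ 34 * T := by nlinarith [sq_nonneg (a - m)]
      have k2 := mul_le_mul_of_nonneg_left k1 (sq_nonneg (a - m))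
      have k3 := mul_le_mul_of_nonneg_left hvT hv.le
      have e : a ^ 2 - T = (a - m) * (a + m) - v := by rw [hT]; ring
      rw [e]
      have k4 := sq_nonneg ((a - m) * (a + m) + v)
      linarith
    have : 0 ≤ 3 * ((a - m) ^ 2 * log⁺ ((a - m) ^ 2 / v)) := by positivity
    linarith
  · have h1 : a ^ 2 ≤ 16 / 7 * (a - m) ^ 2 := by nlinarith [sq_nonneg (a - 2 * m)]
    have ha : 0 < a ^ 2 := by linarith
    have hg : 0 < (a - m) ^ 2 := by linarith
    have h2 : Real.log (a ^ 2 / T) ≤ 2 + log⁺ ((a - m) ^ 2 / v) := by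
      calc Real.log (a ^ 2 / T) ≤ Real.log (16 / 7 * ((a - m) ^ 2 / v)) := by
            apply Real.log_le_log (by positivity)
            rw [← mul_div_assoc]
            gcongr
        _ = Real.log (16 / 7) + Real.log ((a - m) ^ 2 / v) := Real.log_mul (by norm_num) (by positivity)
        _ ≤ _ := by
            gcongr
            · have := Real.log_le_sub_one_of_pos (show (0:ℝ) < 16 / 7 by norm_num)
              linarith
            · exact le_max_right _ _
    have h3 : 0 ≤ 2 + log⁺ ((a - m) ^ 2 / v) := by linarith
    have h4 : a ^ 2 * Real.log (a ^ 2 / T) ≤ 16 / 7 * (a - m) ^ 2 * (2 + log⁺ ((a - m) ^ 2 / v)) := by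
      refine (mul_le_mul_of_nonneg_left h2 ha.le).trans ?_
      gcongr
    have h5 : 0 ≤ (a - m) ^ 2 * log⁺ ((a - m) ^ 2 / v) := by positivity
    nlinarith

lemma int_bdd {Ω : Type*} [MeasurableSpace Ω] {μ : Measure Ω} [IsFiniteMeasure μ] {f : Ω → ℝ} (hf : Measurable f)
    {B : ℝ} (hB : ∀ p, |f p| ≤ B) {φ : ℝ → ℝ} (hφ : Continuous φ) : Integrable (fun p => φ (f p)) μ := by
  obtain ⟨C, hC⟩ := (isCompact_Icc (a := -B) (b := B)).exists_bound_of_continuousOn hφ.continuousOn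
  exact Integrable.of_bound (hφ.measurable.comp hf).aestronglyMeasurable C
    (ae_of_all _ fun p => hC _ (abs_le.1 (hB p)))

lemma var_min {Ω : Type*} [MeasurableSpace Ω] {μ : Measure Ω} [IsProbabilityMeasure μ] {f : Ω → ℝ} (hf : Measurable f)
    {B : ℝ} (hB : ∀ p, |f p| ≤ B) (c : ℝ) :
    ∫ p, (f p - c) ^ 2 ∂μ = ∫ p, (f p) ^ 2 ∂μ - 2 * c * ∫ p, f p ∂μ + c ^ 2 := by
  have i1 : Integrable (fun p => f p ^ 2) μ := int_bdd hf hB (φ := fun x => x ^ 2) (by fun_prop)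
  have i2 : Integrable (fun p => f p) μ := int_bdd hf hB (φ := fun x => x) (by fun_prop)
  have : (fun p => (f p - c) ^ 2) = fun p => (f p ^ 2 - 2 * c * f p) + c ^ 2 := by ext p; ring
  have i3 : Integrable (fun p => f p ^ 2 - 2 * c * f p) μ := i1.sub (i2.const_mul _)
  rw [this, integral_add i3 (integrable_const _), integral_sub i1 (i2.const_mul _), integral_const_mul]
  simp

lemma tighten {Ω : Type*} [MeasurableSpace Ω] {μ : Measure Ω} [IsProbabilityMeasure μ] {f : Ω → ℝ} (hf : Measurable f)
    {B : ℝ} (hB : ∀ p, |f p| ≤ B) {m v E C1 C2 : ℝ} (hm : m = ∫ p, f p ∂μ) (hv : v = ∫ p, (f p - m) ^ 2 ∂μ)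
    (hE : 0 ≤ E) (hC1 : 0 ≤ C1) (hC2 : 0 ≤ C2) (hP : v ≤ C1 * E)
    (hL : 0 < v → ∫ p, (f p - m) ^ 2 * log⁺ ((f p - m) ^ 2 / v) ∂μ ≤ C2 * (E + v)) :
    ∫ p, f p ^ 2 * Real.log (f p ^ 2 / ∫ q, f q ^ 2 ∂μ) ∂μ ≤ (70 * C1 + 3 * C2 * (1 + C1) + 1) * E := by
  have hRHS : 0 ≤ (70 * C1 + 3 * C2 * (1 + C1) + 1) * E := by positivity
  set T := ∫ q, f q ^ 2 ∂μ with hT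
  have hvT : T = m ^ 2 + v := by
    rw [hv, var_min hf hB, ← hm]; ring
  have i1 : Integrable (fun p => f p ^ 2) μ := int_bdd hf hB (φ := fun x => x ^ 2) (by fun_prop)
  have i2 : Integrable (fun p => (f p - m) ^ 2) μ := int_bdd hf hB (φ := fun x => (x - m) ^ 2) (by fun_prop)
  have v0 : 0 ≤ v := by rw [hv]; exact integral_nonneg fun p => sq_nonneg _
  rcases v0.eq_or_lt with h0 | hvp
  · have h1 : (fun p => (f p - m) ^ 2) =ᵐ[μ] 0 :=
      (integral_eq_zero_iff_of_nonneg (fun p => sq_nonneg _) i2).1 (by rw [← hv, ← h0])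
    have h2 : ∫ p, f p ^ 2 * Real.log (f p ^ 2 / T) ∂μ = 0 := by
      rw [integral_eq_zero_of_ae]
      filter_upwards [h1] with p hp
      have : f p = m := by
        have : (f p - m) ^ 2 = 0 := hp
        have := pow_eq_zero_iff (two_ne_zero) |>.1 this
        linarith
      rw [this, hvT, ← h0, add_zero]
      by_cases hm0 : m = 0
      · simp [hm0]
      · rw [div_self (by positivity)]; simp
    rw [h2]; exact hRHS
  · by_cases hi : Integrable (fun p => f p ^ 2 * Real.log (f p ^ 2 / T)) μ
    swap
    · rw [integral_undef hi]; exact hRHS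
    have i3 : Integrable (fun p => (f p - m) ^ 2 * log⁺ ((f p - m) ^ 2 / v)) μ :=
      int_bdd hf hB (φ := fun x => (x - m) ^ 2 * log⁺ ((x - m) ^ 2 / v)) (by fun_prop)
    have h1 := integral_mono ((hi.sub i1).add (integrable_const T))
      (((i2.const_mul 68).add (integrable_const (2 * v))).add (i3.const_mul 3))
      (fun p => ptw (f p) m v T hvp hvT)
    rw [integral_add' (hi.sub i1) (integrable_const T), integral_sub' hi i1,
      integral_add' ((i2.const_mul 68).add (integrable_const (2 * v))) (i3.const_mul 3),
      integral_add' (i2.const_mul 68) (integrable_const (2 * v)), integral_const_mul (68:ℝ), integral_const_mul (3:ℝ), ← hv, ← hT] at h1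
    simp only [integral_const, probReal_univ, one_smul] at h1
    have h2 := hL hvp
    have h3 := mul_le_mul_of_nonneg_left hP (by positivity : 0 ≤ 70 + 3 * C2)
    linarith

section
variable {β σ : ℝ} {V V' V'' : ℝ → ℝ} {R2 C0 : ℝ}

lemma exp_ae : (fun p => Real.exp (-(UH β σ V p))) =ᵐ[volume] Wt β σ V := by
  filter_upwards [ae_Om] with p hp
  simp only [Wt, Set.indicator_of_mem hp]; rfl

lemma Hyp.lint_mu (H : Hyp β σ V V' V'' R2 C0) (hZpos : 0 < ∫ p : ℝ × ℝ × ℝ, Real.exp (-(UH β σ V p)))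
    {k : ℝ × ℝ × ℝ → ENNReal} (hk : Measurable k) :
    ∫⁻ p, k p * ENNReal.ofReal (Wt β σ V p) =
      ENNReal.ofReal (∫ p : ℝ × ℝ × ℝ, Real.exp (-(UH β σ V p))) * ∫⁻ p, k p ∂(gibbsP (UH β σ V)) := by
  have mW := H.measW
  unfold gibbsP
  rw [lintegral_smul_measure, smul_eq_mul, ← mul_assoc, ENNReal.mul_inv_cancel (by simpa using hZpos) ENNReal.ofReal_ne_top,
    one_mul]
  have : (volume : Measure (ℝ × ℝ × ℝ)).withDensity (fun p => ENNReal.ofReal (Real.exp (-(UH β σ V p)))) =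
      volume.withDensity (fun p => ENNReal.ofReal (Wt β σ V p)) := by
    apply withDensity_congr_ae
    filter_upwards [exp_ae (β := β) (σ := σ) (V := V)] with p hp
    rw [hp]
  rw [this, lintegral_withDensity_eq_lintegral_mul _ (by fun_prop) hk]
  simp only [Pi.mul_apply, mul_comm]

lemma Hyp.lint_W (_H : Hyp β σ V V' V'' R2 C0) (hZint : Integrable (fun p : ℝ × ℝ × ℝ => Real.exp (-(UH β σ V p)))) :
    ∫⁻ p, ENNReal.ofReal (Wt β σ V p) = ENNReal.ofReal (∫ p : ℝ × ℝ × ℝ, Real.exp (-(UH β σ V p))) := by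
  rw [ofReal_integral_eq_lintegral_ofReal hZint (ae_of_all _ fun p => (Real.exp_pos _).le)]
  apply lintegral_congr_ae
  filter_upwards [exp_ae (β := β) (σ := σ) (V := V)] with p hp
  rw [hp]

lemma Hyp.prob (H : Hyp β σ V V' V'' R2 C0) (hZint : Integrable (fun p : ℝ × ℝ × ℝ => Real.exp (-(UH β σ V p))))
    (hZpos : 0 < ∫ p : ℝ × ℝ × ℝ, Real.exp (-(UH β σ V p))) : IsProbabilityMeasure (gibbsP (UH β σ V)) := by
  have h1 := H.lint_mu hZpos (k := fun _ => 1) measurable_const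
  simp only [one_mul, lintegral_one] at h1
  rw [H.lint_W hZint] at h1
  constructor
  have h0 : ENNReal.ofReal (∫ p : ℝ × ℝ × ℝ, Real.exp (-(UH β σ V p))) ≠ 0 := by simpa using hZpos
  have h2 : ENNReal.ofReal (∫ p : ℝ × ℝ × ℝ, Real.exp (-(UH β σ V p))) * (gibbsP (UH β σ V)) Set.univ =
    ENNReal.ofReal (∫ p : ℝ × ℝ × ℝ, Real.exp (-(UH β σ V p))) * 1 := by rw [← h1, mul_one]
  exact (ENNReal.mul_right_inj h0 ENNReal.ofReal_ne_top).1 h2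

lemma Hyp.main (H : Hyp β σ V V' V'' R2 C0) (hZint : Integrable (fun p : ℝ × ℝ × ℝ => Real.exp (-(UH β σ V p))))
    (hZpos : 0 < ∫ p : ℝ × ℝ × ℝ, Real.exp (-(UH β σ V p))) :
    ∃ c > (0 : ℝ), ∀ f : ℝ × ℝ × ℝ → ℝ, ContDiff ℝ 1 f → HasCompactSupport f →
      ∫ p, (f p) ^ 2 * Real.log ((f p) ^ 2 / ∫ q, (f q) ^ 2 ∂(gibbsP (UH β σ V)))
          ∂(gibbsP (UH β σ V))
        ≤ c * ∫ p, ((X1 f p) ^ 2 + (X2 f p) ^ 2) ∂(gibbsP (UH β σ V)) := by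
  have := H.prob hZint hZpos
  have hWi : ∫⁻ p, ENNReal.ofReal (Wt β σ V p) ≠ ⊤ := by rw [H.lint_W hZint]; exact ENNReal.ofReal_ne_top
  obtain ⟨C1, hC1⟩ := H.poinc hWi
  obtain ⟨C2, hC2⟩ := H.dlsi
  have lm : ∀ {k : ℝ × ℝ × ℝ → ENNReal}, Measurable k → _ := fun {k} hk => H.lint_mu hZpos (k := k) hk
  set Z := ∫ p : ℝ × ℝ × ℝ, Real.exp (-(UH β σ V p)) with hZ
  set μ := gibbsP (UH β σ V) with hμ
  have l0 : 0 ≤ log⁺ Z := Real.posLog_nonneg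
  have c20 : (0:ℝ) ≤ C2 := C2.2
  have c10 : (0:ℝ) ≤ C1 := C1.2
  have mW := H.measW
  -- transfer lemma
  have tr : ∀ h : ℝ × ℝ × ℝ → ℝ, Measurable h → (∀ p, 0 ≤ h p) → Integrable h μ →
      ∫⁻ p, ENNReal.ofReal (h p * Wt β σ V p) = ENNReal.ofReal (Z * ∫ p, h p ∂μ) := by
    intro h mh h0 hi
    rw [ENNReal.ofReal_mul hZpos.le, ofReal_integral_eq_lintegral_ofReal hi (ae_of_all _ h0), ← lm (by fun_prop)]
    congr 1; ext p
    rw [ENNReal.ofReal_mul (h0 p)]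
  refine ⟨70 * C1 + 3 * (C2 + log⁺ Z) * (1 + C1) + 1, by positivity, fun f hf hs => ?_⟩
  obtain ⟨B, hB⟩ := hf.continuous.bounded_above_of_compact_support hs
  have hB : ∀ p, |f p| ≤ B := hB
  have mf := hf.continuous.measurable
  have hgc := continuous_gsq hf
  have hgs : HasCompactSupport (gsq f) := by
    refine (hs.fderiv ℝ).mono ?_
    intro p hp
    simp only [Function.mem_support] at hp ⊢
    intro h
    apply hp
    simp [gsq, X1, X2, h]
  obtain ⟨B', hB'⟩ := hgc.bounded_above_of_compact_support hgs
  set E := ∫ p, gsq f p ∂μ with hE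
  have E0 : 0 ≤ E := integral_nonneg (gsq_nonneg f)
  have igs : Integrable (gsq f) μ := Integrable.of_bound hgc.aestronglyMeasurable B' (ae_of_all _ hB')
  have hEn : En (Wt β σ V) f = ENNReal.ofReal (Z * E) := by
    rw [← tr (gsq f) hgc.measurable (gsq_nonneg f) igs]
    unfold En
    simp only [mul_comm]
  set m := ∫ p, f p ∂μ with hm
  set v := ∫ p, (f p - m) ^ 2 ∂μ with hv
  have ic : ∀ c : ℝ, Integrable (fun p => (f p - c) ^ 2) μ := fun c => int_bdd mf hB (φ := fun x => (x - c) ^ 2) (by fun_prop)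
  have v0 : 0 ≤ v := integral_nonneg fun p => sq_nonneg _
  have trc : ∀ c : ℝ, ∫⁻ p, ENNReal.ofReal ((f p - c) ^ 2 * Wt β σ V p) = ENNReal.ofReal (Z * ∫ p, (f p - c) ^ 2 ∂μ) :=
    fun c => tr _ (by fun_prop) (fun p => sq_nonneg _) (ic c)
  have hP : v ≤ C1 * E := by
    have h1 := hC1 f hf B hB (ENNReal.ofReal (Z * v)) (by
      intro c
      rw [trc]
      apply ENNReal.ofReal_le_ofReal
      gcongr Z * ?_
      rw [var_min mf hB, var_min mf hB, ← hm]
      nlinarith [sq_nonneg (m - c)])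
    rw [hEn, ← ENNReal.ofReal_coe_nnreal, ← ENNReal.ofReal_mul c10, ENNReal.ofReal_le_ofReal_iff (by positivity)] at h1
    have : Z * v ≤ Z * (C1 * E) := by linarith
    exact le_of_mul_le_mul_left this hZpos
  have hL : 0 < v → ∫ p, (f p - m) ^ 2 * log⁺ ((f p - m) ^ 2 / v) ∂μ ≤ (C2 + log⁺ Z) * (E + v) := by
    intro hvp
    have hw : 0 < Z * v := by positivity
    have h1 := hC2 (fun p => f p - m) (hf.sub contDiff_const) (Z * v) hw (trc m).le
    have iw : ∀ w : ℝ, Integrable (fun p => (f p - m) ^ 2 * log⁺ ((f p - m) ^ 2 / w)) μ := fun w =>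
      int_bdd mf hB (φ := fun x => (x - m) ^ 2 * log⁺ ((x - m) ^ 2 / w)) (by fun_prop)
    have mw : ∀ w : ℝ, Measurable (fun p => (f p - m) ^ 2 * log⁺ ((f p - m) ^ 2 / w)) := fun w =>
      (by fun_prop : Continuous fun x : ℝ => (x - m) ^ 2 * log⁺ ((x - m) ^ 2 / w)).measurable.comp mf
    rw [tr _ (mw (Z * v)) (fun p => mul_nonneg (sq_nonneg _) Real.posLog_nonneg) (iw _), En_sub_const, hEn, trc m, ← hv,
      ← ENNReal.ofReal_add (by positivity) (by positivity), ← ENNReal.ofReal_coe_nnreal, ← ENNReal.ofReal_mul c20,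
      ENNReal.ofReal_le_ofReal_iff (by positivity)] at h1
    have h2 : ∫ p, (f p - m) ^ 2 * log⁺ ((f p - m) ^ 2 / (Z * v)) ∂μ ≤ C2 * (E + v) := by
      refine le_of_mul_le_mul_left ?_ hZpos
      linarith
    have h3 : ∫ p, (f p - m) ^ 2 * log⁺ ((f p - m) ^ 2 / v) ∂μ ≤
        ∫ p, ((f p - m) ^ 2 * log⁺ ((f p - m) ^ 2 / (Z * v)) + log⁺ Z * (f p - m) ^ 2) ∂μ := by
      refine integral_mono (iw v) ((iw _).add ((ic m).const_mul _)) fun p => ?_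
      have e : (f p - m) ^ 2 / v = (f p - m) ^ 2 / (Z * v) * Z := by field_simp
      have := mul_le_mul_of_nonneg_left (Real.posLog_mul (x := (f p - m) ^ 2 / (Z * v)) (y := Z)) (sq_nonneg (f p - m))
      rw [← e] at this
      simp only
      linarith
    rw [integral_add (iw _) ((ic m).const_mul _), integral_const_mul, ← hv] at h3
    have h4 : 0 ≤ log⁺ Z * E := by positivity
    linarith
  exact tighten mf hB hm hv E0 c10 (by positivity) hP hL

end
end HeisLSI

theorem heisenberg_additive_taming_logSobolev
    (β σ : ℝ) (hβ : 0 < β) (hσ : 0 < σ)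
    (V V' V'' : ℝ → ℝ)
    (hVnonneg : ∀ s > (0 : ℝ), 0 ≤ V s)
    (hVmono : StrictMonoOn V (Set.Ioi (0 : ℝ)))
    (hV' : ∀ s > (0 : ℝ), HasDerivAt V (V' s) s)
    (hV'' : ∀ s > (0 : ℝ), HasDerivAt V' (V'' s) s)
    (hRBD : ∃ R > (0 : ℝ), ∃ B > (0 : ℝ), ∃ D > (0 : ℝ),
      ∀ s ≥ R, D * s ^ 7 ≤ V' s ∧ B * V s ≤ s * V' s)
    (hV''pos : ∃ R₁ : ℝ, ∀ s ≥ R₁, 0 < V'' s)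
    (hratio : Tendsto (fun s => (V' s) ^ 2 / V'' s) atTop atTop)
    (hZint : Integrable (fun p : ℝ × ℝ × ℝ => Real.exp (-(UH β σ V p))))
    (hZpos : 0 < ∫ p : ℝ × ℝ × ℝ, Real.exp (-(UH β σ V p))) :
    ∃ c > (0 : ℝ), ∀ f : ℝ × ℝ × ℝ → ℝ, ContDiff ℝ (⊤ : ℕ∞) f → HasCompactSupport f →
      ∫ p, (f p) ^ 2 * Real.log ((f p) ^ 2 / ∫ q, (f q) ^ 2 ∂(gibbsP (UH β σ V)))
          ∂(gibbsP (UH β σ V))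
        ≤ c * ∫ p, ((X1 f p) ^ 2 + (X2 f p) ^ 2) ∂(gibbsP (UH β σ V)) := by
  obtain ⟨R2, C0, H⟩ := HeisLSI.hyp_of hβ hσ hVnonneg hVmono hV' hV'' hRBD hV''pos hratio
  obtain ⟨c, hc, h⟩ := H.main hZint hZpos
  exact ⟨c, hc, fun f hf hs => h f (hf.of_le (by exact_mod_cast le_top)) hs⟩
end

section
/- Let β, σ ∈ (0,∞) and ξ(x) = |x|^{−σ}. For every point (x₁,x₂,z) of the Heisenberg group with x = (x₁,x₂) ≠ 0, the sub-gradient ∇(βN + ξ) vanishes at (x,z) if and only if z = 0 and |x| = (σ/β)^{1/(1+σ)}. In particular, ∇(βN + ξ) has no zeros outside a compact subset of ℝ³. -/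
open Real MeasureTheory Filter

/-- The function `β N + ξ`, where `ξ(x) = |x|^(−σ)`. -/
noncomputable def GH (β σ : ℝ) (p : ℝ × ℝ × ℝ) : ℝ :=
  β * NH p + Real.sqrt (p.1 ^ 2 + p.2.1 ^ 2) ^ (-σ)

theorem GH_fderiv (β σ : ℝ) (p : ℝ × ℝ × ℝ) (hr : 0 < p.1 ^ 2 + p.2.1 ^ 2) (v : ℝ × ℝ × ℝ) :
    fderiv ℝ (GH β σ) p v =
      β * ((1 / 4 : ℝ) * ((p.1 ^ 2 + p.2.1 ^ 2) ^ 2 + 16 * p.2.2 ^ 2) ^ ((1 / 4 : ℝ) - 1) *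
        (2 * (p.1 ^ 2 + p.2.1 ^ 2) * (2 * p.1 * v.1 + 2 * p.2.1 * v.2.1) + 32 * p.2.2 * v.2.2))
      + (-σ) * Real.sqrt (p.1 ^ 2 + p.2.1 ^ 2) ^ (-σ - 1) *
        (1 / (2 * Real.sqrt (p.1 ^ 2 + p.2.1 ^ 2)) * (2 * p.1 * v.1 + 2 * p.2.1 * v.2.1)) := by
  have ha : HasFDerivAt (fun q : ℝ × ℝ × ℝ => q.1) (ContinuousLinearMap.fst ℝ ℝ (ℝ × ℝ)) p :=
    hasFDerivAt_fst
  have hbc : HasFDerivAt (fun q : ℝ × ℝ × ℝ => q.2) (ContinuousLinearMap.snd ℝ ℝ (ℝ × ℝ)) p :=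
    hasFDerivAt_snd
  have hb := hbc.fst
  have hc := hbc.snd
  have hR := (ha.pow 2).add (hb.pow 2)
  have hU := (hR.pow 2).add ((hc.pow 2).const_mul 16)
  have hu : ((p.1 ^ 2 + p.2.1 ^ 2) ^ 2 + 16 * p.2.2 ^ 2) ≠ 0 := by positivity
  have hs : Real.sqrt (p.1 ^ 2 + p.2.1 ^ 2) ≠ 0 := (Real.sqrt_pos.2 hr).ne'
  have hN := (Real.hasDerivAt_rpow_const (p := (1 : ℝ) / 4) (Or.inl hu)).comp_hasFDerivAt p hU
  have hS := (Real.hasDerivAt_sqrt hr.ne').comp_hasFDerivAt p hR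
  have hX := (Real.hasDerivAt_rpow_const (p := -σ) (Or.inl hs)).comp_hasFDerivAt p hS
  have hG : HasFDerivAt (GH β σ) _ p := (hN.const_mul β).add hX
  rw [hG.fderiv]
  simp
  ring

theorem gradient_zeros_of_additively_tamed_potential (β σ : ℝ) (hβ : 0 < β) (hσ : 0 < σ) :
    (∀ p : ℝ × ℝ × ℝ, (p.1, p.2.1) ≠ (0, 0) →
      ((X1 (GH β σ) p = 0 ∧ X2 (GH β σ) p = 0) ↔
        (p.2.2 = 0 ∧ Real.sqrt (p.1 ^ 2 + p.2.1 ^ 2) = (σ / β) ^ ((1 : ℝ) / (1 + σ))))) ∧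
    (∃ K : Set (ℝ × ℝ × ℝ), IsCompact K ∧
      ∀ p : ℝ × ℝ × ℝ, (p.1, p.2.1) ≠ (0, 0) →
        (X1 (GH β σ) p = 0 ∧ X2 (GH β σ) p = 0) → p ∈ K) := by
  have main : ∀ p : ℝ × ℝ × ℝ, (p.1, p.2.1) ≠ (0, 0) →
      ((X1 (GH β σ) p = 0 ∧ X2 (GH β σ) p = 0) ↔
        (p.2.2 = 0 ∧ Real.sqrt (p.1 ^ 2 + p.2.1 ^ 2) = (σ / β) ^ ((1 : ℝ) / (1 + σ)))) := by
    rintro ⟨a, b, z⟩ hp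
    have hr : 0 < a ^ 2 + b ^ 2 := by
      by_contra h
      apply hp
      have h1 : a = 0 := by nlinarith [sq_nonneg a, sq_nonneg b]
      have h2 : b = 0 := by nlinarith [sq_nonneg a, sq_nonneg b]
      simp [h1, h2]
    unfold X1 X2
    simp only [GH_fderiv β σ (a, b, z) hr]
    have hs : 0 < Real.sqrt (a ^ 2 + b ^ 2) := Real.sqrt_pos.2 hr
    have hs2 : Real.sqrt (a ^ 2 + b ^ 2) ^ 2 = a ^ 2 + b ^ 2 := Real.sq_sqrt hr.le
    set s := Real.sqrt (a ^ 2 + b ^ 2) with hsdef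
    have hW : 0 < ((a ^ 2 + b ^ 2) ^ 2 + 16 * z ^ 2) ^ ((1 / 4 : ℝ) - 1) := by positivity
    have hW0 : z = 0 → ((a ^ 2 + b ^ 2) ^ 2 + 16 * z ^ 2) ^ ((1 / 4 : ℝ) - 1) = (s ^ 3)⁻¹ := by
      intro hz
      rw [hz, ← hs2]
      have : (s ^ 2) ^ 2 + 16 * (0 : ℝ) ^ 2 = s ^ (4 : ℝ) := by
        norm_cast; ring
      rw [this, ← Real.rpow_mul hs.le, ← Real.rpow_natCast, ← Real.rpow_neg hs.le]
      norm_num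
    generalize ((a ^ 2 + b ^ 2) ^ 2 + 16 * z ^ 2) ^ ((1 / 4 : ℝ) - 1) = W at hW hW0 ⊢
    have hT : s ^ (-σ - 1) = (s ^ (1 + σ))⁻¹ := by
      rw [← Real.rpow_neg hs.le]; ring_nf
    have hP : 0 < s ^ (1 + σ) := by positivity
    have key : s = (σ / β) ^ ((1 : ℝ) / (1 + σ)) ↔ β * s ^ (1 + σ) = σ := by
      rw [one_div, Real.eq_rpow_inv hs.le (by positivity) (by positivity), eq_div_iff hβ.ne',
        mul_comm]
    rw [hT]
    simp only [key]
    generalize s ^ (1 + σ) = P at hP ⊢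
    have e : ∀ t : ℝ, 1 / (2 * s) * (2 * t) = t / s := by intro t; field_simp
    constructor
    · rintro ⟨h1, h2⟩
      have hz : z = 0 := by
        have : β * W * z * (a ^ 2 + b ^ 2) = 0 := by
          linear_combination (b * h1 - a * h2) / 4
        simpa [hβ.ne', hW.ne', hr.ne'] using this
      refine ⟨hz, ?_⟩
      rw [hW0 hz, hz, ← hs2] at h1 h2
      have h3 : (a ^ 2 + b ^ 2) * (β / s - σ / (P * s)) = 0 := by
        have : β / s = β * (s ^ 3)⁻¹ * s ^ 2 := by field_simp
        rw [this]
        linear_combination a * h1 + b * h2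
      have h4 := (mul_eq_zero.1 h3).resolve_left hr.ne'
      field_simp at h4
      linarith
    · rintro ⟨hz, h⟩
      rw [hW0 hz, hz, ← hs2, ← h]
      constructor <;> (field_simp; ring)
  refine ⟨main, Set.Icc (-((σ / β) ^ ((1 : ℝ) / (1 + σ)))) ((σ / β) ^ ((1 : ℝ) / (1 + σ))) ×ˢ
    Set.Icc (-((σ / β) ^ ((1 : ℝ) / (1 + σ)))) ((σ / β) ^ ((1 : ℝ) / (1 + σ))) ×ˢ {0},
    isCompact_Icc.prod (isCompact_Icc.prod isCompact_singleton), ?_⟩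
  intro p hp h
  obtain ⟨hz, hs⟩ := (main p hp).1 h
  rw [← hs]
  refine ⟨?_, ?_, hz⟩
  · exact abs_le.1 (Real.abs_le_sqrt (by nlinarith [sq_nonneg p.2.1]))
  · exact abs_le.1 (Real.abs_le_sqrt (by nlinarith [sq_nonneg p.1]))
end
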